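/- arXiv:1102.4834 — 4 statements merged into one kernel-verified Lean document; each statement's English description precedes it below -/
import Mathlib

section
/- Let a>1, b>1, c>0, r>0, s>0 be integers with gcd(ra, sb)=1. If the equation (-1)^u·r·a^x + (-1)^v·s·b^y = c has more than two solutions (x,y,u,v) with x,y positive integers and u,v ∈ {0,1}, then a < 8·10^14, b < 8·10^14, r < 8·10^14, s < 8·10^14, and every solution (x,y,u,v) satisfies x < 8·10^14 and y < 8·10^14. (Consequently the equation has at most two such solutions except for a finite number of cases that can be found in a finite number of steps.) -/
/-- A solution of equation (1): `(-1)^u * r * a^x + (-1)^v * s * b^y = c`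
with `x, y` positive integers and `u, v ∈ {0,1}`. -/
def IsSol (a b c r s : ℤ) (x y : ℕ) : Prop :=
  0 < x ∧ 0 < y ∧ ∃ u v : ℕ, u ≤ 1 ∧ v ≤ 1 ∧
    (-1 : ℤ) ^ u * r * a ^ x + (-1 : ℤ) ^ v * s * b ^ y = c

lemma sum_range_le_sum_of_card_le {ι : Type*} [Fintype ι] (w : ι → ℕ)
    (h : ∀ k < Fintype.card ι, (Finset.univ.filter fun i => w i ≤ k).card ≤ k + 1) :
    ∑ k ∈ Finset.range (Fintype.card ι), k ≤ ∑ i, w i := by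
  set n := Fintype.card ι with hn
  have hmin : ∀ i, ∑ k ∈ Finset.range n, (if k < w i then 1 else 0) ≤ w i := by
    intro i
    rw [← Finset.card_filter]
    calc _ ≤ (Finset.range (w i)).card := Finset.card_le_card fun k => by simp
      _ = w i := Finset.card_range _
  calc ∑ k ∈ Finset.range n, k = ∑ k ∈ Finset.range n, (n - 1 - k) :=
        (Finset.sum_range_reflect _ _).symm
    _ ≤ ∑ k ∈ Finset.range n, ∑ i, (if k < w i then 1 else 0) := by
        refine Finset.sum_le_sum fun k hk => ?_
        rw [← Finset.card_filter]
        have h1 := h k (Finset.mem_range.1 hk)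
        have h2 := Finset.card_filter_add_card_filter_not (s := (Finset.univ : Finset ι))
          (fun i => w i ≤ k)
        rw [Finset.card_univ, ← hn] at h2
        have h3 : (Finset.univ.filter fun i => ¬ w i ≤ k) = Finset.univ.filter fun i => k < w i :=
          Finset.filter_congr fun i _ => by omega
        rw [h3] at h2
        omega
    _ = ∑ i, ∑ k ∈ Finset.range n, (if k < w i then 1 else 0) := Finset.sum_comm
    _ ≤ ∑ i, w i := Finset.sum_le_sum fun i _ => hmin i

lemma pow_dvd_det_of_eq_sum {ι : Type*} [Fintype ι] [DecidableEq ι] {n : ℕ}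
    (hn : Fintype.card ι = n) (q : ℤ) (A : Matrix ι ι ℤ) (b : ι → Fin n → ℤ)
    (g : Fin n → ι → ℤ) (w : ι → ι → ℤ)
    (hA : ∀ i c, A i c = ∑ j, b i j * (q ^ (j : ℕ) * g j c) + q ^ n * w i c) :
    q ^ (∑ k ∈ Finset.range n, k) ∣ A.det := by
  let wt : Fin n ⊕ ι → ℕ := Sum.elim (fun j => j) (fun _ => n)
  let cf : ι → Fin n ⊕ ι → ℤ := fun i => Sum.elim (b i) (fun t => if t = i then 1 else 0)
  let vec : Fin n ⊕ ι → ι → ℤ := Sum.elim g w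
  have hrow : A = fun i => ∑ t, (cf i t * q ^ wt t) • vec t := by
    funext i c
    simp [hA, Fintype.sum_sum_type, cf, wt, vec, mul_assoc]
  have hdet : A.det = ∑ f : ι → Fin n ⊕ ι,
      (∏ i, (cf i (f i) * q ^ wt (f i))) • Matrix.det (fun i => vec (f i)) := by
    have h1 := MultilinearMap.map_sum (Matrix.detRowAlternating (n := ι) (R := ℤ)).toMultilinearMap
      (fun i t => (cf i t * q ^ wt t) • vec t)
    have h2 : A.det = (Matrix.detRowAlternating (n := ι) (R := ℤ)).toMultilinearMap
        (fun i => ∑ t, (cf i t * q ^ wt t) • vec t) := by rw [← hrow]; rfl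
    rw [h2, h1]
    refine Finset.sum_congr rfl fun f _ => ?_
    rw [MultilinearMap.map_smul_univ]
    rfl
  rw [hdet]
  refine Finset.dvd_sum fun f _ => ?_
  by_cases hf : Function.Injective f
  · rw [smul_eq_mul, Finset.prod_mul_distrib, Finset.prod_pow_eq_pow_sum]
    refine Dvd.dvd.mul_right (Dvd.dvd.mul_left (pow_dvd_pow q ?_) _) _
    rw [← hn]
    refine sum_range_le_sum_of_card_le (fun i => wt (f i)) fun k hk => ?_
    rw [hn] at hk
    rw [← Finset.card_image_of_injective _ hf]
    calc _ ≤ ((Finset.range (k + 1)).attach.image fun j : {x // x ∈ Finset.range (k + 1)} =>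
          (Sum.inl ⟨j.1, by have := Finset.mem_range.1 j.2; omega⟩ : Fin n ⊕ ι)).card := by
            refine Finset.card_le_card fun t ht => ?_
            obtain ⟨i, hi, rfl⟩ := Finset.mem_image.1 ht
            have hi := (Finset.mem_filter.1 hi).2
            cases h : f i with
            | inl j =>
              simp only [h, wt, Sum.elim_inl] at hi
              exact Finset.mem_image.2 ⟨⟨j, Finset.mem_range.2 (by omega)⟩,
                Finset.mem_attach _ _, rfl⟩
            | inr t =>
              simp only [h, wt, Sum.elim_inr] at hi
              omega
      _ ≤ k + 1 := Finset.card_image_le.trans (by simp)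
  · obtain ⟨i, j, hij, hne⟩ : ∃ i j, f i = f j ∧ i ≠ j := by
      simpa [Function.Injective] using hf
    have h0 : Matrix.det (fun i => vec (f i)) = 0 :=
      Matrix.det_zero_of_row_eq hne (by rw [hij])
    rw [h0, smul_zero]
    exact dvd_zero _

lemma abs_det_le_factorial_mul_prod {ι : Type*} [Fintype ι] [DecidableEq ι]
    (A : Matrix ι ι ℤ) (B : ι → ℤ) (h : ∀ i c, |A i c| ≤ B c) :
    |A.det| ≤ (Fintype.card ι).factorial * ∏ c, B c := by
  rw [Matrix.det_apply]
  calc _ ≤ ∑ σ : Equiv.Perm ι, |Equiv.Perm.sign σ • ∏ i, A (σ i) i| :=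
        Finset.abs_sum_le_sum_abs _ _
    _ ≤ ∑ _σ : Equiv.Perm ι, ∏ c, B c := by
        refine Finset.sum_le_sum fun σ _ => ?_
        have hsign : |((Equiv.Perm.sign σ : ℤˣ) : ℤ)| = 1 := by
          rcases Int.units_eq_one_or (Equiv.Perm.sign σ) with h | h <;> simp [h]
        rw [Units.smul_def, smul_eq_mul, abs_mul, hsign, one_mul, Finset.abs_prod]
        exact Finset.prod_le_prod (fun _ _ => abs_nonneg _) fun i _ => h _ _
    _ = _ := by simp [Fintype.card_perm]

lemma exists_det_submatrix_ne_zero {P C F : Type*} [Fintype P] [Fintype C] [DecidableEq C]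
    [Field F] (M : Matrix P C F) (h : ∀ v, M.mulVec v = 0 → v = 0) :
    ∃ f : C → P, (M.submatrix f id).det ≠ 0 := by
  have hrank : M.rank = Fintype.card C := by
    have hker : LinearMap.ker M.mulVecLin = ⊥ := by
      rw [LinearMap.ker_eq_bot']
      exact fun v hv => h v (by simpa using hv)
    have := LinearMap.finrank_range_add_finrank_ker M.mulVecLin
    rw [hker, finrank_bot, add_zero, Module.finrank_fintype_fun_eq_card] at this
    exact this
  rw [Matrix.rank_eq_finrank_span_row] at hrank
  obtain ⟨b, hb, hspan, hli⟩ := exists_linearIndependent F (Set.range M.row)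
  have hbfin : b.Finite := (Set.finite_range _).subset hb
  have : Fintype b := hbfin.fintype
  rw [← hspan] at hrank
  have hcard : Fintype.card b = Fintype.card C := by
    rw [← hrank, ← finrank_span_eq_card hli, Subtype.range_coe]
  obtain ⟨e⟩ := Fintype.card_eq.1 hcard
  choose f hf using fun c => hb (e.symm c).2
  refine ⟨f, ?_⟩
  have hrows : LinearIndependent F (M.submatrix f id).row := by
    have : (M.submatrix f id).row = (Subtype.val : b → C → F) ∘ e.symm := by
      funext c
      exact hf c
    rw [this]
    exact hli.comp _ e.symm.injective
  have := (Matrix.linearIndependent_rows_iff_isUnit.1 hrows)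
  exact ((Matrix.isUnit_iff_isUnit_det _).1 this).ne_zero

open Polynomial in
lemma det_shift_ne_zero {m : ℕ} (P : Fin m → ℚ[X]) (hP : ∀ l, P l ≠ 0) (θ : Fin m → ℚ)
    (hθ : Function.Injective θ) (hθ0 : ∀ l, θ l ≠ 0) :
    (Matrix.of fun t l : Fin m => (P l).comp (X + C (t : ℚ)) * C (θ l ^ (t : ℕ))).det ≠ 0 := by
  set D := Matrix.of fun t l : Fin m => (P l).comp (X + C (t : ℚ)) * C (θ l ^ (t : ℕ)) with hD
  have hdeg : ∀ t l, (D t l).natDegree = (P l).natDegree := fun t l => by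
    rw [hD, Matrix.of_apply, natDegree_mul_C (pow_ne_zero _ (hθ0 l)), natDegree_comp,
      natDegree_X_add_C, mul_one]
  have hlead : ∀ t l, (D t l).leadingCoeff = (P l).leadingCoeff * θ l ^ (t : ℕ) := fun t l => by
    rw [hD, Matrix.of_apply, leadingCoeff_mul, leadingCoeff_comp
      (by rw [natDegree_X_add_C]; exact one_ne_zero), leadingCoeff_X_add_C, one_pow, mul_one,
      leadingCoeff_C]
  have hne : ∀ t l, D t l ≠ 0 := fun t l => by
    rw [← leadingCoeff_ne_zero, hlead]
    exact mul_ne_zero (leadingCoeff_ne_zero.2 (hP l)) (pow_ne_zero _ (hθ0 l))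
  have hcoeff : D.det.coeff (∑ l, (P l).natDegree) =
      (Matrix.of fun t l : Fin m =>
        (P l).leadingCoeff * (Matrix.vandermonde θ).transpose t l).det := by
    rw [Matrix.det_apply, Matrix.det_apply, finsetSum_coeff]
    refine Finset.sum_congr rfl fun σ _ => ?_
    have h1 : (∏ i, D (σ i) i).natDegree = ∑ l, (P l).natDegree := by
      rw [natDegree_prod _ _ fun i _ => hne _ _]
      exact Finset.sum_congr rfl fun i _ => hdeg _ _
    rw [Units.smul_def, Units.smul_def, coeff_smul, ← h1, coeff_natDegree, leadingCoeff_prod]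
    congr 1
    exact Finset.prod_congr rfl fun i _ => by simp [hlead, Matrix.vandermonde]
  intro h0
  rw [h0, Matrix.det_mul_row, Matrix.det_transpose, coeff_zero] at hcoeff
  exact mul_ne_zero (Finset.prod_ne_zero_iff.2 fun l _ => leadingCoeff_ne_zero.2 (hP l))
    (Matrix.det_vandermonde_ne_zero_iff.2 hθ) hcoeff.symm

open Polynomial in
lemma natDegree_det_le_of_natDegree_le {m d : ℕ} (D : Matrix (Fin m) (Fin m) ℚ[X])
    (h : ∀ i j, (D i j).natDegree ≤ d) : D.det.natDegree ≤ m * d := by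
  rw [Matrix.det_apply]
  refine natDegree_sum_le_of_forall_le _ _ fun σ _ => ?_
  rw [Units.smul_def]
  refine (natDegree_smul_le _ _).trans ((natDegree_prod_le _ _).trans ?_)
  calc _ ≤ ∑ _i : Fin m, d := Finset.sum_le_sum fun i _ => h _ _
    _ = _ := by simp

open Polynomial in
lemma eq_zero_of_sum_eval_mul_pow_eq_zero {K L R S N : ℕ} (P : Fin L → ℚ[X])
    (hdeg : ∀ l, (P l).natDegree ≤ K) (θ : Fin L → ℚ) (hθ : Function.Injective θ)
    (hθ0 : ∀ l, θ l ≠ 0) (w : ℕ → Fin L → ℚ) (hw : ∀ j l, w j l ≠ 0) (hRN : R ≤ N)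
    (hRS : L * K < R * S)
    (h : ∀ i < R + L, ∀ j < S, ∑ l, (P l).eval ((i + N * j : ℕ) : ℚ) * θ l ^ i * w j l = 0) :
    ∀ l, P l = 0 := by
  by_contra hne
  set I : Finset (Fin L) := Finset.univ.filter fun l => P l ≠ 0 with hI
  set m := I.card with hm
  have hmL : m ≤ L := (Finset.card_le_univ _).trans (by simp)
  have hm0 : 0 < m := by
    push Not at hne
    obtain ⟨l, hl⟩ := hne
    exact Finset.card_pos.2 ⟨l, by simp [hI, hl]⟩
  let e : Fin m ≃ I := (I.orderIsoOfFin rfl).toEquiv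
  have heP : ∀ t, P (e t) ≠ 0 := fun t => (Finset.mem_filter.1 (e t).2).2
  have hsumI : ∀ f : Fin L → ℚ, (∀ l, P l = 0 → f l = 0) → ∑ t, f (e t) = ∑ l, f l := by
    intro f hf
    rw [e.sum_comp (fun x : I => f x), Finset.sum_coe_sort I f]
    refine Finset.sum_subset (Finset.subset_univ _) fun l _ hl => hf l ?_
    simpa [hI] using hl
  set D := Matrix.of fun t l : Fin m =>
    (P (e l)).comp (X + C (t : ℚ)) * C (θ (e l) ^ (t : ℕ)) with hD
  have hD0 : D.det ≠ 0 := det_shift_ne_zero (fun t => P (e t)) heP (fun t => θ (e t))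
    (hθ.comp (Subtype.val_injective.comp e.injective)) fun t => hθ0 _
  have hDdeg : D.det.natDegree ≤ m * K := natDegree_det_le_of_natDegree_le D fun t l => by
    rw [hD, Matrix.of_apply, natDegree_mul_C (pow_ne_zero _ (hθ0 _)), natDegree_comp,
      natDegree_X_add_C, mul_one]
    exact hdeg _
  refine hD0 (eq_zero_of_natDegree_lt_card_of_eval_eq_zero D.det
    (f := fun p : Fin R × Fin S => (((p.1 : ℕ) + N * (p.2 : ℕ) : ℕ) : ℚ)) ?_ ?_ ?_)
  · intro p p' hpp
    have hpp : (p.1 : ℕ) + N * p.2 = p'.1 + N * p'.2 := by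
      simp only at hpp
      exact_mod_cast hpp
    have h1 : (p.1 : ℕ) = p'.1 := by
      have := congrArg (· % N) hpp
      simpa [Nat.mod_eq_of_lt (p.1.2.trans_le hRN), Nat.mod_eq_of_lt (p'.1.2.trans_le hRN)]
        using this
    have hN : 0 < N := p.1.pos.trans_le hRN
    have h2 : (p.2 : ℕ) = p'.2 := by
      rw [h1] at hpp
      exact Nat.eq_of_mul_eq_mul_left hN (Nat.add_left_cancel hpp)
    exact Prod.ext (Fin.ext h1) (Fin.ext h2)
  · rintro ⟨i, j⟩
    rw [← coe_evalRingHom, RingHom.map_det]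
    refine Matrix.exists_mulVec_eq_zero_iff.1
      ⟨fun l => θ (e l) ^ (i : ℕ) * w j (e l), ?_, ?_⟩
    · intro h0
      exact mul_ne_zero (pow_ne_zero _ (hθ0 _)) (hw _ _) (congrFun h0 ⟨0, hm0⟩)
    · funext t
      have h1 := h (i + t) (by have := i.2; have := t.2; omega) j j.2
      rw [← hsumI _ (fun l hl => by simp [hl])] at h1
      rw [Pi.zero_apply, ← h1, Matrix.mulVec, dotProduct]
      refine Finset.sum_congr rfl fun l _ => ?_
      simp only [RingHom.mapMatrix_apply, Matrix.map_apply, hD, Matrix.of_apply,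
        coe_evalRingHom, eval_mul, eval_comp, eval_add, eval_X, eval_C]
      rw [pow_add]
      have : ((i : ℕ) + N * (j : ℕ) : ℕ) + (t : ℚ) = (((i : ℕ) + t + N * j : ℕ) : ℚ) := by
        push_cast; ring
      rw [this]
      ring
  · rw [Fintype.card_prod, Fintype.card_fin, Fintype.card_fin]
    exact hDdeg.trans_lt ((Nat.mul_le_mul_right _ hmL).trans_lt hRS)

open Polynomial in
/-- The polynomial with value `Nat.choose u k` at the natural number `u`. -/
noncomputable def choosePoly (k : ℕ) : ℚ[X] :=
  C ((k.factorial : ℚ)⁻¹) * descPochhammer ℚ k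

open Polynomial in
lemma choosePoly_eval (k u : ℕ) : (choosePoly k).eval (u : ℚ) = (u.choose k : ℚ) := by
  rw [choosePoly, eval_mul, eval_C, descPochhammer_eval_eq_descFactorial,
    Nat.descFactorial_eq_factorial_mul_choose, Nat.cast_mul, inv_mul_cancel_left₀]
  exact_mod_cast k.factorial_ne_zero

open Polynomial in
lemma choosePoly_natDegree_le (k : ℕ) : (choosePoly k).natDegree ≤ k :=
  (natDegree_C_mul_le _ _).trans (descPochhammer_natDegree ℚ k).le

open Polynomial in
lemma eq_zero_of_sum_choosePoly_eq_zero {K : ℕ} (v : Fin K → ℚ)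
    (h : ∑ k : Fin K, C (v k) * choosePoly k = 0) : ∀ k, v k = 0 := by
  suffices H : ∀ n : ℕ, ∀ hn : n < K, v ⟨n, hn⟩ = 0 from fun k => H k k.2
  intro n
  induction n using Nat.strong_induction_on with
  | _ n ih =>
    intro hn
    have h1 := congrArg (eval (n : ℚ)) h
    rw [eval_finsetSum, eval_zero, Finset.sum_eq_single_of_mem ⟨n, hn⟩ (Finset.mem_univ _)] at h1
    · simpa [choosePoly_eval] using h1
    · intro k _ hk
      have hkn : (k : ℕ) ≠ n := fun h => hk (Fin.ext h)
      rw [eval_mul, eval_C, choosePoly_eval]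
      rcases lt_or_gt_of_ne hkn with h2 | h2
      · rw [show v k = 0 from ih k h2 k.2, zero_mul]
      · rw [Nat.choose_eq_zero_of_lt h2, Nat.cast_zero, mul_zero]

/-- An interpolation determinant with entries `u.choose k * β ^ (l i) * γ₁ ^ (l j) * ...`,
where `u = i + N * j`. -/
lemma exists_interpolation_det_ne_zero {K L R S N : ℕ} {β γ₁ γ₂ : ℤ} (hβ : 1 < |β|)
    (h₁ : γ₁ ≠ 0) (h₂ : γ₂ ≠ 0) (hRN : R ≤ N) (hRS : L * (K - 1) < R * S) :
    ∃ f : Fin K × Fin L → Fin (R + L) × Fin S,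
      (Matrix.of fun p c : Fin K × Fin L =>
        ((((f p).1 : ℕ) + N * (f p).2 : ℕ).choose c.1 : ℤ) * (β ^ (c.2 : ℕ)) ^ ((f p).1 : ℕ) *
          (γ₁ ^ ((f p).2 : ℕ) * γ₂ ^ (S - 1 - (f p).2)) ^ (c.2 : ℕ)).det ≠ 0 := by
  have hβ0 : (β : ℚ) ≠ 0 := by
    intro h
    rw [Int.cast_eq_zero.1 h] at hβ
    simp at hβ
  have h₁' : (γ₁ : ℚ) ≠ 0 := by exact_mod_cast h₁
  have h₂' : (γ₂ : ℚ) ≠ 0 := by exact_mod_cast h₂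
  have hinj : Function.Injective fun l : Fin L => (β : ℚ) ^ (l : ℕ) := by
    intro l l' hll
    have h1 : |(β : ℚ)| ^ (l : ℕ) = |(β : ℚ)| ^ (l' : ℕ) := by
      rw [← abs_pow, ← abs_pow]
      exact congrArg _ hll
    have h2 : (1 : ℚ) < |(β : ℚ)| := by exact_mod_cast hβ
    exact Fin.ext (pow_right_injective₀ (by positivity) h2.ne' h1)
  obtain ⟨f, hf⟩ := exists_det_submatrix_ne_zero
    (Matrix.of fun (p : Fin (R + L) × Fin S) (c : Fin K × Fin L) =>
      ((((p.1 : ℕ) + N * p.2 : ℕ).choose c.1 : ℚ) * ((β : ℚ) ^ (c.2 : ℕ)) ^ (p.1 : ℕ) *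
          ((γ₁ : ℚ) ^ (p.2 : ℕ) * (γ₂ : ℚ) ^ (S - 1 - p.2)) ^ (c.2 : ℕ))) (by
    intro v hv
    have hz := eq_zero_of_sum_eval_mul_pow_eq_zero (K := K - 1) (R := R) (S := S) (N := N)
      (fun l : Fin L => ∑ k : Fin K, Polynomial.C (v (k, l)) * choosePoly k) (fun l => by
        refine Polynomial.natDegree_sum_le_of_forall_le _ _ fun k _ => ?_
        refine (Polynomial.natDegree_C_mul_le _ _).trans ((choosePoly_natDegree_le _).trans ?_)
        have := k.2
        omega) _ hinj (fun l => pow_ne_zero _ hβ0)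
      (fun j l => ((γ₁ : ℚ) ^ j * (γ₂ : ℚ) ^ (S - 1 - j)) ^ (l : ℕ))
      (fun j l => pow_ne_zero _ (mul_ne_zero (pow_ne_zero _ h₁') (pow_ne_zero _ h₂')))
      hRN hRS (by
        intro i hi j hj
        have h1 := congrFun hv (⟨i, hi⟩, ⟨j, hj⟩)
        rw [Pi.zero_apply, Matrix.mulVec, dotProduct, Fintype.sum_prod_type_right] at h1
        rw [← h1]
        refine Finset.sum_congr rfl fun l _ => ?_
        rw [Polynomial.eval_finsetSum, Finset.sum_mul, Finset.sum_mul]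
        refine Finset.sum_congr rfl fun k _ => ?_
        rw [Polynomial.eval_mul, Polynomial.eval_C, choosePoly_eval, Matrix.of_apply]
        ring)
    funext ⟨k, l⟩
    exact eq_zero_of_sum_choosePoly_eq_zero _ (hz l) k)
  refine ⟨f, fun h0 => hf ?_⟩
  have h1 := congrArg (Int.castRingHom ℚ) h0
  rw [RingHom.map_det, map_zero] at h1
  rw [← h1]
  congr 1
  ext p c
  simp

lemma pow_mul_choose_mul_one_add_pow (q t : ℤ) (u k : ℕ) :
    q ^ k * ((u.choose k : ℤ) * (1 + q * t) ^ u) = ∑ j ∈ Finset.range (u + 1),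
      (u.choose j : ℤ) * (q ^ j * ((j.choose k : ℤ) * t ^ (j - k) * (1 + q * t) ^ k)) := by
  rcases lt_or_ge u k with hk | hk
  · rw [Nat.choose_eq_zero_of_lt hk, Finset.sum_eq_zero]
    · simp
    · intro j hj
      have := Finset.mem_range.1 hj
      rw [Nat.choose_eq_zero_of_lt (show j < k by omega)]
      simp
  · obtain ⟨v, rfl⟩ := Nat.exists_eq_add_of_le hk
    rw [show k + v + 1 = k + (v + 1) by ring, Finset.sum_range_add, Finset.sum_eq_zero, zero_add,
      pow_add (1 + q * t), add_comm 1 (q * t), add_pow (q * t) 1 v, Finset.mul_sum,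
      Finset.mul_sum, Finset.mul_sum]
    · refine Finset.sum_congr rfl fun i _ => ?_
      have h1 := Nat.choose_mul (n := k + v) (k := k + i) (s := k) (by omega)
      rw [Nat.add_sub_cancel_left, Nat.add_sub_cancel_left] at h1
      have h2 : ((k + v).choose (k + i) : ℤ) * (k + i).choose k =
          (k + v).choose k * v.choose i := by
        exact_mod_cast h1
      rw [Nat.add_sub_cancel_left]
      linear_combination (-(q ^ k * q ^ i * t ^ i * (1 + q * t) ^ k)) * h2
    · intro j hj
      rw [Nat.choose_eq_zero_of_lt (Finset.mem_range.1 hj)]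
      simp

lemma pow_mul_choose_mul_one_add_pow_modEq (q t : ℤ) (n u k : ℕ) :
    ∃ w, q ^ k * ((u.choose k : ℤ) * (1 + q * t) ^ u) = ∑ j : Fin n,
      (u.choose j : ℤ) * (q ^ (j : ℕ) * (((j : ℕ).choose k : ℤ) * t ^ ((j : ℕ) - k) *
        (1 + q * t) ^ k)) + q ^ n * w := by
  have h1 : q ^ k * ((u.choose k : ℤ) * (1 + q * t) ^ u) = ∑ j ∈ Finset.range (n + (u + 1)),
      (u.choose j : ℤ) * (q ^ j * ((j.choose k : ℤ) * t ^ (j - k) * (1 + q * t) ^ k)) := by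
    rw [pow_mul_choose_mul_one_add_pow]
    refine Finset.sum_subset (fun j hj => ?_) fun j _ hj => ?_
    · have := Finset.mem_range.1 hj
      exact Finset.mem_range.2 (by omega)
    · rw [Nat.choose_eq_zero_of_lt (by simpa using hj)]
      simp
  refine ⟨∑ i ∈ Finset.range (u + 1), (u.choose (n + i) : ℤ) *
    (q ^ i * (((n + i).choose k : ℤ) * t ^ (n + i - k) * (1 + q * t) ^ k)), ?_⟩
  rw [h1, Finset.sum_range_add, Finset.sum_range, Finset.mul_sum]
  congr 1
  refine Finset.sum_congr rfl fun i _ => ?_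
  rw [pow_add]
  ring

lemma interpolation_bound {K L R S N U : ℕ} {q β γ₁ γ₂ G H : ℤ} (hK : 0 < K) (hL : 0 < L)
    (hq : 2 ≤ q) (hβ : 1 < |β|) (h₁ : γ₁ ≠ 0) (h₂ : γ₂ ≠ 0) (hβq : q ∣ β - 1)
    (hdvd : q ^ (K * L) ∣ γ₁ - β ^ N * γ₂) (hRN : R + L ≤ N) (hRS : L * (K - 1) < R * S)
    (hG₁ : |γ₁| ≤ G) (hG₂ : |γ₂| ≤ G) (hH : |β| ^ (R + L) * G ^ S ≤ H) (hU : N * S ≤ U) :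
    q ^ (K * L - 1) ≤ ((K * L : ℕ) : ℤ) ^ 2 * (q * U) ^ (K - 1) * H ^ (L - 1) := by
  obtain ⟨f, hf⟩ := exists_interpolation_det_ne_zero (N := N) hβ h₁ h₂
    (by omega : R ≤ N) hRS
  obtain ⟨n, hn⟩ : ∃ n, n = K * L := ⟨_, rfl⟩
  rw [← hn] at hdvd ⊢
  have hn0 : 0 < n := hn ▸ Nat.mul_pos hK hL
  have hcard : Fintype.card (Fin K × Fin L) = n := by simp [hn]
  set M : Matrix (Fin K × Fin L) (Fin K × Fin L) ℤ := Matrix.of fun p c =>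
    ((((f p).1 : ℕ) + N * (f p).2 : ℕ).choose c.1 : ℤ) * (β ^ (c.2 : ℕ)) ^ ((f p).1 : ℕ) *
      (γ₁ ^ ((f p).2 : ℕ) * γ₂ ^ (S - 1 - (f p).2)) ^ (c.2 : ℕ) with hM
  set A : Matrix (Fin K × Fin L) (Fin K × Fin L) ℤ := Matrix.of fun p c =>
    q ^ (c.1 : ℕ) * M p c with hA
  have hq0 : 0 < q := by omega
  have hA0 : A.det ≠ 0 := by
    rw [hA, Matrix.det_mul_row]
    exact mul_ne_zero (Finset.prod_ne_zero_iff.2 fun c _ => pow_ne_zero _ hq0.ne') hf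
  have hG : 1 ≤ G := (Int.one_le_abs h₁).trans hG₁
  have hH1 : 1 ≤ H := le_trans (one_le_mul_of_one_le_of_one_le (one_le_pow₀ hβ.le)
    (one_le_pow₀ hG)) hH
  have hlow : q ^ (∑ k ∈ Finset.range n, k) ∣ A.det := by
    choose t ht using fun l : ℕ => hβq.trans (sub_one_dvd_pow_sub_one β l)
    choose w hw using fun (p c : Fin K × Fin L) =>
      pow_mul_choose_mul_one_add_pow_modEq q (t c.2) n ((f p).1 + N * (f p).2) c.1
    have hent : ∀ p c, ∃ z, M p c = ((((f p).1 : ℕ) + N * (f p).2 : ℕ).choose c.1 : ℤ) *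
        (1 + q * t c.2) ^ (((f p).1 : ℕ) + N * (f p).2 : ℕ) * γ₂ ^ ((S - 1) * (c.2 : ℕ)) +
          q ^ n * z := by
      intro p c
      have hmod : γ₁ ≡ β ^ N * γ₂ [ZMOD q ^ n] := (Int.modEq_iff_dvd.2 hdvd).symm
      obtain ⟨z, hz⟩ := Int.modEq_iff_dvd.1 (((((hmod.pow ((f p).2 : ℕ)).mul_right
        (γ₂ ^ (S - 1 - (f p).2))).pow (c.2 : ℕ)).mul_left
        (((((f p).1 : ℕ) + N * (f p).2 : ℕ).choose c.1 : ℤ) *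
          (β ^ (c.2 : ℕ)) ^ ((f p).1 : ℕ))).symm)
      refine ⟨z, ?_⟩
      rw [← hz, ← ht, add_sub_cancel, hM, Matrix.of_apply]
      have hS : (S - 1) * (c.2 : ℕ) = ((f p).2 : ℕ) * c.2 + (S - 1 - (f p).2) * c.2 := by
        have := (f p).2.2
        rw [← Nat.add_mul]
        congr 1
        omega
      rw [hS]
      ring
    choose z hz using hent
    refine pow_dvd_det_of_eq_sum hcard q A
      (fun p j => ((((f p).1 : ℕ) + N * (f p).2 : ℕ).choose j : ℤ))
      (fun j c => (((j : ℕ).choose c.1 : ℤ) * t c.2 ^ ((j : ℕ) - c.1) *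
        (1 + q * t c.2) ^ (c.1 : ℕ)) * γ₂ ^ ((S - 1) * (c.2 : ℕ)))
      (fun p c => w p c * γ₂ ^ ((S - 1) * (c.2 : ℕ)) + q ^ (c.1 : ℕ) * z p c) fun p c => ?_
    have h1 : A p c = (q ^ (c.1 : ℕ) * (((((f p).1 : ℕ) + N * (f p).2 : ℕ).choose c.1 : ℤ) *
        (1 + q * t c.2) ^ (((f p).1 : ℕ) + N * (f p).2 : ℕ))) * γ₂ ^ ((S - 1) * (c.2 : ℕ)) +
          q ^ n * (q ^ (c.1 : ℕ) * z p c) := by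
      rw [hA, Matrix.of_apply, hz]
      ring
    rw [h1, hw, add_mul, Finset.sum_mul, mul_add, add_assoc, mul_assoc]
    congr 1
    refine Finset.sum_congr rfl fun j _ => ?_
    ring
  have hup : |A.det| ≤ (n.factorial : ℤ) * ∏ c : Fin K × Fin L,
      ((q * U) ^ (c.1 : ℕ) * H ^ (c.2 : ℕ)) := by
    rw [← hcard]
    refine abs_det_le_factorial_mul_prod A _ fun p c => ?_
    have hi := (f p).1.2
    have hj := (f p).2.2
    have hu : ((f p).1 : ℕ) + N * (f p).2 ≤ U := by
      refine le_trans ?_ hU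
      calc ((f p).1 : ℕ) + N * (f p).2 ≤ N * ((f p).2 + 1) := by rw [mul_add]; omega
        _ ≤ N * S := Nat.mul_le_mul_left _ hj
    have hbin : (((((f p).1 : ℕ) + N * (f p).2 : ℕ).choose c.1 : ℕ) : ℤ) ≤ (U : ℤ) ^ (c.1 : ℕ) := by
      exact_mod_cast (Nat.choose_le_pow _ _).trans (Nat.pow_le_pow_left hu _)
    have hpow : |β| ^ ((f p).1 : ℕ) * (|γ₁| ^ ((f p).2 : ℕ) * |γ₂| ^ (S - 1 - (f p).2)) ≤ H := by
      refine le_trans (mul_le_mul (pow_le_pow_right₀ hβ.le hi.le) ?_ (by positivity)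
        (by positivity)) hH
      calc |γ₁| ^ ((f p).2 : ℕ) * |γ₂| ^ (S - 1 - (f p).2)
          ≤ G ^ ((f p).2 : ℕ) * G ^ (S - 1 - (f p).2) := by gcongr
        _ = G ^ (S - 1) := by rw [← pow_add]; congr 1; omega
        _ ≤ G ^ S := pow_le_pow_right₀ hG (Nat.sub_le _ _)
    calc |A p c| = q ^ (c.1 : ℕ) * ((((f p).1 : ℕ) + N * (f p).2 : ℕ).choose c.1 : ℕ) *
          (|β| ^ ((f p).1 : ℕ) * (|γ₁| ^ ((f p).2 : ℕ) * |γ₂| ^ (S - 1 - (f p).2))) ^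
            (c.2 : ℕ) := by
          rw [hA, Matrix.of_apply, hM, Matrix.of_apply]
          simp only [abs_mul, abs_pow, Nat.abs_cast, abs_of_pos hq0]
          ring
      _ ≤ q ^ (c.1 : ℕ) * (U : ℤ) ^ (c.1 : ℕ) * H ^ (c.2 : ℕ) := by gcongr
      _ = _ := by ring
  have hprod : ∏ c : Fin K × Fin L, ((q * U) ^ (c.1 : ℕ) * H ^ (c.2 : ℕ)) =
      (q * U) ^ (L * ∑ k ∈ Finset.range K, k) * H ^ (K * ∑ l ∈ Finset.range L, l) := by
    rw [Finset.prod_mul_distrib, Finset.prod_pow_eq_pow_sum, Finset.prod_pow_eq_pow_sum,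
      Fintype.sum_prod_type, Fintype.sum_prod_type]
    simp only [Finset.sum_const, Finset.card_univ, Fintype.card_fin, smul_eq_mul]
    rw [Finset.sum_range fun k => k, Finset.sum_range fun k => k, Finset.mul_sum, Finset.mul_sum]
  have hmain : q ^ (∑ k ∈ Finset.range n, k) ≤ (n : ℤ) ^ n *
      ((q * U) ^ (L * ∑ k ∈ Finset.range K, k) * H ^ (K * ∑ l ∈ Finset.range L, l)) := by
    rw [← hprod]
    refine (Int.le_of_dvd (abs_pos.2 hA0) ((dvd_abs _ _).2 hlow)).trans (hup.trans ?_)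
    refine mul_le_mul_of_nonneg_right (by exact_mod_cast Nat.factorial_le_pow n)
      (Finset.prod_nonneg fun c _ => by positivity)
  have hsq := pow_le_pow_left₀ (by positivity) hmain 2
  have e1 : (∑ k ∈ Finset.range n, k) * 2 = (n - 1) * n := by
    rw [Finset.sum_range_id_mul_two, mul_comm]
  have e2 : (L * ∑ k ∈ Finset.range K, k) * 2 = (K - 1) * n := by
    rw [mul_assoc, Finset.sum_range_id_mul_two, hn]; ring
  have e3 : (K * ∑ k ∈ Finset.range L, k) * 2 = (L - 1) * n := by
    rw [mul_assoc, Finset.sum_range_id_mul_two, hn]; ring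
  rw [mul_pow, mul_pow, ← pow_mul, ← pow_mul, ← pow_mul, ← pow_mul, e1, e2, e3, mul_comm n 2,
    pow_mul, pow_mul, pow_mul (q * U), pow_mul H, ← mul_pow, ← mul_pow, ← mul_assoc] at hsq
  exact le_of_pow_le_pow_left₀ hn0.ne' (by positivity) hsq

lemma poly_le_two_pow {h : ℕ} (hh : 40 ≤ h) :
    400 * h ^ 2 * (4 * h + 1) ^ 2 ≤ 2 ^ h ∧
      6 * h + 1 + h * (6 * h * ((20 * h + 1) * (4 * h + 1))) < 2 ^ h := by
  have key : 10000 * h ^ 4 ≤ 2 ^ h := by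
    induction h, hh using Nat.le_induction with
    | base => norm_num
    | succ n hn ih =>
      have : (n + 1) ^ 4 ≤ 2 * n ^ 4 := by
        have h1 : 40 * n ^ 3 ≤ n ^ 4 := by nlinarith [pow_pos (show 0 < n by omega) 3]
        have h2 : 40 * n ^ 2 ≤ n ^ 3 := by nlinarith [pow_pos (show 0 < n by omega) 2]
        have h3 : 40 * n ≤ n ^ 2 := by nlinarith
        nlinarith
      rw [pow_succ 2]
      linarith
  have h3 : 40 * h ^ 3 ≤ h ^ 4 := by nlinarith [pow_pos (show 0 < h by omega) 3]
  have h2 : 40 * h ^ 2 ≤ h ^ 3 := by nlinarith [pow_pos (show 0 < h by omega) 2]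
  have h1 : 40 * h ≤ h ^ 2 := by nlinarith
  constructor <;> nlinarith

lemma false_of_large_parameters {h N : ℕ} {q β γ₁ γ₂ : ℤ} (hh : 40 ≤ h) (hq : 3 ≤ q)
    (hβ : 1 < |β|) (hβ' : |β| ≤ 2 ^ (6 * h)) (h₁ : γ₁ ≠ 0) (h₂ : γ₂ ≠ 0)
    (h₁' : |γ₁| ≤ 2 ^ (6 * h)) (h₂' : |γ₂| ≤ 2 ^ (6 * h)) (hβq : q ∣ β - 1)
    (hdvd : q ^ (400 * h ^ 2 * (4 * h + 1) ^ 2) ∣ γ₁ - β ^ N * γ₂)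
    (hN : (20 * h + 1) * (4 * h + 1) ≤ N) (hN' : N ≤ 2 ^ (2 * h)) : False := by
  obtain ⟨L, hL⟩ : ∃ L, L = 4 * h + 1 := ⟨_, rfl⟩
  obtain ⟨T, hT⟩ : ∃ T, T = 20 * h * L := ⟨_, rfl⟩
  obtain ⟨K, hK⟩ : ∃ K, K = 400 * h ^ 2 * L := ⟨_, rfl⟩
  have hL0 : 0 < L := by omega
  have hK0 : 0 < K := by rw [hK]; positivity
  have hKL : K * L = T ^ 2 := by rw [hK, hT]; ring
  have hKL2 : K * L ≤ 2 ^ h := by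
    rw [hK, hL]
    calc _ = 400 * h ^ 2 * (4 * h + 1) ^ 2 := by ring
      _ ≤ _ := (poly_le_two_pow hh).1
  have hT2 : T ≤ 2 ^ h := by nlinarith
  have hb := interpolation_bound (K := K) (L := L) (R := T) (S := T) (N := N) (U := 2 ^ (3 * h))
    (G := 2 ^ (6 * h)) (H := 2 ^ (6 * h * (2 * T + L))) hK0 hL0 (by omega : (2 : ℤ) ≤ q) hβ h₁ h₂
    hβq (by rw [hK, hL]; convert hdvd using 2; ring) (by rw [hT, hL]; linarith)
    (by rw [← pow_two, ← hKL, mul_comm]; exact Nat.mul_lt_mul_of_pos_right (by omega) hL0) h₁' h₂'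
    (by
      calc |β| ^ (T + L) * (2 ^ (6 * h)) ^ T ≤ (2 ^ (6 * h)) ^ (T + L) * (2 ^ (6 * h)) ^ T := by
            gcongr
        _ = _ := by rw [← pow_mul, ← pow_mul, ← pow_add]; congr 1; ring)
    (by
      calc N * T ≤ 2 ^ (2 * h) * 2 ^ h := Nat.mul_le_mul hN' hT2
        _ = _ := by rw [← pow_add]; congr 1; ring)
  have e1 : K * L - 1 = (K - 1) + 4 * h * K := by
    obtain ⟨k, rfl⟩ := Nat.exists_eq_add_of_le' hK0
    rw [hL, Nat.add_sub_cancel]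
    exact Nat.sub_eq_of_eq_add (by ring)
  have hq0 : 0 < q := by omega
  have h8 : q ^ (4 * h * K) ≤ 2 ^ (2 * h + 3 * h * (K - 1) + 6 * h * (2 * T + L) * (4 * h)) := by
    refine le_of_mul_le_mul_left (a := q ^ (K - 1)) ?_ (by positivity)
    rw [← pow_add, ← e1]
    refine hb.trans ?_
    have : ((K * L : ℕ) : ℤ) ≤ 2 ^ h := by exact_mod_cast hKL2
    have e2 : L - 1 = 4 * h := by omega
    rw [mul_pow, e2]
    calc _ ≤ (2 ^ h) ^ 2 * (q ^ (K - 1) * ((2 ^ (3 * h) : ℕ) : ℤ) ^ (K - 1)) *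
          (2 ^ (6 * h * (2 * T + L))) ^ (4 * h) := by gcongr
      _ = _ := by push_cast; ring
  have h9 : (2 : ℤ) ^ (6 * h * K) ≤ q ^ (4 * h * K) := by
    calc (2 : ℤ) ^ (6 * h * K) = 8 ^ (2 * h * K) := by
          rw [show (8 : ℤ) = 2 ^ 3 by norm_num, ← pow_mul]; congr 1; ring
      _ ≤ 9 ^ (2 * h * K) := pow_le_pow_left₀ (by norm_num) (by norm_num) _
      _ = 3 ^ (4 * h * K) := by
          rw [show (9 : ℤ) = 3 ^ 2 by norm_num, ← pow_mul]; congr 1; ring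
      _ ≤ _ := pow_le_pow_left₀ (by norm_num) hq _
  have h10 := (pow_le_pow_iff_right₀ (by norm_num : (1 : ℤ) < 2)).1 (h9.trans h8)
  obtain ⟨k, hk⟩ := Nat.exists_eq_add_of_le' hK0
  have h11 : 3 * h * K + h ≤ 24 * h ^ 2 * (2 * T + L) := by
    rw [hk, Nat.add_sub_cancel] at h10
    rw [hk]
    nlinarith
  have h12 : 24 * h ^ 2 * (2 * T + L) ≤ 3 * h * K := by
    rw [hK, hT]
    have : h ^ 2 * L ≤ h ^ 3 * L :=
      Nat.mul_le_mul_right _ (Nat.pow_le_pow_right (by omega) (by omega))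
    nlinarith
  omega

lemma lt_two_pow_of_le_mul_pow {t x y : ℕ} {b : ℕ} (hb : b ≤ 2 * x) (hx : x < 2 ^ (t + 1))
    (h : 2 ^ x ≤ 2 * (8 * (2 * x + 1) ^ 2 * y) * b ^ y) {u : ℕ} (hy : y ≤ 2 ^ u) :
    x ≤ 8 + 2 * t + u + (t + 2) * y := by
  have h1 : 2 * x + 1 ≤ 2 ^ (t + 2) := by rw [pow_succ 2 (t + 1)]; omega
  refine (Nat.pow_le_pow_iff_right (by norm_num : 1 < 2)).1 (h.trans ?_)
  calc 2 * (8 * (2 * x + 1) ^ 2 * y) * b ^ y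
      ≤ 2 * (8 * (2 ^ (t + 2)) ^ 2 * 2 ^ u) * (2 ^ (t + 2)) ^ y := by
        gcongr
        omega
    _ = _ := by
        rw [show (8 : ℕ) = 2 ^ 3 by norm_num]
        simp only [← pow_mul, ← pow_add, ← pow_succ']
        congr 1
        ring

/-- Explicit bounds for `x` and `y` when `b ^ y` divides `r * a ^ x ∓ c`, under bounds for the
coefficients that are polynomial in `x` and `y`. -/
lemma lt_of_pow_dvd {a b c r : ℤ} {d x y : ℕ} {σ ε : ℤ} (ha : 2 ≤ a) (hb : 3 ≤ b) (hc : 1 ≤ c)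
    (hr : 1 ≤ r) (hd : 1 ≤ d) (hσ : σ = 1 ∨ σ = -1) (hε : ε = 1 ∨ ε = -1)
    (hbd : b ∣ a ^ d - σ) (hdvd : b ^ y ∣ r * a ^ x - ε * c) (hbx : b ≤ 2 * x)
    (hax : a ≤ x + 1) (hcZ : c ≤ 8 * (2 * x + 1) ^ 2 * y)
    (hrZ : r * a ^ d ≤ 8 * (2 * x + 1) ^ 2 * y)
    (hba : b ^ y ≤ 2 * (8 * (2 * x + 1) ^ 2 * y) * a ^ x)
    (hab : a ^ x ≤ 2 * (8 * (2 * x + 1) ^ 2 * y) * b ^ y) : y < 2 ^ 40 ∧ x < 2 ^ 47 := by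
  have h2x : 2 ^ x ≤ 2 * (8 * (2 * x + 1) ^ 2 * y) * b.toNat ^ y := by
    have hb' : (b.toNat : ℤ) = b := Int.toNat_of_nonneg (by omega)
    have : (2 : ℤ) ^ x ≤ 2 * (8 * (2 * x + 1) ^ 2 * y) * b ^ y :=
      (pow_le_pow_left₀ (by norm_num) ha x).trans hab
    rw [← hb'] at this
    exact_mod_cast this
  have hbx' : b.toNat ≤ 2 * x := by omega
  have hx0 : x ≠ 0 := by rintro rfl; norm_num at hbx; omega
  have hy : y < 2 ^ 40 := by
    by_contra hy
    push Not at hy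
    have hy0 : y ≠ 0 := by rintro rfl; norm_num at hy
    obtain ⟨h, hh⟩ : ∃ h, h = Nat.log 2 y := ⟨_, rfl⟩
    have hh1 : 2 ^ h ≤ y := hh ▸ Nat.pow_log_le_self 2 hy0
    have hh2 : y < 2 ^ (h + 1) := hh ▸ Nat.lt_pow_succ_log_self (by norm_num) y
    have hh40 : 40 ≤ h := by
      rw [hh]
      exact (Nat.le_log_iff_pow_le (by norm_num) hy0).2 hy
    have hx : x < 2 ^ (2 * h) := by
      by_contra hx
      push Not at hx
      obtain ⟨t, ht⟩ : ∃ t, t = Nat.log 2 x := ⟨_, rfl⟩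
      have ht1 : 2 ^ t ≤ x := ht ▸ Nat.pow_log_le_self 2 hx0
      have ht2 : x < 2 ^ (t + 1) := ht ▸ Nat.lt_pow_succ_log_self (by norm_num) x
      have ht3 : 2 * h ≤ t := ht ▸ (Nat.le_log_iff_pow_le (by norm_num) hx0).2 hx
      have h1 := lt_two_pow_of_le_mul_pow hbx' ht2 h2x hh2.le
      obtain ⟨m, rfl⟩ : ∃ m, t = h + m := ⟨t - h, by omega⟩
      have hm : 10 * m + 40 ≤ 2 ^ m := by
        have : 40 ≤ m := by omega
        clear * - this
        induction m, this using Nat.le_induction with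
        | base => norm_num
        | succ n hn ih => rw [pow_succ]; omega
      have h2h : 1 ≤ 2 ^ h := Nat.one_le_two_pow
      have hle : (h + m + 2) * y ≤ (2 * m + 2) * (2 * 2 ^ h) :=
        Nat.mul_le_mul (by omega) (by rw [pow_succ] at hh2; omega)
      have hlow : 2 ^ h * (10 * m + 40) ≤ x := by
        refine le_trans ?_ ht1
        rw [pow_add]
        exact Nat.mul_le_mul_left _ hm
      nlinarith
    have hZ : (8 * (2 * x + 1) ^ 2 * y : ℤ) ≤ 2 ^ (6 * h) := by
      have h1 : 2 * x + 1 ≤ 2 ^ (2 * h + 1) := by rw [pow_succ]; omega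
      have : 8 * (2 * x + 1) ^ 2 * y ≤ 2 ^ (6 * h) := by
        calc 8 * (2 * x + 1) ^ 2 * y ≤ 8 * (2 ^ (2 * h + 1)) ^ 2 * 2 ^ (h + 1) := by gcongr
          _ = 2 ^ (5 * h + 6) := by
              rw [show 8 = 2 ^ 3 by norm_num]
              simp only [← pow_mul, ← pow_add]
              congr 1
              ring
          _ ≤ _ := Nat.pow_le_pow_right (by norm_num) (by omega)
      exact_mod_cast this
    have had1 : 1 < a ^ d := one_lt_pow₀ (by omega) (by omega)
    have had : a ^ d ≤ 2 ^ (6 * h) := by nlinarith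
    have hd6 : d ≤ 6 * h := by
      refine (pow_le_pow_iff_right₀ (by norm_num : (1 : ℤ) < 2)).1 (le_trans ?_ had)
      exact pow_le_pow_left₀ (by norm_num) ha d
    have hσ2 : σ ^ 2 = 1 := by rcases hσ with rfl | rfl <;> norm_num
    have hσabs : |σ| = 1 := by rcases hσ with rfl | rfl <;> norm_num
    have hεabs : |ε| = 1 := by rcases hε with rfl | rfl <;> norm_num
    have hβabs : |σ * a ^ d| = a ^ d := by
      rw [abs_mul, hσabs, one_mul, abs_of_pos (by positivity)]
    rcases le_or_gt ((20 * h + 1) * (4 * h + 1)) (x / d) with hN | hN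
    · refine false_of_large_parameters (N := x / d) (q := b) (β := σ * a ^ d)
        (γ₁ := σ ^ (x / d) * (ε * c)) (γ₂ := r * a ^ (x % d)) hh40 hb (by rwa [hβabs])
        (by rwa [hβabs]) ?_ (by positivity) ?_ ?_ ?_ ?_ hN ?_
      · rw [← abs_pos, abs_mul, abs_pow, hσabs, one_pow, abs_mul, hεabs, one_mul, one_mul]
        exact abs_pos.2 (by omega)
      · rw [abs_mul, abs_pow, hσabs, one_pow, abs_mul, hεabs, one_mul, one_mul,
          abs_of_pos (by omega)]
        exact hcZ.trans hZ
      · rw [abs_of_pos (by positivity)]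
        refine le_trans (le_trans ?_ hrZ) hZ
        gcongr
        · omega
        · exact (Nat.mod_lt _ hd).le
      · have : σ * a ^ d - 1 = σ * (a ^ d - σ) := by linear_combination hσ2
        rw [this]
        exact hbd.mul_left _
      · have hpow : (σ * a ^ d) ^ (x / d) * (r * a ^ (x % d)) = σ ^ (x / d) * (r * a ^ x) := by
          have : a ^ x = (a ^ d) ^ (x / d) * a ^ (x % d) := by
            rw [← pow_mul, ← pow_add, Nat.div_add_mod]
          rw [this]
          ring
        rw [hpow, ← mul_sub]
        refine Dvd.dvd.mul_left ?_ _
        rw [dvd_sub_comm]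
        exact (pow_dvd_pow b ((poly_le_two_pow hh40).1.trans hh1)).trans hdvd
      · exact (Nat.div_le_self _ _).trans hx.le
    · have hxs : x < 6 * h * ((20 * h + 1) * (4 * h + 1)) := by
        calc x < d * (x / d + 1) := Nat.lt_mul_div_succ x hd
          _ ≤ 6 * h * ((20 * h + 1) * (4 * h + 1)) := Nat.mul_le_mul hd6 hN
      have hbig := (poly_le_two_pow hh40).2
      have hxh : x + 1 ≤ 2 ^ h := by nlinarith
      have h1 : (2 : ℤ) ^ y ≤ 2 ^ (6 * h + 1 + h * x) := by
        calc (2 : ℤ) ^ y ≤ b ^ y := pow_le_pow_left₀ (by norm_num) (by omega) _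
          _ ≤ 2 * (8 * (2 * x + 1) ^ 2 * y) * a ^ x := hba
          _ ≤ 2 * 2 ^ (6 * h) * (2 ^ h) ^ x := by
              gcongr
              exact hax.trans (by exact_mod_cast hxh)
          _ = _ := by simp only [pow_add, pow_mul]; ring
      have h2 := (pow_le_pow_iff_right₀ (by norm_num : (1 : ℤ) < 2)).1 h1
      nlinarith
  refine ⟨hy, ?_⟩
  by_contra hx
  push Not at hx
  obtain ⟨t, ht⟩ : ∃ t, t = Nat.log 2 x := ⟨_, rfl⟩
  have ht1 : 2 ^ t ≤ x := ht ▸ Nat.pow_log_le_self 2 hx0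
  have ht2 : x < 2 ^ (t + 1) := ht ▸ Nat.lt_pow_succ_log_self (by norm_num) x
  have ht3 : 47 ≤ t := ht ▸ (Nat.le_log_iff_pow_le (by norm_num) hx0).2 hx
  have h1 := lt_two_pow_of_le_mul_pow hbx' ht2 h2x hy.le
  obtain ⟨k, rfl⟩ := Nat.exists_eq_add_of_le ht3
  have hk : k + 1 ≤ 2 ^ k := Nat.lt_two_pow_self
  have h2 : (47 + k + 2) * y ≤ (47 + k + 2) * 2 ^ 40 := Nat.mul_le_mul_left _ hy.le
  have h3 : 2 ^ 47 * (k + 1) ≤ x := by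
    refine le_trans ?_ ht1
    rw [pow_add]
    exact Nat.mul_le_mul_left _ hk
  omega

lemma IsSol.exists_signs {a b c r s : ℤ} {x y : ℕ} (h : IsSol a b c r s x y) :
    ∃ ε δ : ℤ, (ε = 1 ∨ ε = -1) ∧ (δ = 1 ∨ δ = -1) ∧ ε * (r * a ^ x) + δ * (s * b ^ y) = c := by
  obtain ⟨-, -, u, v, -, -, h⟩ := h
  exact ⟨(-1) ^ u, (-1) ^ v, neg_one_pow_eq_or ℤ u, neg_one_pow_eq_or ℤ v, by rw [← h]; ring⟩

lemma IsSol.symm {a b c r s : ℤ} {x y : ℕ} (h : IsSol a b c r s x y) : IsSol b a c s r y x := by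
  obtain ⟨hx, hy, u, v, hu, hv, h⟩ := h
  exact ⟨hy, hx, v, u, hv, hu, by rw [← h]; ring⟩

lemma pow_dvd_of_pow_dvd_geom_sum {p k n : ℕ} (hp : p.Prime) (hp2 : p ≠ 2) {z : ℤ}
    (hz : (p : ℤ) ∣ z - 1) (h : (p : ℤ) ^ k ∣ ∑ i ∈ Finset.range n, z ^ i) : p ^ k ∣ n := by
  rcases eq_or_ne z 1 with rfl | hz1
  · simp only [one_pow, Finset.sum_const, Finset.card_range, nsmul_eq_mul, mul_one] at h
    exact_mod_cast h
  have hpz : ¬ (p : ℤ) ∣ z := fun h' => by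
    have := (dvd_sub_right h').1 hz
    exact hp.one_lt.ne' (by exact_mod_cast Int.eq_one_of_dvd_one (by positivity) this)
  have h1 := Int.emultiplicity_pow_sub_pow hp (hp.odd_of_ne_two hp2) (by simpa using hz) hpz n
  rw [one_pow, ← mul_geom_sum, emultiplicity_mul (Nat.prime_iff_prime_int.1 hp)] at h1
  have hfin : FiniteMultiplicity (p : ℤ) (z - 1) :=
    Int.finiteMultiplicity_iff.2 ⟨by simpa using hp.one_lt.ne', sub_ne_zero.2 hz1⟩
  rw [add_comm, add_comm _ (emultiplicity p n)] at h1
  have h2 := (WithTop.add_right_inj (finiteMultiplicity_iff_emultiplicity_ne_top.1 hfin)).1 h1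
  rw [pow_dvd_iff_le_emultiplicity, ← h2]
  exact le_emultiplicity_of_pow_dvd h

lemma two_pow_dvd_of_dvd_pow_sub {b τ : ℤ} (hb : Odd b) (hτ : τ = 1 ∨ τ = -1) :
    ∃ T : ℤ, (T = b - 1 ∨ T = b + 1) ∧
      ∀ k n : ℕ, (2 : ℤ) ^ k ∣ b ^ n - τ → (2 : ℤ) ^ k ∣ T * n := by
  obtain ⟨c, rfl⟩ := hb
  have key : ∀ k n : ℕ, (2 : ℤ) ^ k ∣ (2 * c + 1) ^ n - τ → (2 : ℤ) ^ k ∣ 2 * c * (c + 1) * n := by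
    intro k n h
    have h1 : (2 : ℤ) ^ (k + 1) ∣ ((2 * c + 1) ^ 2) ^ n - 1 ^ n := by
      have hodd : Odd ((2 * c + 1) ^ n) := (odd_two_mul_add_one c).pow
      have h2 : (2 : ℤ) ∣ (2 * c + 1) ^ n + τ := by
        rw [← even_iff_two_dvd]
        rcases hτ with rfl | rfl
        · exact hodd.add_odd odd_one
        · exact hodd.add_odd (by decide)
      have h3 : ((2 * c + 1) ^ 2) ^ n - 1 ^ n =
          ((2 * c + 1) ^ n - τ) * ((2 * c + 1) ^ n + τ) := by
        rw [pow_right_comm]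
        rcases hτ with rfl | rfl <;> ring
      rw [h3, pow_succ]
      exact mul_dvd_mul h h2
    have hsq : (2 * c + 1) ^ 2 - 1 = 2 * (2 * c * (c + 1)) := by ring
    have h4 : (4 : ℤ) ∣ (2 * c + 1) ^ 2 - 1 := ⟨c * (c + 1), by ring⟩
    have h2' : ¬ (2 : ℤ) ∣ (2 * c + 1) ^ 2 := by
      rw [← even_iff_two_dvd, Int.not_even_iff_odd]
      exact (odd_two_mul_add_one c).pow
    have h5 := Int.two_pow_sub_pow' n h4 h2'
    rw [pow_dvd_iff_le_emultiplicity, h5, ← emultiplicity_mul Int.prime_two,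
      ← pow_dvd_iff_le_emultiplicity, hsq, pow_succ', mul_assoc] at h1
    exact (mul_dvd_mul_iff_left (by norm_num)).1 h1
  have hcop : ∀ (k : ℕ) (z : ℤ), Odd z → IsCoprime ((2 : ℤ) ^ k) z := by
    rintro k z ⟨j, rfl⟩
    exact IsCoprime.pow_left ⟨-j, 1, by ring⟩
  rcases Int.even_or_odd c with hc | hc
  · refine ⟨_, Or.inl rfl, fun k n h => ?_⟩
    have h1 := key k n h
    rw [show 2 * c * (c + 1) * n = (c + 1) * (2 * c * n) by ring] at h1
    rw [add_sub_cancel_right]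
    exact (hcop k _ hc.add_one).dvd_of_dvd_mul_left h1
  · refine ⟨_, Or.inr rfl, fun k n h => ?_⟩
    have h1 := key k n h
    rw [show 2 * c * (c + 1) * n = c * ((2 * c + 1 + 1) * n) by ring] at h1
    exact (hcop k _ hc).dvd_of_dvd_mul_left h1

lemma pow_dvd_of_dvd_pow_sub {p k : ℕ} (hp : p.Prime) (hp2 : p ≠ 2) {a b R m τ τ' : ℤ}
    {d e n : ℕ} (hτ : τ = 1 ∨ τ = -1) (hτ' : τ' = 1 ∨ τ' = -1) (hR : R ≠ 0) (haR : a ∣ R)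
    (ham : IsCoprime a m) (h : b ^ e - τ = R * m) (h' : R * a ^ d ∣ b ^ n - τ')
    (hk : (p : ℤ) ^ k ∣ a ^ d) : p ^ k ∣ n := by
  rcases Nat.eq_zero_or_pos k with rfl | hk0
  · simp
  have hpi := Nat.prime_iff_prime_int.1 hp
  have hpa : (p : ℤ) ∣ a := hpi.dvd_of_dvd_pow ((dvd_pow_self _ hk0.ne').trans hk)
  have hpe : (p : ℤ) ∣ b ^ e - τ := h ▸ (hpa.trans haR).mul_right m
  have hz : (b ^ (2 * e)) - 1 = R * (m * (b ^ e + τ)) := by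
    rw [← mul_assoc, ← h, mul_comm 2 e, pow_mul]
    rcases hτ with rfl | rfl <;> ring
  have hp2' : ¬ (p : ℤ) ∣ 2 := fun h2 => hp2 ((Nat.prime_dvd_prime_iff_eq hp Nat.prime_two).1
    (by exact_mod_cast h2))
  have hpe' : ¬ (p : ℤ) ∣ b ^ e + τ := fun h2 => by
    have h3 := dvd_sub h2 hpe
    rcases hτ with rfl | rfl
    · exact hp2' ((by ring : b ^ e + 1 - (b ^ e - 1) = 2) ▸ h3)
    · exact hp2' ((dvd_neg).1 ((by ring : b ^ e + -1 - (b ^ e - -1) = -2) ▸ h3))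
  have hpm : ¬ (p : ℤ) ∣ m := fun h2 => hpi.not_isUnit (ham.isUnit_of_dvd' hpa h2)
  refine pow_dvd_of_pow_dvd_geom_sum hp hp2 (z := b ^ (2 * e))
    (hz ▸ (hpa.trans haR).mul_right _) ?_
  have h1 : R * a ^ d ∣ R * (m * (b ^ e + τ)) * ∑ i ∈ Finset.range n, (b ^ (2 * e)) ^ i := by
    rw [← hz, mul_geom_sum, ← pow_mul, show 2 * e * n = n * 2 * e by ring, pow_mul]
    refine (h'.trans ?_).trans (sub_one_dvd_pow_sub_one (b ^ (n * 2)) e)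
    refine ⟨b ^ n + τ', ?_⟩
    rw [pow_mul]
    rcases hτ' with rfl | rfl <;> ring
  rw [mul_assoc] at h1
  have h2 := hk.trans ((mul_dvd_mul_iff_left hR).1 h1)
  refine ((hpi.coprime_iff_not_dvd.2 ?_).pow_left).dvd_of_dvd_mul_left h2
  exact fun h3 => (hpi.dvd_or_dvd h3).elim hpm hpe'

lemma exists_cofactor {R W X Y ε₁ ε₂ δ₁ δ₂ : ℤ} (hcop : IsCoprime R W) (hR : 0 < R) (hW : 0 < W)
    (hX : 2 ≤ X) (hY : 2 ≤ Y) (h₁ : ε₁ = 1 ∨ ε₁ = -1) (h₂ : ε₂ = 1 ∨ ε₂ = -1)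
    (h₃ : δ₁ = 1 ∨ δ₁ = -1) (h₄ : δ₂ = 1 ∨ δ₂ = -1)
    (h : R * (ε₁ - ε₂ * X) = W * (δ₁ - δ₂ * Y)) :
    ∃ σ τ m : ℤ, (σ = 1 ∨ σ = -1) ∧ (τ = 1 ∨ τ = -1) ∧ 0 < m ∧ Y - τ = R * m ∧
      X - σ = W * m := by
  obtain ⟨k, hk⟩ : R ∣ δ₁ - δ₂ * Y := hcop.dvd_of_dvd_mul_left ⟨_, h.symm⟩
  have hk' : ε₁ - ε₂ * X = W * k := by
    refine mul_left_cancel₀ hR.ne' ?_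
    rw [h, hk]
    ring
  have e1 : Y - δ₁ * δ₂ = R * (-δ₂ * k) := by
    rcases h₄ with rfl | rfl
    · linear_combination -hk
    · linear_combination hk
  have e2 : X - ε₁ * ε₂ = W * (-ε₂ * k) := by
    rcases h₂ with rfl | rfl
    · linear_combination -hk'
    · linear_combination hk'
  have hτ : δ₁ * δ₂ = 1 ∨ δ₁ * δ₂ = -1 := by
    rcases h₃ with rfl | rfl <;> rcases h₄ with rfl | rfl <;> simp
  have hσ : ε₁ * ε₂ = 1 ∨ ε₁ * ε₂ = -1 := by
    rcases h₁ with rfl | rfl <;> rcases h₂ with rfl | rfl <;> simp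
  have p1 : 0 < -δ₂ * k := pos_of_mul_pos_right (by rw [← e1]; omega) hR.le
  have p2 : 0 < -ε₂ * k := pos_of_mul_pos_right (by rw [← e2]; omega) hW.le
  have e3 : -ε₂ * k = -δ₂ * k := by
    rcases h₂ with rfl | rfl <;> rcases h₄ with rfl | rfl <;> omega
  exact ⟨_, _, _, hσ, hτ, p1, e1, by rw [e2, e3]⟩

lemma isCoprime_mul_pow {a b r s : ℤ} (hcop : IsCoprime (r * a) (s * b)) (x y : ℕ) :
    IsCoprime (r * a ^ x) (s * b ^ y) :=
  IsCoprime.mul_left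
    (IsCoprime.mul_right hcop.of_mul_left_left.of_mul_right_left
      hcop.of_mul_left_left.of_mul_right_right.pow_right)
    (IsCoprime.mul_right hcop.of_mul_left_right.of_mul_right_left.pow_left
      hcop.of_mul_left_right.of_mul_right_right.pow)

/-- The divisibility relations between two solutions which differ in both exponents. -/
lemma IsSol.exists_gap {a b c r s : ℤ} {x₁ y₁ x₂ y₂ : ℕ} (ha : 2 ≤ a) (hb : 2 ≤ b) (hr : 0 < r)
    (hs : 0 < s) (hcop : IsCoprime (r * a) (s * b)) (h₁ : IsSol a b c r s x₁ y₁)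
    (h₂ : IsSol a b c r s x₂ y₂) (hx : x₁ < x₂) (hy : y₁ ≠ y₂) :
    ∃ σ τ m : ℤ, (σ = 1 ∨ σ = -1) ∧ (τ = 1 ∨ τ = -1) ∧ 0 < m ∧
      b ^ (max y₁ y₂ - min y₁ y₂) - τ = r * a ^ x₁ * m ∧
      a ^ (x₂ - x₁) - σ = s * b ^ min y₁ y₂ * m := by
  obtain ⟨ε₁, δ₁, hε₁, hδ₁, e₁⟩ := h₁.exists_signs
  obtain ⟨ε₂, δ₂, hε₂, hδ₂, e₂⟩ := h₂.exists_signs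
  have hpos : ∀ {z : ℤ}, 2 ≤ z → ∀ {k : ℕ}, 0 < k → 2 ≤ z ^ k := fun hz k hk =>
    hz.trans (le_self_pow₀ (by omega) hk.ne')
  obtain ⟨d, rfl⟩ := Nat.exists_eq_add_of_lt hx
  have hneg : ∀ {δ : ℤ}, (δ = 1 ∨ δ = -1) → (-δ = 1 ∨ -δ = -1) := fun h => by omega
  rcases lt_or_gt_of_ne hy with hy | hy
  · obtain ⟨e, rfl⟩ := Nat.exists_eq_add_of_lt hy
    rw [max_eq_right hy.le, min_eq_left hy.le, show y₁ + e + 1 - y₁ = e + 1 by omega,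
      show x₁ + d + 1 - x₁ = d + 1 by omega]
    refine exists_cofactor (isCoprime_mul_pow hcop x₁ y₁) (by positivity) (by positivity)
      (hpos ha (by omega)) (hpos hb (by omega)) hε₁ hε₂ (hneg hδ₁) (hneg hδ₂) ?_
    linear_combination e₁ - e₂
  · obtain ⟨e, rfl⟩ := Nat.exists_eq_add_of_lt hy
    rw [max_eq_left hy.le, min_eq_right hy.le, show y₂ + e + 1 - y₂ = e + 1 by omega,
      show x₁ + d + 1 - x₁ = d + 1 by omega]
    refine exists_cofactor (isCoprime_mul_pow hcop x₁ y₂) (by positivity) (by positivity)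
      (hpos ha (by omega)) (hpos hb (by omega)) hε₁ hε₂ hδ₂ hδ₁ ?_
    linear_combination e₁ - e₂

lemma isCoprime_of_pow_sub_eq {a R m σ : ℤ} {d : ℕ} (hd : 0 < d) (hσ : σ = 1 ∨ σ = -1)
    (h : a ^ d - σ = R * m) : IsCoprime a m := by
  obtain ⟨k, rfl⟩ := Nat.exists_eq_add_of_le' hd
  have h1 : IsCoprime a (R * m) := by
    refine ⟨σ * a ^ k, -σ, ?_⟩
    rw [← h]
    rcases hσ with rfl | rfl <;> ring
  exact h1.of_mul_right_right

lemma pow_dvd_of_odd_of_dvd_pow_sub {a b R m τ τ' : ℤ} {d e n : ℕ} (ha : Odd a)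
    (hτ : τ = 1 ∨ τ = -1) (hτ' : τ' = 1 ∨ τ' = -1) (hR : R ≠ 0) (haR : a ∣ R)
    (ham : IsCoprime a m) (h : b ^ e - τ = R * m) (h' : R * a ^ d ∣ b ^ n - τ') :
    a ^ d ∣ (n : ℤ) := by
  rw [← Int.natAbs_dvd_natAbs, Int.natAbs_natCast, Nat.dvd_iff_prime_pow_dvd_dvd]
  intro p k hp hk
  rcases Nat.eq_zero_or_pos k with rfl | hk0
  · simp
  have hk' : (p : ℤ) ^ k ∣ a ^ d := by
    rw [← Int.natCast_dvd] at hk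
    exact_mod_cast hk
  refine pow_dvd_of_dvd_pow_sub hp ?_ hτ hτ' hR haR ham h h' hk'
  rintro rfl
  have h2 : (2 : ℤ) ∣ a ^ d := (dvd_pow_self _ hk0.ne').trans (by exact_mod_cast hk')
  rw [← even_iff_two_dvd] at h2
  exact (Int.not_even_iff_odd.2 ha.pow) h2

lemma pow_dvd_mul_of_dvd_pow_sub {a b R m τ τ' : ℤ} {d e n : ℕ} (hb : Odd b)
    (hτ : τ = 1 ∨ τ = -1) (hτ' : τ' = 1 ∨ τ' = -1) (hR : R ≠ 0) (haR : a ∣ R)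
    (ham : IsCoprime a m) (h : b ^ e - τ = R * m) (h' : R * a ^ d ∣ b ^ n - τ') :
    ∃ T : ℤ, (T = b - 1 ∨ T = b + 1) ∧ a ^ d ∣ T * n := by
  obtain ⟨T, hT, hT2⟩ := two_pow_dvd_of_dvd_pow_sub hb hτ'
  refine ⟨T, hT, ?_⟩
  rw [← Int.natAbs_dvd_natAbs, Nat.dvd_iff_prime_pow_dvd_dvd]
  intro p k hp hk
  rw [← Int.natCast_dvd, Nat.cast_pow] at hk ⊢
  rcases eq_or_ne p 2 with rfl | hp2
  · exact hT2 k n ((hk.trans (dvd_mul_left _ _)).trans h')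
  · refine Dvd.dvd.mul_left ?_ _
    exact_mod_cast pow_dvd_of_dvd_pow_sub hp hp2 hτ hτ' hR haR ham h h' hk

lemma IsSol.lt_of_bounds {a b c r s σ : ℤ} {d X Y : ℕ} (h : IsSol a b c r s X Y) (ha : 2 ≤ a)
    (hb : 3 ≤ b) (hc : 0 < c) (hr : 0 < r) (hs : 0 < s) (hd : 0 < d) (hσ : σ = 1 ∨ σ = -1)
    (hbd : b ∣ a ^ d - σ) (hbX : b ≤ 2 * X) (haX : a ≤ X + 1)
    (hcZ : c ≤ 8 * (2 * X + 1) ^ 2 * Y) (hrZ : r * a ^ d ≤ 8 * (2 * X + 1) ^ 2 * Y)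
    (hsZ : s ≤ 8 * (2 * X + 1) ^ 2 * Y) : Y < 2 ^ 40 ∧ X < 2 ^ 47 := by
  obtain ⟨ε, δ, hε, hδ, e⟩ := h.exists_signs
  obtain ⟨Z, hZ⟩ : ∃ Z : ℤ, Z = 8 * (2 * X + 1) ^ 2 * Y := ⟨_, rfl⟩
  have haX1 : 1 ≤ a ^ X := one_le_pow₀ (by omega)
  have hbY1 : 1 ≤ b ^ Y := one_le_pow₀ (by omega)
  have had1 : 1 ≤ a ^ d := one_le_pow₀ (by omega)
  have hrZ' : r ≤ Z := by rw [hZ]; nlinarith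
  have hA : 0 < r * a ^ X := by positivity
  have hB : 0 < s * b ^ Y := by positivity
  have hle : s * b ^ Y ≤ r * a ^ X + c ∧ r * a ^ X ≤ s * b ^ Y + c := by
    rcases hε with rfl | rfl <;> rcases hδ with rfl | rfl <;> constructor <;> linarith
  refine lt_of_pow_dvd ha hb hc hr hd hσ hε hbd ?_ hbX haX hcZ hrZ ?_ ?_
  · refine ⟨-ε * δ * s, ?_⟩
    rw [← e]
    rcases hε with rfl | rfl <;> ring
  · rw [← hZ] at hcZ ⊢
    nlinarith
  · rw [← hZ] at hcZ hsZ ⊢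
    nlinarith

lemma IsSol.bounds_of_gap {a b c r s σ τ σ' τ' m : ℤ} {x y d e D E X Y : ℕ}
    (hsol : IsSol a b c r s X Y) (ha : 2 ≤ a) (hb : 3 ≤ b) (hbodd : Odd b) (hc : 0 < c)
    (hr : 0 < r) (hs : 0 < s) (hx : 0 < x) (hy : 0 < y) (hd : 0 < d) (he : 0 < e) (hD : 0 < D)
    (hE : 0 < E) (hDX : D ≤ X) (hEY : E ≤ Y) (hσ : σ = 1 ∨ σ = -1) (hτ : τ = 1 ∨ τ = -1)
    (hσ' : σ' = 1 ∨ σ' = -1) (hτ' : τ' = 1 ∨ τ' = -1) (hm : 0 < m)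
    (h₁ : b ^ e - τ = r * a ^ x * m) (h₂ : a ^ d - σ = s * b ^ y * m)
    (h₃ : s * b ^ (y + e) ∣ a ^ D - σ') (h₄ : r * a ^ (x + d) ∣ b ^ E - τ')
    (hcle : c ≤ r * a ^ (x + d) + s * b ^ y) :
    Y < 2 ^ 40 ∧ X < 2 ^ 47 ∧ b ≤ X ∧ a ≤ X + 1 ∧ r ≤ X + 1 ∧ s ≤ 2 * Y := by
  have hbe : b ^ e ≤ D := by
    refine Int.le_of_dvd (by exact_mod_cast hD) (pow_dvd_of_odd_of_dvd_pow_sub hbodd hσ hσ'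
      (by positivity) ((dvd_pow_self b hy.ne').mul_left s) (isCoprime_of_pow_sub_eq he hτ h₁) h₂ ?_)
    rwa [mul_assoc, ← pow_add]
  have had : a ^ d ≤ (b + 1) * E := by
    obtain ⟨T, hT, h⟩ := pow_dvd_mul_of_dvd_pow_sub hbodd hτ hτ' (by positivity)
      ((dvd_pow_self a hx.ne').mul_left r) (isCoprime_of_pow_sub_eq hd hσ h₂) h₁
      (by rwa [mul_assoc, ← pow_add])
    have hE' : (0 : ℤ) < E := by exact_mod_cast hE
    refine (Int.le_of_dvd (mul_pos (by omega) hE') h).trans ?_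
    exact mul_le_mul_of_nonneg_right (by omega) hE'.le
  have hb1 : b ≤ b ^ e := le_self_pow₀ (by omega) he.ne'
  have hb2 : b ≤ b ^ y := le_self_pow₀ (by omega) hy.ne'
  have ha1 : a ≤ a ^ x := le_self_pow₀ (by omega) hx.ne'
  have hDX' : (D : ℤ) ≤ X := by exact_mod_cast hDX
  have hEY' : (E : ℤ) ≤ Y := by exact_mod_cast hEY
  have hY1 : (1 : ℤ) ≤ Y := by exact_mod_cast (hE.trans_le hEY)
  have hbX : b ≤ X := by omega
  have hax : r * a ^ x ≤ X + 1 := by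
    have : r * a ^ x ≤ r * a ^ x * m := le_mul_of_one_le_right (by positivity) hm
    omega
  have hsy : s * b ^ y ≤ a ^ d + 1 := by
    have : s * b ^ y ≤ s * b ^ y * m := le_mul_of_one_le_right (by positivity) hm
    omega
  have haX : a ≤ X + 1 := ha1.trans ((le_mul_of_one_le_left (by positivity) hr).trans hax)
  have hrX : r ≤ X + 1 := (le_mul_of_one_le_right hr.le (by omega)).trans hax
  have hadX : a ^ d ≤ (X + 1) * Y := had.trans (by gcongr)
  have hsY : s ≤ 2 * Y := by
    have h1 : s * b ≤ s * b ^ y := by gcongr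
    have h2 : (b + 1) * E ≤ (b + 1) * Y := by gcongr
    by_contra! h3
    have h4 : (2 * Y + 1) * b ≤ s * b := by gcongr; omega
    have h5 : (Y : ℤ) ≤ b * Y := le_mul_of_one_le_left (by omega) (by omega)
    linarith
  have had0 : 0 < a ^ d := by positivity
  have hbig : (X + 1) * ((X + 1) * (Y : ℤ)) + (X + 1) * Y + 1 ≤ 8 * (2 * X + 1) ^ 2 * Y := by
    have hX0 : (0 : ℤ) ≤ X := by positivity
    have h1 : (X + 1) * (X + 1) + (X + 1) + 1 ≤ 8 * (2 * (X : ℤ) + 1) ^ 2 := by nlinarith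
    have h2 := mul_le_mul_of_nonneg_right h1 (by omega : (0 : ℤ) ≤ Y)
    linarith
  have hXY : (Y : ℤ) ≤ (X + 1) * Y := le_mul_of_one_le_left (by omega) (by omega)
  have hrad : r * a ^ x * a ^ d ≤ (X + 1) * ((X + 1) * (Y : ℤ)) := by gcongr
  have hlt := hsol.lt_of_bounds ha hb hc hr hs hd hσ
    (h₂ ▸ ((dvd_pow_self b hy.ne').mul_left s).mul_right m) (by omega) haX
    (by rw [pow_add, ← mul_assoc] at hcle; linarith)
    (by
      have : r * a ^ d ≤ (X + 1) * ((X + 1) * (Y : ℤ)) := by gcongr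
      linarith)
    (by
      have : (X + 1) * (Y : ℤ) ≤ (X + 1) * ((X + 1) * (Y : ℤ)) :=
        le_mul_of_one_le_left (by positivity) (by omega)
      linarith)
  exact ⟨hlt.1, hlt.2, hbX, haX, hrX, hsY⟩

lemma IsSol.gap_le {a b c r s : ℤ} {x₁ y₁ x₂ y₂ : ℕ} (ha : 2 ≤ a) (hb : 2 ≤ b) (hr : 0 < r)
    (hs : 0 < s) (hcop : IsCoprime (r * a) (s * b)) (h₁ : IsSol a b c r s x₁ y₁)
    (h₂ : IsSol a b c r s x₂ y₂) (hx : x₁ < x₂) (hy : y₁ ≠ y₂) :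
    r * a ^ x₁ ≤ b ^ (max y₁ y₂ - min y₁ y₂) + 1 ∧ s * b ^ min y₁ y₂ ≤ a ^ (x₂ - x₁) + 1 := by
  obtain ⟨σ, τ, m, hσ, hτ, hm, e₁, e₂⟩ := h₁.exists_gap ha hb hr hs hcop h₂ hx hy
  have h1 : r * a ^ x₁ ≤ r * a ^ x₁ * m := le_mul_of_one_le_right (by positivity) hm
  have h2 : s * b ^ min y₁ y₂ ≤ s * b ^ min y₁ y₂ * m :=
    le_mul_of_one_le_right (by positivity) hm
  omega

lemma IsSol.right_le {a b c r s : ℤ} {x₁ y₁ x₂ y₂ : ℕ} (ha : 2 ≤ a) (hb : 2 ≤ b) (hr : 0 < r)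
    (hs : 0 < s) (h₁ : IsSol a b c r s x₁ y₁) (h₂ : IsSol a b c r s x₂ y₂) :
    s * b ^ y₂ ≤ s * b ^ y₁ + r * a ^ x₁ + r * a ^ x₂ := by
  obtain ⟨ε₁, δ₁, hε₁, hδ₁, e₁⟩ := h₁.exists_signs
  obtain ⟨ε₂, δ₂, hε₂, hδ₂, e₂⟩ := h₂.exists_signs
  have hA₁ : 0 < r * a ^ x₁ := by positivity
  have hA₂ : 0 < r * a ^ x₂ := by positivity
  have hB₁ : 0 < s * b ^ y₁ := by positivity
  have hB₂ : 0 < s * b ^ y₂ := by positivity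
  rcases hε₁ with rfl | rfl <;> rcases hδ₁ with rfl | rfl <;> rcases hε₂ with rfl | rfl <;>
    rcases hδ₂ with rfl | rfl <;> linarith

lemma IsSol.le_add {a b c r s : ℤ} {x y : ℕ} (ha : 2 ≤ a) (hb : 2 ≤ b) (hr : 0 < r)
    (hs : 0 < s) (h : IsSol a b c r s x y) : c ≤ r * a ^ x + s * b ^ y := by
  obtain ⟨ε, δ, hε, hδ, e⟩ := h.exists_signs
  have hA : 0 < r * a ^ x := by positivity
  have hB : 0 < s * b ^ y := by positivity
  rcases hε with rfl | rfl <;> rcases hδ with rfl | rfl <;> linarith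

lemma mul_pow_le_pow_of_lt {z k : ℤ} (hz : k ≤ z) {m l : ℕ} (h : m < l)
    (hz1 : 1 ≤ z) : k * z ^ m ≤ z ^ l := by
  calc k * z ^ m ≤ z * z ^ m := by gcongr
    _ = z ^ (m + 1) := (pow_succ' z m).symm
    _ ≤ z ^ l := pow_le_pow_right₀ hz1 h

/-- Among three solutions with distinct coordinates, the one with maximal `x` has maximal `y`. -/
lemma IsSol.lt_right_of_lt {a b c r s : ℤ} {x₁ y₁ x₂ y₂ x₃ y₃ : ℕ} (ha : 2 ≤ a) (hb : 3 ≤ b)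
    (hr : 0 < r) (hs : 0 < s) (hcop : IsCoprime (r * a) (s * b)) (h₁ : IsSol a b c r s x₁ y₁)
    (h₂ : IsSol a b c r s x₂ y₂) (h₃ : IsSol a b c r s x₃ y₃) (hx₁₂ : x₁ < x₂) (hx₂₃ : x₂ < x₃)
    (hy₁₂ : y₁ ≠ y₂) (hy₁₃ : y₁ ≠ y₃) (hy₂₃ : y₂ ≠ y₃) : y₁ < y₃ ∧ y₂ < y₃ := by
  have hb' : 2 ≤ b := by omega
  have hx₁ := h₁.1
  have hy₁ := h₁.2.1
  have hy₂ := h₂.2.1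
  have hy₃ := h₃.2.1
  obtain ⟨g₁, g₂⟩ := h₁.gap_le ha hb' hr hs hcop h₂ hx₁₂ hy₁₂
  obtain ⟨g₃, g₄⟩ := h₂.gap_le ha hb' hr hs hcop h₃ hx₂₃ hy₂₃
  have ha2 : ∀ {m l : ℕ}, m < l → 2 * a ^ m ≤ a ^ l := fun h =>
    mul_pow_le_pow_of_lt ha h (by omega)
  have hb3 : ∀ {m l : ℕ}, m < l → 3 * b ^ m ≤ b ^ l := fun h =>
    mul_pow_le_pow_of_lt hb h (by omega)
  have ha4 : ∀ {m l : ℕ}, m + 1 < l → 4 * a ^ m ≤ a ^ l := fun {m l} h => by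
    have e1 := ha2 h
    have e2 := ha2 (show m < m + 1 by omega)
    linarith
  have hb9 : ∀ {m l : ℕ}, m + 1 < l → 9 * b ^ m ≤ b ^ l := fun {m l} h => by
    have e1 := hb3 h
    have e2 := hb3 (show m < m + 1 by omega)
    linarith
  have har : ∀ m : ℕ, a ^ m ≤ r * a ^ m := fun m => le_mul_of_one_le_left (by positivity) hr
  have hbs : ∀ m : ℕ, b ^ m ≤ s * b ^ m := fun m => le_mul_of_one_le_left (by positivity) hs
  have hA₁₂ : 2 * (r * a ^ x₁) ≤ r * a ^ x₂ := by
    linarith [mul_le_mul_of_nonneg_left (ha2 hx₁₂) hr.le]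
  by_contra hcon
  rcases lt_or_gt_of_ne hy₂₃ with h | h
  · -- `y₂ < y₃ < y₁`
    have hy : y₃ < y₁ := by omega
    rw [max_eq_right h.le, min_eq_left h.le] at g₃
    have e1 := h₂.right_le ha hb' hr hs h₁
    have e2 := hb9 (show y₃ - y₂ + 1 < y₁ by omega)
    have e3 := mul_le_mul_of_nonneg_left (hb9 (show y₂ + 1 < y₁ by omega)) hs.le
    have e4 := hbs y₁
    have e5 : 1 ≤ b ^ (y₃ - y₂) := one_le_pow₀ (by omega)
    linarith
  · rcases lt_or_gt_of_ne hy₁₃ with h' | h'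
    · -- `y₁ < y₃ < y₂`
      rw [max_eq_left h.le, min_eq_right h.le] at g₃
      have e1 := h₁.right_le ha hb' hr hs h₂
      have e2 := hb9 (show y₂ - y₃ + 1 < y₂ by omega)
      have e3 := mul_le_mul_of_nonneg_left (hb9 (show y₁ + 1 < y₂ by omega)) hs.le
      have e4 := hbs y₂
      have e5 : 1 ≤ b ^ (y₂ - y₃) := one_le_pow₀ (by omega)
      linarith
    · rcases lt_or_gt_of_ne hy₁₂ with h'' | h''
      · -- `y₃ < y₁ < y₂`
        rw [min_eq_left h''.le] at g₂
        have e1 := h₁.symm.right_le hb' ha hs hr h₃.symm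
        have e2 := ha4 (show x₂ - x₁ + 1 < x₃ by omega)
        have e3 := mul_le_mul_of_nonneg_left (ha4 (show x₁ + 1 < x₃ by omega)) hr.le
        have e4 := mul_le_mul_of_nonneg_left (hb3 h') hs.le
        have e5 := har x₃
        have e6 : 1 ≤ a ^ (x₂ - x₁) := one_le_pow₀ (by omega)
        linarith
      · -- `y₃ < y₂ < y₁`
        rw [min_eq_right h''.le] at g₂
        rw [max_eq_left h.le, min_eq_right h.le] at g₃
        have e1 := ha2 (show x₂ - x₁ < x₂ by omega)
        have e2 := hb3 (show y₂ - y₃ < y₂ by omega)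
        have e3 := har x₂
        have e4 := hbs y₂
        have e5 : 1 ≤ a ^ (x₂ - x₁) := one_le_pow₀ (by omega)
        linarith

lemma IsSol.bounds_of_lt {a b c r s : ℤ} {x₁ y₁ x₂ y₂ x₃ y₃ : ℕ} (ha : 2 ≤ a) (hb : 3 ≤ b)
    (hbodd : Odd b) (hc : 0 < c)
    (hr : 0 < r) (hs : 0 < s) (hcop : IsCoprime (r * a) (s * b)) (h₁ : IsSol a b c r s x₁ y₁)
    (h₂ : IsSol a b c r s x₂ y₂) (h₃ : IsSol a b c r s x₃ y₃) (hx₁₂ : x₁ < x₂) (hx₂₃ : x₂ < x₃)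
    (hy₁₂ : y₁ ≠ y₂) (hy₁₃ : y₁ < y₃) (hy₂₃ : y₂ < y₃) :
    y₃ < 2 ^ 40 ∧ x₃ < 2 ^ 47 ∧ b ≤ x₃ ∧ a ≤ x₃ + 1 ∧ r ≤ x₃ + 1 ∧ s ≤ 2 * y₃ := by
  have hb' : 2 ≤ b := by omega
  obtain ⟨σ, τ, m, hσ, hτ, hm, e₁, e₂⟩ := h₁.exists_gap ha hb' hr hs hcop h₂ hx₁₂ hy₁₂
  obtain ⟨σ', τ', m', hσ', hτ', hm', e₁', e₂'⟩ :=
    h₂.exists_gap ha hb' hr hs hcop h₃ hx₂₃ hy₂₃.ne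
  rw [max_eq_right hy₂₃.le, min_eq_left hy₂₃.le] at e₁'
  rw [min_eq_left hy₂₃.le] at e₂'
  have hA : r * a ^ x₁ ≤ r * a ^ x₂ :=
    mul_le_mul_of_nonneg_left (pow_le_pow_right₀ (by omega) hx₁₂.le) hr.le
  have hx : x₁ + (x₂ - x₁) = x₂ := by omega
  rcases lt_or_gt_of_ne hy₁₂ with h | h
  · rw [max_eq_right h.le, min_eq_left h.le] at e₁
    rw [min_eq_left h.le] at e₂
    refine h₃.bounds_of_gap ha hb hbodd hc hr hs h₁.1 h₁.2.1 (show 0 < x₂ - x₁ by omega)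
      (show 0 < y₂ - y₁ by omega) (show 0 < x₃ - x₂ by omega) (show 0 < y₃ - y₂ by omega)
      (Nat.sub_le _ _) (Nat.sub_le _ _) hσ hτ hσ' hτ' hm e₁ e₂ ?_ ?_ ?_
    · rw [show y₁ + (y₂ - y₁) = y₂ by omega, e₂']
      exact dvd_mul_right _ _
    · rw [hx, e₁']
      exact dvd_mul_right _ _
    · rw [hx]
      linarith [h₁.le_add ha hb' hr hs]
  · rw [max_eq_left h.le, min_eq_right h.le] at e₁
    rw [min_eq_right h.le] at e₂
    obtain ⟨σ'', τ'', m'', hσ'', hτ'', hm'', e₁'', e₂''⟩ :=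
      h₁.exists_gap ha hb' hr hs hcop h₃ (hx₁₂.trans hx₂₃) hy₁₃.ne
    rw [min_eq_left hy₁₃.le] at e₂''
    refine h₃.bounds_of_gap ha hb hbodd hc hr hs h₁.1 h₂.2.1 (show 0 < x₂ - x₁ by omega)
      (show 0 < y₁ - y₂ by omega) (show 0 < x₃ - x₁ by omega) (show 0 < y₃ - y₂ by omega)
      (Nat.sub_le _ _) (Nat.sub_le _ _) hσ hτ hσ'' hτ' hm e₁ e₂ ?_ ?_ ?_
    · rw [show y₂ + (y₁ - y₂) = y₁ by omega, e₂'']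
      exact dvd_mul_right _ _
    · rw [hx, e₁']
      exact dvd_mul_right _ _
    · rw [hx]
      exact h₂.le_add ha hb' hr hs

lemma IsSol.left_ne {a b c r s : ℤ} {x y₁ y₂ : ℕ} (hb : 3 ≤ b) (hs : 0 < s)
    (hcop : IsCoprime (r * a) (s * b)) (h₁ : IsSol a b c r s x y₁)
    (h₂ : IsSol a b c r s x y₂) : ¬ y₁ < y₂ := by
  intro hy
  obtain ⟨ε₁, δ₁, hε₁, hδ₁, e₁⟩ := h₁.exists_signs
  obtain ⟨ε₂, δ₂, hε₂, hδ₂, e₂⟩ := h₂.exists_signs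
  obtain ⟨e, rfl⟩ := Nat.exists_eq_add_of_lt hy
  have hE : b ≤ b ^ (e + 1) := le_self_pow₀ (by omega) (by omega)
  have hW : b ≤ s * b ^ y₁ := (le_self_pow₀ (by omega) h₁.2.1.ne').trans
    (le_mul_of_one_le_left (by positivity) hs)
  have hrel : r * a ^ x * (ε₁ - ε₂) = s * b ^ y₁ * (δ₂ * b ^ (e + 1) - δ₁) := by
    linear_combination e₁ - e₂
  have hdvd : s * b ^ y₁ ∣ ε₁ - ε₂ :=
    (isCoprime_mul_pow hcop x y₁).symm.dvd_of_dvd_mul_left ⟨_, hrel⟩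
  rcases eq_or_ne ε₁ ε₂ with h | h
  · rw [h, sub_self, mul_zero] at hrel
    rcases mul_eq_zero.1 hrel.symm with h0 | h0
    · omega
    · rcases hδ₁ with rfl | rfl <;> rcases hδ₂ with rfl | rfl <;> omega
  · have h2 : s * b ^ y₁ ∣ 2 := by
      rcases hε₁ with rfl | rfl <;> rcases hε₂ with rfl | rfl
      · exact absurd rfl h
      · exact hdvd
      · exact (dvd_neg (b := (2 : ℤ))).1 hdvd
      · exact absurd rfl h
    have := Int.le_of_dvd (by norm_num) h2
    omega

lemma IsSol.eq_of_right_eq {a b c r s : ℤ} {x₁ x₂ y : ℕ} (ha : 2 ≤ a) (hb : 2 ≤ b) (hc : 0 < c)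
    (hr : 0 < r) (hs : 0 < s) (hcop : IsCoprime (r * a) (s * b)) (h₁ : IsSol a b c r s x₁ y)
    (h₂ : IsSol a b c r s x₂ y) (hx : x₁ < x₂) :
    r = 1 ∧ a = 2 ∧ x₁ = 1 ∧ ∃ σ : ℤ, (σ = 1 ∨ σ = -1) ∧ s * b ^ y = 2 ^ (x₂ - 1) + σ ∧
      c = 2 ^ (x₂ - 1) - σ := by
  obtain ⟨ε₁, δ₁, hε₁, hδ₁, e₁⟩ := h₁.exists_signs
  obtain ⟨ε₂, δ₂, hε₂, hδ₂, e₂⟩ := h₂.exists_signs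
  obtain ⟨d, rfl⟩ := Nat.exists_eq_add_of_lt hx
  have hX : a ≤ a ^ (d + 1) := le_self_pow₀ (by omega) (by omega)
  have ha1 : a ≤ a ^ x₁ := le_self_pow₀ (by omega) h₁.1.ne'
  have hR : a ^ x₁ ≤ r * a ^ x₁ := le_mul_of_one_le_left (by positivity) hr
  have hrel : s * b ^ y * (δ₁ - δ₂) = r * a ^ x₁ * (ε₂ * a ^ (d + 1) - ε₁) := by
    linear_combination e₁ - e₂
  have hdvd : r * a ^ x₁ ∣ δ₁ - δ₂ :=
    (isCoprime_mul_pow hcop x₁ y).dvd_of_dvd_mul_left ⟨_, hrel⟩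
  have hne : δ₁ ≠ δ₂ := by
    intro h
    rw [h, sub_self, mul_zero] at hrel
    rcases mul_eq_zero.1 hrel.symm with h0 | h0
    · omega
    · rcases hε₁ with rfl | rfl <;> rcases hε₂ with rfl | rfl <;> omega
  have h2 : r * a ^ x₁ ∣ 2 := by
    rcases hδ₁ with rfl | rfl <;> rcases hδ₂ with rfl | rfl
    · exact absurd rfl hne
    · exact hdvd
    · exact (dvd_neg (b := (2 : ℤ))).1 hdvd
    · exact absurd rfl hne
  have hle := Int.le_of_dvd (by norm_num) h2
  have ha2 : a = 2 := by omega
  subst ha2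
  have hx1 : x₁ = 1 := by
    refine Nat.pow_right_injective le_rfl ?_
    have : (2 : ℤ) ^ x₁ = 2 := by omega
    exact_mod_cast this
  subst hx1
  have hr1 : r = 1 := by omega
  subst hr1
  refine ⟨rfl, rfl, rfl, -ε₁, by omega, ?_⟩
  rw [show 1 + d + 1 - 1 = d + 1 by omega]
  rw [show 1 + d + 1 = (d + 1) + 1 by omega, pow_succ _ (d + 1)] at e₂
  rw [pow_one] at e₁
  have hW : 0 < s * b ^ y := by positivity
  generalize s * b ^ y = W at e₁ e₂ hW ⊢
  generalize (2 : ℤ) ^ (d + 1) = Q at e₂ hX ⊢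
  clear hrel hdvd
  rcases hε₁ with rfl | rfl <;> rcases hδ₁ with rfl | rfl <;> rcases hε₂ with rfl | rfl <;>
    rcases hδ₂ with rfl | rfl <;> omega

lemma exists_sub_pow_eq {σ : ℤ} (hσ : σ = 1 ∨ σ = -1) (B : ℤ) (n : ℕ) :
    ∃ q : ℤ, (B - σ) ^ n = (-σ) ^ n * (1 - σ * n * B) + B ^ 2 * q := by
  have h1 : σ * σ = 1 := by rcases hσ with rfl | rfl <;> rfl
  induction n with
  | zero => exact ⟨0, by simp⟩
  | succ n ih =>
    obtain ⟨q, hq⟩ := ih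
    refine ⟨q * (B - σ) - (-σ) ^ n * σ * n, ?_⟩
    rw [pow_succ, hq, pow_succ]
    push_cast
    linear_combination -(-σ) ^ n * B * h1

lemma eq_zero_of_dvd_two_pow_add {B σ τ : ℤ} {f ρ : ℕ} (hf : 3 ≤ f) (hσ : σ = 1 ∨ σ = -1)
    (hτ : τ = 1 ∨ τ = -1) (hB : B = 2 ^ f + σ) (hρ : ρ < f) (h : B ∣ 2 ^ ρ + τ) : ρ = 0 := by
  by_contra h0
  obtain ⟨ρ, rfl⟩ := Nat.exists_eq_succ_of_ne_zero h0
  obtain ⟨g, rfl⟩ := Nat.exists_eq_add_of_le' (show 1 ≤ f by omega)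
  have h1 : (2 : ℤ) ^ (ρ + 1) ≤ 2 ^ g := pow_le_pow_right₀ (by norm_num) (by omega)
  have h2 : (2 : ℤ) ^ 2 ≤ 2 ^ g := pow_le_pow_right₀ (by norm_num) (by omega)
  have h3 : (1 : ℤ) ≤ 2 ^ ρ := one_le_pow₀ (by norm_num)
  have h4 := Int.le_of_dvd (by rw [pow_succ]; omega) h
  rw [pow_succ] at hB
  simp only [Nat.succ_eq_add_one] at h4
  omega

/-- If `ε * 2 ^ N ≡ -σ` modulo `B = 2 ^ f + σ`, the quotient is `N / f` modulo `B`. -/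
lemma exists_eq_add_of_two_pow {B σ ε k : ℤ} {f N : ℕ} (hf : 3 ≤ f) (hσ : σ = 1 ∨ σ = -1)
    (hε : ε = 1 ∨ ε = -1) (hB : B = 2 ^ f + σ) (hfN : f ≤ N) (h : ε * 2 ^ N + σ = B * k) :
    ∃ n : ℕ, ∃ q : ℤ, 0 < n ∧ n ≤ N ∧ k = n + B * q := by
  have hB7 : 7 ≤ B := by
    have : (2 : ℤ) ^ 3 ≤ 2 ^ f := pow_le_pow_right₀ (by norm_num) hf
    omega
  obtain ⟨q, hq⟩ := exists_sub_pow_eq hσ B (N / f)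
  have hu : (-σ) ^ (N / f) = 1 ∨ (-σ) ^ (N / f) = -1 := by
    rcases hσ with rfl | rfl
    · exact neg_one_pow_eq_or ℤ _
    · simp
  have hN : (2 : ℤ) ^ N = (B - σ) ^ (N / f) * 2 ^ (N % f) := by
    rw [hB, add_sub_cancel_right, ← pow_mul, ← pow_add, Nat.div_add_mod]
  rw [hq] at hN
  generalize (-σ) ^ (N / f) = u at hu hN
  have hρ : N % f = 0 := by
    refine eq_zero_of_dvd_two_pow_add hf hσ (τ := ε * u * σ) ?_ hB (Nat.mod_lt _ (by omega)) ?_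
    · rcases hε with rfl | rfl <;> rcases hu with rfl | rfl <;> rcases hσ with rfl | rfl <;> simp
    · refine ⟨ε * u * (k + ε * u * σ * (N / f : ℕ) * 2 ^ (N % f) - ε * B * q * 2 ^ (N % f)), ?_⟩
      have h1 : ε * ε = 1 := by rcases hε with rfl | rfl <;> rfl
      have h2 : u * u = 1 := by rcases hu with rfl | rfl <;> rfl
      rw [hN] at h
      generalize (2 : ℤ) ^ (N % f) = P at h ⊢
      generalize ((N / f : ℕ) : ℤ) = n at h ⊢
      rcases hε with rfl | rfl <;> rcases hu with rfl | rfl <;> linarith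
  rw [hρ, pow_zero, mul_one] at hN
  rw [hN] at h
  have hεu : ε * u = -σ := by
    have hd : B ∣ ε * u + σ := ⟨k + ε * u * σ * (N / f : ℕ) - ε * B * q, by linarith⟩
    rcases hε with rfl | rfl <;> rcases hu with rfl | rfl <;> rcases hσ with rfl | rfl <;>
      first
      | rfl
      | (exfalso; norm_num at hd; have := Int.le_of_dvd (by norm_num) hd; omega)
  refine ⟨N / f, ε * q, Nat.div_pos hfN (by omega), Nat.div_le_self _ _, ?_⟩
  refine mul_left_cancel₀ (show B ≠ 0 by omega) ?_
  have h1 : σ * σ = 1 := by rcases hσ with rfl | rfl <;> rfl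
  linear_combination -h + (1 - σ * (N / f : ℕ) * B) * hεu + (N / f : ℕ) * B * h1

/-- The bound when `(1, y)` and `(f + 1, y)` are solutions and a third one has larger `y`. -/
lemma IsSol.bounds_of_tie_lt {b c s σ : ℤ} {f y X Y : ℕ} (hb : 3 ≤ b) (hbodd : Odd b) (hc : 0 < c)
    (hs : 0 < s) (hcop : IsCoprime (1 * 2) (s * b)) (h : IsSol 2 b c 1 s (f + 1) y)
    (h' : IsSol 2 b c 1 s X Y) (hf : 0 < f) (hσ : σ = 1 ∨ σ = -1) (hB : s * b ^ y = 2 ^ f + σ)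
    (hC : c = 2 ^ f - σ) (hX : 3 ≤ f ∨ 3 ≤ X) (hXf : X ≠ f + 1) (hY : y < Y) :
    b ≤ 2 * X ∧ s ≤ 2 * Y ∧ f < X ∧ Y < 2 ^ 40 ∧ X < 2 ^ 47 := by
  have hbB : b ≤ b ^ y := le_self_pow₀ (by omega) h.2.1.ne'
  have hsB : s * b ≤ s * b ^ y := mul_le_mul_of_nonneg_left hbB hs.le
  have hY0 : (0 : ℤ) < Y := by exact_mod_cast h'.2.1
  have hbs : b ≤ s * b := le_mul_of_one_le_left (by omega) hs
  have key : b ≤ 2 * X ∧ (2 : ℤ) ^ f ≤ (b + 1) * Y ∧ f < X := by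
    rcases Nat.lt_or_ge f 3 with hf3 | hf3
    · have : (2 : ℤ) ^ f ≤ 2 ^ 2 := pow_le_pow_right₀ (by norm_num) (by omega)
      refine ⟨by omega, by nlinarith, by omega⟩
    · have hf8 : (2 : ℤ) ^ 3 ≤ 2 ^ f := pow_le_pow_right₀ (by norm_num) hf3
      obtain ⟨ε, δ, hε, hδ, e⟩ := h'.exists_signs
      obtain ⟨e₀, rfl⟩ := Nat.exists_eq_add_of_lt hY
      have hbe : b ≤ b ^ (e₀ + 1) := le_self_pow₀ (by omega) (by omega)
      have hBb : s * b ^ (y + e₀ + 1) = (2 ^ f + σ) * b ^ (e₀ + 1) := by rw [← hB]; ring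
      have hlarge : 3 * (2 ^ f + σ) ≤ (2 ^ f + σ) * b ^ (e₀ + 1) := by nlinarith
      have hfX : f + 1 < X := by
        by_contra hcon
        have h0 : -1 ≤ σ ∧ σ ≤ 1 := by omega
        have h2 : (0 : ℤ) < 2 ^ X := by positivity
        have h1 : (2 : ℤ) ^ X ≤ 2 ^ f := pow_le_pow_right₀ (by norm_num) (by omega)
        rw [hBb] at e
        rcases hε with rfl | rfl <;> rcases hδ with rfl | rfl <;> linarith
      refine ⟨?_, ?_, by omega⟩
      · obtain ⟨N, rfl⟩ := Nat.exists_eq_add_of_le' (show 1 ≤ X by omega)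
        obtain ⟨k, hk⟩ : Even (1 - δ * b ^ (e₀ + 1)) := by
          refine odd_one.sub_odd (Odd.mul ?_ hbodd.pow)
          rcases hδ with rfl | rfl <;> decide
        have hk2 : ε * 2 ^ N + σ = (2 ^ f + σ) * k := by
          rw [hBb, hC, pow_succ] at e
          refine mul_left_cancel₀ (two_ne_zero' ℤ) ?_
          linear_combination e + (2 ^ f + σ) * hk
        rw [← hB] at hk2
        obtain ⟨n, q, hn, hnN, hkn⟩ := exists_eq_add_of_two_pow hf3 hσ hε hB (by omega) hk2
        have hdvd : b ∣ 2 * n - 1 := by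
          have h1 : b ∣ s * b ^ y := (dvd_pow_self b h.2.1.ne').mul_left s
          have h2 : b ∣ b ^ (e₀ + 1) := dvd_pow_self b (by omega)
          have h3 : (2 * n - 1 : ℤ) = -δ * b ^ (e₀ + 1) - s * b ^ y * (2 * q) := by
            linear_combination -2 * hkn - hk
          rw [h3]
          exact dvd_sub (h2.mul_left _) (h1.mul_right _)
        have := Int.le_of_dvd (by omega) hdvd
        push_cast
        omega
      · obtain ⟨σ', τ, m, hσ', hτ, hm, e₁, e₂⟩ :=
          h.exists_gap le_rfl (by omega) one_pos hs hcop h' hfX hY.ne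
        rw [max_eq_right hY.le, min_eq_left hY.le, one_mul] at e₁
        obtain ⟨T, hT, hT2⟩ := two_pow_dvd_of_dvd_pow_sub hbodd hτ
        have h1 := Int.le_of_dvd (mul_pos (by omega) (by omega)) (hT2 _ _ ⟨m, e₁⟩)
        rw [pow_succ] at h1
        have h2 : T * (y + e₀ + 1 - y : ℕ) ≤ (b + 1) * (y + e₀ + 1 : ℕ) :=
          mul_le_mul (by omega) (by omega) (by omega) (by omega)
        linarith
  obtain ⟨hbX, hfY, hfX⟩ := key
  have hsY : s ≤ 2 * Y := by
    by_contra hcon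
    have h1 : (2 * Y + 1) * b ≤ s * b := mul_le_mul_of_nonneg_right (by omega) (by omega)
    have h2 : Y * 3 ≤ Y * b := mul_le_mul_of_nonneg_left hb hY0.le
    have h3 : σ ≤ 1 := by omega
    linarith
  have hXY : (2 * X + 1) * Y ≤ (8 * (2 * X + 1) ^ 2 * Y : ℤ) := by
    nlinarith [mul_pos (show (0 : ℤ) < 2 * X + 1 by omega) hY0]
  have hfXY : (2 : ℤ) ^ f ≤ (2 * X + 1) * Y :=
    hfY.trans (mul_le_mul_of_nonneg_right (by omega) hY0.le)
  have hXY1 : (2 * X + 1) * Y + 1 ≤ (8 * (2 * X + 1) ^ 2 * Y : ℤ) := by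
    nlinarith [mul_pos (show (0 : ℤ) < 2 * X + 1 by omega) hY0]
  refine ⟨hbX, hsY, hfX, h'.lt_of_bounds le_rfl hb hc one_pos hs hf (σ := -σ) (by omega) ?_ hbX
    (by omega) (by omega) (by omega) (by nlinarith)⟩
  rw [sub_neg_eq_add, ← hB]
  exact (dvd_pow_self b h.2.1.ne').mul_left s

/-- The bound when `(1, y)` and `(f + 1, y)` are solutions. -/
lemma IsSol.bounds_of_tie {b c s σ : ℤ} {f y X Y : ℕ} (hb : 3 ≤ b) (hbodd : Odd b) (hc : 0 < c)
    (hs : 0 < s) (hcop : IsCoprime (1 * 2) (s * b)) (h : IsSol 2 b c 1 s (f + 1) y)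
    (h' : IsSol 2 b c 1 s X Y) (hf : 0 < f) (hσ : σ = 1 ∨ σ = -1) (hB : s * b ^ y = 2 ^ f + σ)
    (hC : c = 2 ^ f - σ) (hX1 : X ≠ 1) (hXf : X ≠ f + 1) (hY : y ≠ Y) :
    b < 2 ^ 48 ∧ s < 2 ^ 48 ∧ f + 1 < 2 ^ 48 ∧ y < 2 ^ 48 ∧ X < 2 ^ 48 ∧ Y < 2 ^ 48 := by
  have hX0 := h'.1
  have small : ∀ {x z : ℕ}, (2 : ℤ) ^ x < 16 → b ^ z < 16 → s * b ^ z < 16 → 0 < z →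
      x < 4 ∧ z < 4 ∧ b < 16 ∧ s < 16 := by
    intro x z h1 h2 h3 hz
    refine ⟨?_, ?_, ?_, ?_⟩
    · by_contra hcon
      have : (2 : ℤ) ^ 4 ≤ 2 ^ x := pow_le_pow_right₀ (by norm_num) (by omega)
      omega
    · by_contra hcon
      have : b ^ 4 ≤ b ^ z := pow_le_pow_right₀ (by omega) (by omega)
      have : 3 ^ 4 ≤ b ^ 4 := pow_le_pow_left₀ (by omega) hb 4
      omega
    · exact (le_self_pow₀ (by omega) hz.ne').trans_lt h2
    · have : s ≤ s * b ^ z := le_mul_of_one_le_right hs.le (one_le_pow₀ (by omega))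
      omega
  have hle : ∀ z : ℕ, b ^ z ≤ s * b ^ z := fun z =>
    le_mul_of_one_le_left (by positivity) hs
  obtain ⟨ε, δ, hε, hδ, e⟩ := h'.exists_signs
  have hX2 : (0 : ℤ) < 2 ^ X := by positivity
  have hfp : (0 : ℤ) < 2 ^ f := by positivity
  rcases lt_or_gt_of_ne hY with hlt | hgt
  · by_cases hX : 3 ≤ f ∨ 3 ≤ X
    · obtain ⟨h1, h2, h3, h4, h5⟩ :=
        h.bounds_of_tie_lt hb hbodd hc hs hcop h' hf hσ hB hC hX hXf hlt
      omega
    · have h1 : (2 : ℤ) ^ f ≤ 2 ^ 2 := pow_le_pow_right₀ (by norm_num) (by omega)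
      have h2 : (2 : ℤ) ^ X ≤ 2 ^ 2 := pow_le_pow_right₀ (by norm_num) (by omega)
      have hBle := hle Y
      have hBY : s * b ^ Y < 16 := by
        rcases hε with rfl | rfl <;> rcases hδ with rfl | rfl <;> omega
      have := small (by omega : (2 : ℤ) ^ X < 16) (by omega) hBY h'.2.1
      omega
  · obtain ⟨e₀, rfl⟩ := Nat.exists_eq_add_of_lt hgt
    have hbe : b ≤ b ^ (e₀ + 1) := le_self_pow₀ (by omega) (by omega)
    have hbY : b ≤ s * b ^ Y := (le_self_pow₀ (by omega) h'.2.1.ne').trans (hle Y)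
    have h3 : 3 * (s * b ^ Y) ≤ s * b ^ (Y + e₀ + 1) := by
      calc 3 * (s * b ^ Y) ≤ b ^ (e₀ + 1) * (s * b ^ Y) :=
            mul_le_mul_of_nonneg_right (by omega) (by omega)
        _ = s * b ^ (Y + e₀ + 1) := by ring
    have hBle := hle (Y + e₀ + 1)
    rcases Nat.lt_or_ge f 4 with hf4 | hf4
    · have h1 : (2 : ℤ) ^ f ≤ 2 ^ 3 := pow_le_pow_right₀ (by norm_num) (by omega)
      have h2 : (2 : ℤ) ^ X < 16 := by
        rcases hε with rfl | rfl <;> rcases hδ with rfl | rfl <;> omega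
      have := small h2 (by omega) (by omega) (by omega : 0 < Y + e₀ + 1)
      omega
    · exfalso
      have h1 : (2 : ℤ) ^ 4 ≤ 2 ^ f := pow_le_pow_right₀ (by norm_num) hf4
      rcases lt_trichotomy X f with h | rfl | h
      · have h2 : (2 : ℤ) ^ (X + 1) ≤ 2 ^ f := pow_le_pow_right₀ (by norm_num) h
        rw [pow_succ] at h2
        rcases hε with rfl | rfl <;> rcases hδ with rfl | rfl <;> omega
      · rcases hε with rfl | rfl <;> rcases hδ with rfl | rfl <;> omega
      · have h2 : (2 : ℤ) ^ (f + 2) ≤ 2 ^ X := pow_le_pow_right₀ (by norm_num) (by omega)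
        rw [pow_add] at h2
        rcases hε with rfl | rfl <;> rcases hδ with rfl | rfl <;> omega

lemma IsSol.bounds_of_right_eq {a b c r s : ℤ} {x₁ x₂ y X Y : ℕ} (ha : 2 ≤ a) (hb : 3 ≤ b)
    (hbodd : Odd b) (hc : 0 < c) (hr : 0 < r) (hs : 0 < s) (hcop : IsCoprime (r * a) (s * b))
    (h₁ : IsSol a b c r s x₁ y) (h₂ : IsSol a b c r s x₂ y) (h : IsSol a b c r s X Y)
    (hx : x₁ < x₂) (hX₁ : X ≠ x₁) (hX₂ : X ≠ x₂) (hY : y ≠ Y) :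
    a < 2 ^ 48 ∧ b < 2 ^ 48 ∧ r < 2 ^ 48 ∧ s < 2 ^ 48 ∧ x₁ < 2 ^ 48 ∧ y < 2 ^ 48 ∧ x₂ < 2 ^ 48 ∧
      X < 2 ^ 48 ∧ Y < 2 ^ 48 := by
  obtain ⟨rfl, rfl, rfl, σ, hσ, hB, hC⟩ :=
    h₁.eq_of_right_eq ha (by omega) hc hr hs hcop h₂ hx
  obtain ⟨f, rfl⟩ := Nat.exists_eq_add_of_le' h₂.1
  rw [Nat.add_sub_cancel] at hB hC
  have := h₂.bounds_of_tie hb hbodd hc hs hcop h (by omega) hσ hB hC hX₁ hX₂ hY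
  omega

lemma IsSol.bounds_of_sorted {a b c r s : ℤ} {x₁ y₁ x₂ y₂ x₃ y₃ : ℕ} (ha : 2 ≤ a) (hb : 3 ≤ b)
    (hbodd : Odd b) (hc : 0 < c) (hr : 0 < r) (hs : 0 < s) (hcop : IsCoprime (r * a) (s * b))
    (h₁ : IsSol a b c r s x₁ y₁) (h₂ : IsSol a b c r s x₂ y₂) (h₃ : IsSol a b c r s x₃ y₃)
    (hx₁₂ : x₁ < x₂) (hx₂₃ : x₂ < x₃) :
    a < 2 ^ 48 ∧ b < 2 ^ 48 ∧ r < 2 ^ 48 ∧ s < 2 ^ 48 ∧ x₁ < 2 ^ 48 ∧ y₁ < 2 ^ 48 ∧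
      x₂ < 2 ^ 48 ∧ y₂ < 2 ^ 48 ∧ x₃ < 2 ^ 48 ∧ y₃ < 2 ^ 48 := by
  have hy₂₃ : y₂ ≠ y₃ := by
    rintro rfl
    obtain ⟨-, -, h, -⟩ := h₂.eq_of_right_eq ha (by omega) hc hr hs hcop h₃ hx₂₃
    have := h₁.1
    omega
  by_cases hy₁₂ : y₁ = y₂
  · subst hy₁₂
    have := h₁.bounds_of_right_eq ha hb hbodd hc hr hs hcop h₂ h₃ hx₁₂ (by omega) (by omega) hy₂₃
    omega
  by_cases hy₁₃ : y₁ = y₃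
  · subst hy₁₃
    have := h₁.bounds_of_right_eq ha hb hbodd hc hr hs hcop h₃ h₂ (by omega) (by omega) (by omega)
      hy₁₂
    omega
  obtain ⟨h13, h23⟩ := h₁.lt_right_of_lt ha hb hr hs hcop h₂ h₃ hx₁₂ hx₂₃ hy₁₂ hy₁₃ hy₂₃
  have := h₁.bounds_of_lt ha hb hbodd hc hr hs hcop h₂ h₃ hx₁₂ hx₂₃ hy₁₂ h13 h23
  omega

lemma IsSol.bounds_of_odd {a b c r s : ℤ} {p q t : ℕ × ℕ} (ha : 2 ≤ a) (hb : 2 ≤ b)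
    (hbodd : Odd b) (hc : 0 < c) (hr : 0 < r) (hs : 0 < s) (hcop : IsCoprime (r * a) (s * b))
    (hp : IsSol a b c r s p.1 p.2) (hq : IsSol a b c r s q.1 q.2) (ht : IsSol a b c r s t.1 t.2)
    (hpq : p ≠ q) (hpt : p ≠ t) (hqt : q ≠ t) :
    a < 2 ^ 48 ∧ b < 2 ^ 48 ∧ r < 2 ^ 48 ∧ s < 2 ^ 48 ∧ p.1 < 2 ^ 48 ∧ p.2 < 2 ^ 48 := by
  have hb3 : 3 ≤ b := by
    obtain ⟨k, rfl⟩ := hbodd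
    omega
  have hne : ∀ {u v : ℕ × ℕ}, IsSol a b c r s u.1 u.2 → IsSol a b c r s v.1 v.2 → u ≠ v →
      u.1 ≠ v.1 := by
    rintro ⟨x, y⟩ ⟨x', y'⟩ hu hv huv rfl
    have := hu.left_ne hb3 hs hcop hv
    have := hv.left_ne hb3 hs hcop hu
    exact huv (Prod.ext rfl (by dsimp only at *; omega))
  have key : ∀ {u v w : ℕ × ℕ}, IsSol a b c r s u.1 u.2 → IsSol a b c r s v.1 v.2 →
      IsSol a b c r s w.1 w.2 → u.1 < v.1 → v.1 < w.1 → _ := fun hu hv hw =>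
    hu.bounds_of_sorted ha hb3 hbodd hc hr hs hcop hv hw
  rcases lt_or_gt_of_ne (hne hp hq hpq) with h1 | h1 <;>
    rcases lt_or_gt_of_ne (hne hp ht hpt) with h2 | h2 <;>
    rcases lt_or_gt_of_ne (hne hq ht hqt) with h3 | h3
  · have := key hp hq ht h1 h3; omega
  · have := key hp ht hq h2 h3; omega
  · omega
  · have := key ht hp hq h2 h1; omega
  · have := key hq hp ht h1 h2; omega
  · omega
  · have := key hq ht hp h3 h2; omega
  · have := key ht hq hp h3 h1; omega

lemma IsSol.bounds_of_three {a b c r s : ℤ} {p q t : ℕ × ℕ} (ha : 2 ≤ a) (hb : 2 ≤ b)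
    (hc : 0 < c) (hr : 0 < r) (hs : 0 < s) (hcop : IsCoprime (r * a) (s * b))
    (hp : IsSol a b c r s p.1 p.2) (hq : IsSol a b c r s q.1 q.2) (ht : IsSol a b c r s t.1 t.2)
    (hpq : p ≠ q) (hpt : p ≠ t) (hqt : q ≠ t) :
    a < 2 ^ 48 ∧ b < 2 ^ 48 ∧ r < 2 ^ 48 ∧ s < 2 ^ 48 ∧ p.1 < 2 ^ 48 ∧ p.2 < 2 ^ 48 := by
  rcases Int.even_or_odd b with hbe | hbo
  · have hao : Odd a := by
      rw [← Int.not_even_iff_odd]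
      intro hae
      have := hcop.of_mul_left_right.of_mul_right_right.isUnit_of_dvd'
        (even_iff_two_dvd.1 hae) (even_iff_two_dvd.1 hbe)
      exact absurd this (by decide)
    have hswap := Prod.swap_injective (α := ℕ) (β := ℕ)
    have := IsSol.bounds_of_odd (p := p.swap) (q := q.swap) (t := t.swap) hb ha hao hc hs hr
      hcop.symm hp.symm hq.symm ht.symm (hswap.ne hpq) (hswap.ne hpt) (hswap.ne hqt)
    simp only [Prod.fst_swap, Prod.snd_swap] at this
    tauto
  · exact hp.bounds_of_odd ha hb hbo hc hr hs hcop hq ht hpq hpt hqt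

theorem stmt_0 (a b c r s : ℤ)
    (ha : 1 < a) (hb : 1 < b) (hc : 0 < c) (hr : 0 < r) (hs : 0 < s)
    (hgcd : Int.gcd (r * a) (s * b) = 1)
    (h3 : ∃ p₁ p₂ p₃ : ℕ × ℕ, p₁ ≠ p₂ ∧ p₁ ≠ p₃ ∧ p₂ ≠ p₃ ∧
      IsSol a b c r s p₁.1 p₁.2 ∧ IsSol a b c r s p₂.1 p₂.2 ∧
      IsSol a b c r s p₃.1 p₃.2) :
    a < 8 * 10 ^ 14 ∧ b < 8 * 10 ^ 14 ∧ r < 8 * 10 ^ 14 ∧ s < 8 * 10 ^ 14 ∧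
      ∀ x y : ℕ, IsSol a b c r s x y → x < 8 * 10 ^ 14 ∧ y < 8 * 10 ^ 14 := by
  obtain ⟨p, q, t, hpq, hpt, hqt, hp, hq, ht⟩ := h3
  have hcop : IsCoprime (r * a) (s * b) := Int.isCoprime_iff_gcd_eq_one.2 hgcd
  have key : ∀ {u v w : ℕ × ℕ}, IsSol a b c r s u.1 u.2 → IsSol a b c r s v.1 v.2 →
      IsSol a b c r s w.1 w.2 → u ≠ v → u ≠ w → v ≠ w → _ := fun hu hv hw =>
    hu.bounds_of_three ha hb hc hr hs hcop hv hw
  have h := key hp hq ht hpq hpt hqt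
  refine ⟨by omega, by omega, by omega, by omega, fun x y hxy => ?_⟩
  have h' : x < 2 ^ 48 ∧ y < 2 ^ 48 := by
    by_cases h1 : (x, y) = p
    · subst h1
      exact h.2.2.2.2
    by_cases h2 : (x, y) = q
    · subst h2
      exact (key hq hp ht hpq.symm hqt hpt).2.2.2.2
    · exact (key (u := (x, y)) hxy hp hq h1 h2 hpq).2.2.2.2
  omega
end

section
/- Let a>1, b>1, r>0, m>0 be integers. Suppose there exist a positive integer y and a sign ε ∈ {1,-1} such that r·a^m divides b^y + ε and (b^y + ε)/(r·a^m) is coprime to a, and let n be the least such positive integer y (over both choices of sign). Define g = 1 and h = 0, unless r is odd, a ≡ 2 (mod 4), and m = 1, in which case g is the largest integer such that 2^g divides b−1 or 2^g divides b+1 (whichever is larger), and h is the largest integer such that 2^h divides n. Then for any integers M > m, N ≥ 1, L, and any sign δ ∈ {1,-1} with b^N + δ = r·a^M·L, one has n·a^(M−m) divides 2^(g+h−1)·N. -/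
theorem Int.emultiplicity_pow_sub_one {p : ℕ} (hp : p.Prime) {x : ℤ} (hx : (p : ℤ) ∣ x - 1)
    (h4 : p = 2 → 4 ∣ x - 1) (t : ℕ) :
    emultiplicity (p : ℤ) (x ^ t - 1) = emultiplicity (p : ℤ) (x - 1) + emultiplicity p t := by
  have hpx : ¬(p : ℤ) ∣ x := fun h ↦ by
    have h1 : (p : ℤ) ∣ 1 := by simpa using dvd_sub h hx
    exact (Nat.prime_iff_prime_int.mp hp).not_isUnit (isUnit_of_dvd_one h1)
  rcases hp.eq_two_or_odd' with rfl | hodd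
  · have := Int.two_pow_sub_pow' t (h4 rfl) hpx
    rw [one_pow] at this
    simpa [← Int.natCast_emultiplicity] using this
  · simpa using Int.emultiplicity_pow_sub_pow hp hodd hx hpx t

/-- If the powers `b ^ y` and `b ^ k` are both `±1` modulo `A`, and `k` is the least such positive
exponent, then `k` divides `y`. -/
theorem dvd_of_dvd_pow_add_sign {A b ε δ : ℤ} {k y : ℕ} (hε : ε = 1 ∨ ε = -1)
    (hδ : δ = 1 ∨ δ = -1) (hk : 0 < k) (hkA : A ∣ b ^ k + ε)
    (hmin : ∀ s, 0 < s → (A ∣ b ^ s + 1 ∨ A ∣ b ^ s - 1) → k ≤ s) (hy : A ∣ b ^ y + δ) :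
    k ∣ y := by
  rw [Nat.dvd_iff_mod_eq_zero]
  by_contra hs
  have hs' := hmin (y % k) (Nat.pos_of_ne_zero hs)
  have hlt := Nat.mod_lt y hk
  refine absurd (hs' ?_) (by omega)
  have hε2 : ε ^ 2 = 1 := by rcases hε with rfl | rfl <;> norm_num
  have hB : A ∣ (-ε * b ^ k) ^ (y / k) - 1 := by
    refine dvd_trans ?_ (sub_one_dvd_pow_sub_one _ _)
    have : -ε * b ^ k - 1 = -ε * (b ^ k + ε) := by linear_combination hε2
    rw [this]
    exact hkA.mul_left _
  have hpow : b ^ y = (b ^ k) ^ (y / k) * b ^ (y % k) := by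
    rw [← pow_mul, ← pow_add, Nat.div_add_mod]
  have hsgn : (-ε) ^ (y / k) = 1 ∨ (-ε) ^ (y / k) = -1 := by
    rcases hε with rfl | rfl
    · exact neg_one_pow_eq_or ℤ _
    · simp
  rw [mul_pow] at hB
  have key : A ∣ b ^ (y % k) + (-ε) ^ (y / k) * δ := by
    have h1 := (hy.mul_left ((-ε) ^ (y / k))).sub (hB.mul_right (b ^ (y % k)))
    rw [hpow] at h1
    convert! h1 using 1
    ring
  rcases hsgn with h | h <;> rcases hδ with rfl | rfl <;> rw [h] at key <;>
    norm_num [← sub_eq_add_neg] at key <;> tauto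

theorem two_pow_dvd_two_pow_mul_of_dvd_pow_add_sign {b δ : ℤ} {g s N : ℕ} (hb : Odd b)
    (hg : ∀ g' : ℕ, ((2 : ℤ) ^ g' ∣ b - 1 ∨ (2 : ℤ) ^ g' ∣ b + 1) → g' ≤ g)
    (hδ : δ = 1 ∨ δ = -1) (hs : (2 : ℤ) ^ s ∣ b ^ N + δ) : 2 ^ s ∣ 2 ^ g * N := by
  obtain ⟨x, hx4, hxg, hxs⟩ : ∃ x : ℤ, 4 ∣ x - 1 ∧ ¬(2 : ℤ) ^ (g + 1) ∣ x - 1 ∧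
      ((2 : ℤ) ^ s ∣ x ^ N - 1 ∨ (2 : ℤ) ^ s ∣ x ^ N + 1) := by
    have h1 : ¬(2 : ℤ) ^ (g + 1) ∣ b - 1 := fun h ↦ absurd (hg _ (.inl h)) (by omega)
    have h2 : ¬(2 : ℤ) ^ (g + 1) ∣ b + 1 := fun h ↦ absurd (hg _ (.inr h)) (by omega)
    have hb4 : 4 ∣ b - 1 ∨ 4 ∣ -b - 1 := by obtain ⟨c, rfl⟩ := hb; omega
    rcases hb4 with h | h
    · refine ⟨b, h, h1, ?_⟩
      rcases hδ with rfl | rfl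
      · exact .inr hs
      · exact .inl hs
    · refine ⟨-b, h, fun h' ↦ h2 ?_, ?_⟩
      · rw [← dvd_neg]
        convert! h' using 1
        ring
      · rcases Nat.even_or_odd N with hN | hN
        · rw [hN.neg_pow]
          rcases hδ with rfl | rfl
          · exact .inr hs
          · exact .inl hs
        · rw [hN.neg_pow]
          rw [← dvd_neg] at hs
          rcases hδ with rfl | rfl
          · exact .inl (by convert! hs using 1; ring)
          · exact .inr (by convert! hs using 1; ring)
  rcases hxs with hxs | hxs
  · have h2 := Int.emultiplicity_pow_sub_one Nat.prime_two (dvd_trans (by norm_num) hx4)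
      (fun _ ↦ hx4) N
    have hle : emultiplicity ((2 : ℕ) : ℤ) (x - 1) ≤ g := by
      have := emultiplicity_lt_iff_not_dvd.mpr hxg
      push_cast at this ⊢
      exact Order.le_of_lt_add_one this
    have h3 := le_emultiplicity_of_pow_dvd hxs
    apply pow_dvd_of_le_emultiplicity
    rw [emultiplicity_mul Nat.prime_two.prime, emultiplicity_pow_self_of_prime Nat.prime_two.prime]
    push_cast at h2 hle
    rw [h2] at h3
    exact h3.trans (by gcongr)
  · have hs1 : s ≤ 1 := by
      by_contra hcon
      have h4 : (4 : ℤ) ∣ x ^ N + 1 :=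
        dvd_trans (by simpa using pow_dvd_pow (2 : ℤ) (show 2 ≤ s by omega)) hxs
      have := hx4.trans (sub_one_dvd_pow_sub_one x N)
      omega
    have hg1 : 1 ≤ g := hg 1 (.inl (by obtain ⟨c, rfl⟩ := hb; simp))
    exact (pow_dvd_pow 2 (hs1.trans hg1)).mul_right _

theorem neg_sign_mul_pow_pow_sub_one {A b ε δ : ℤ} {k t : ℕ} (hA : 2 < A)
    (hε : ε = 1 ∨ ε = -1) (hδ : δ = 1 ∨ δ = -1) (hk : A ∣ b ^ k + ε)
    (hkt : A ∣ b ^ (k * t) + δ) : (-ε * b ^ k) ^ t - 1 = -δ * (b ^ (k * t) + δ) := by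
  have hB : A ∣ (-ε * b ^ k) ^ t - 1 := by
    refine dvd_trans ?_ (sub_one_dvd_pow_sub_one _ _)
    have : -ε * b ^ k - 1 = -ε * (b ^ k + ε) := by
      rcases hε with rfl | rfl <;> ring
    rw [this]
    exact hk.mul_left _
  have hsgn : (-ε) ^ t = 1 ∨ (-ε) ^ t = -1 := by
    rcases hε with rfl | rfl
    · exact neg_one_pow_eq_or ℤ _
    · simp
  rw [mul_pow, ← pow_mul] at hB ⊢
  have hnot : ¬A ∣ 2 := fun h ↦ by have := Int.le_of_dvd two_pos h; omega
  rcases hsgn with h | h <;> rcases hδ with rfl | rfl <;> rw [h] at hB ⊢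
  · refine absurd ?_ hnot
    convert! hkt.sub hB using 1
    ring
  · ring
  · ring
  · refine absurd ?_ hnot
    rw [← dvd_neg]
    convert! hkt.add hB using 1
    ring

theorem pow_dvd_of_mul_pow_dvd_pow_sub_one {p : ℕ} (hp : p.Prime) {A K x : ℤ} {j t : ℕ}
    (hA : A ≠ 0) (hpA : (p : ℤ) ∣ A) (h4 : p = 2 → 4 ∣ A) (hK : ¬(p : ℤ) ∣ K)
    (hx : x - 1 = A * K) (h : A * (p : ℤ) ^ j ∣ x ^ t - 1) : p ^ j ∣ t := by
  have hpZ := Nat.prime_iff_prime_int.mp hp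
  have hlte := Int.emultiplicity_pow_sub_one hp (hx ▸ hpA.mul_right K)
    (fun h2 ↦ hx ▸ (h4 h2).mul_right K) t
  have hle := emultiplicity_le_emultiplicity_of_dvd_right (a := (p : ℤ)) h
  rw [hlte, hx, emultiplicity_mul hpZ, emultiplicity_mul hpZ, emultiplicity_eq_zero.mpr hK,
    add_zero, emultiplicity_pow_self_of_prime hpZ] at hle
  have hfin : emultiplicity (p : ℤ) A ≠ ⊤ := by
    rw [← finiteMultiplicity_iff_emultiplicity_ne_top, Int.finiteMultiplicity_iff]
    exact ⟨by simpa using hp.ne_one, hA⟩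
  exact pow_dvd_of_le_emultiplicity ((ENat.add_le_add_iff_left hfin).mp hle)

/-- For `A > 2`, the least `y` such that `A` divides `b ^ y ± 1` with cofactor coprime to `a`
divides every `N` such that `A` divides `b ^ N ± 1`. -/
theorem dvd_of_isLeast_coprime_cofactor {A a b ε δ : ℤ} {n N : ℕ} (hA : 2 < A) (hn : 0 < n)
    (hε : ε = 1 ∨ ε = -1) (hδ : δ = 1 ∨ δ = -1) {K : ℤ} (hK : b ^ n + ε = A * K)
    (hKa : IsCoprime K a)
    (hmin : ∀ y : ℕ, 0 < y → ∀ σ K' : ℤ, (σ = 1 ∨ σ = -1) → b ^ y + σ = A * K' →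
      IsCoprime K' a → n ≤ y)
    (hN : A ∣ b ^ N + δ) : n ∣ N := by
  have hnA : A ∣ b ^ n + ε := ⟨K, hK⟩
  have hex : ∃ k, 0 < k ∧ ∃ σ : ℤ, (σ = 1 ∨ σ = -1) ∧ A ∣ b ^ k + σ := ⟨n, hn, ε, hε, hnA⟩
  classical
  obtain ⟨hk0, σ, hσ, K', hK'⟩ := Nat.find_spec hex
  set k := Nat.find hex
  have hkmin : ∀ s, 0 < s → (A ∣ b ^ s + 1 ∨ A ∣ b ^ s - 1) → k ≤ s := by
    rintro s hs (h | h)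
    · exact Nat.find_min' hex ⟨hs, 1, .inl rfl, h⟩
    · exact Nat.find_min' hex ⟨hs, -1, .inr rfl, h⟩
  have hkA : A ∣ b ^ k + σ := ⟨K', hK'⟩
  obtain ⟨u, hu⟩ := dvd_of_dvd_pow_add_sign hσ hε hk0 hkA hkmin hnA
  have hsub := neg_sign_mul_pow_pow_sub_one hA hσ hε hkA (hu ▸ hnA)
  have hdvd : A * K' ∣ A * K := by
    have h1 : A * K' ∣ (-σ * b ^ k) ^ u - 1 := by
      refine dvd_trans ⟨-σ, ?_⟩ (sub_one_dvd_pow_sub_one _ _)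
      rw [← hK']
      rcases hσ with h | h <;> rw [h] <;> ring
    rw [hsub, ← hu, hK] at h1
    rcases hε with rfl | rfl <;> simpa using h1
  have hKK : K' ∣ K := (mul_dvd_mul_iff_left (by omega)).mp hdvd
  have hnk : n = k := le_antisymm (hmin k hk0 σ K' hσ hK' (hKa.of_isCoprime_of_dvd_left hKK))
    (Nat.le_of_dvd hn ⟨u, hu⟩)
  rw [hnk]
  exact dvd_of_dvd_pow_add_sign hσ hδ hk0 hkA hkmin hN


theorem stmt_2 (a b r : ℤ) (m : ℕ)
    (ha : 1 < a) (hb : 1 < b) (hr : 0 < r) (hm : 0 < m)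
    -- the property defining `n`
    (P : ℕ → Prop)
    (hP : ∀ y : ℕ, P y ↔ 0 < y ∧ ∃ ε : ℤ, (ε = 1 ∨ ε = -1) ∧
      (r * a ^ m ∣ b ^ y + ε) ∧ Int.gcd ((b ^ y + ε) / (r * a ^ m)) a = 1)
    (n : ℕ) (hn : P n) (hnleast : ∀ y : ℕ, P y → n ≤ y)
    (g h : ℕ)
    -- in the exceptional case, `g` is the largest integer with `2^g ∣ b - 1` or
    -- `2^g ∣ b + 1`, and `h` is the largest integer with `2^h ∣ n`
    (hgh : (Odd r ∧ a % 4 = 2 ∧ m = 1) →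
      (((2 : ℤ) ^ g ∣ b - 1 ∨ (2 : ℤ) ^ g ∣ b + 1) ∧
        (∀ g' : ℕ, ((2 : ℤ) ^ g' ∣ b - 1 ∨ (2 : ℤ) ^ g' ∣ b + 1) → g' ≤ g)) ∧
      (2 ^ h ∣ n ∧ ∀ h' : ℕ, 2 ^ h' ∣ n → h' ≤ h))
    -- otherwise `g = 1` and `h = 0`
    (hgh' : ¬(Odd r ∧ a % 4 = 2 ∧ m = 1) → g = 1 ∧ h = 0) :
    ∀ (M N : ℕ) (L δ : ℤ), m < M → 1 ≤ N → (δ = 1 ∨ δ = -1) →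
      b ^ N + δ = r * a ^ M * L →
      (n : ℤ) * a ^ (M - m) ∣ 2 ^ (g + h - 1) * (N : ℤ) := by
  intro M N L δ hM hN hδ hL
  have ha0 : a ≠ 0 := by omega
  set A := r * a ^ m with hAdef
  have haA : a ∣ A := (dvd_pow_self a hm.ne').mul_left r
  have hApos : 0 < A := by positivity
  have hP' : ∀ y : ℕ, P y ↔ 0 < y ∧ ∃ σ K : ℤ, (σ = 1 ∨ σ = -1) ∧ b ^ y + σ = A * K ∧
      IsCoprime K a := by
    intro y
    rw [hP]
    refine and_congr_right fun _ ↦ exists_congr fun σ ↦ ?_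
    constructor
    · rintro ⟨hσ, ⟨K, hK⟩, hgcd⟩
      rw [hK, Int.mul_ediv_cancel_left _ hApos.ne'] at hgcd
      exact ⟨K, hσ, hK, Int.isCoprime_iff_gcd_eq_one.mpr hgcd⟩
    · rintro ⟨K, hσ, hK, hcop⟩
      refine ⟨hσ, ⟨K, hK⟩, ?_⟩
      rw [hK, Int.mul_ediv_cancel_left _ hApos.ne']
      exact Int.isCoprime_iff_gcd_eq_one.mp hcop
  obtain ⟨hn0, ε, K, hε, hK, hKa⟩ := (hP' n).mp hn
  have hAM : r * a ^ M = A * a ^ (M - m) := by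
    rw [hAdef, mul_assoc, ← pow_add, Nat.add_sub_cancel' hM.le]
  have hANdvd : A * a ^ (M - m) ∣ b ^ N + δ := ⟨L, by rw [hL, hAM]⟩
  have hAN : A ∣ b ^ N + δ := dvd_trans (dvd_mul_right _ _) hANdvd
  have hb_odd (h : 2 ∣ a) : Odd b := by
    have h2 : Even (b ^ n + ε) := even_iff_two_dvd.mpr (hK ▸ (h.trans haA).mul_right K)
    rw [Int.even_add] at h2
    have hbn : ¬Even (b ^ n) := by rcases hε with rfl | rfl <;> simpa using h2
    rw [Int.even_pow] at hbn
    rw [← Int.not_even_iff_odd]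
    exact fun h ↦ hbn ⟨h, hn0.ne'⟩
  obtain ⟨t, rfl⟩ : n ∣ N := by
    rcases lt_or_ge 2 A with hA | hA
    · exact dvd_of_isLeast_coprime_cofactor hA hn0 hε hδ hK hKa
        (fun y hy σ K' hσ h1 h2 ↦ hnleast y ((hP' y).mpr ⟨hy, σ, K', hσ, h1, h2⟩)) hAN
    · have ha2 : a = 2 := by have := Int.le_of_dvd hApos haA; omega
      have hA2 : A = 2 := by have := Int.le_of_dvd hApos haA; omega
      suffices P 1 by
        have := hnleast 1 this
        exact (show n = 1 by omega) ▸ one_dvd N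
      have hb1 := hb_odd (by simp [ha2])
      rw [hP', ha2, hA2]
      obtain ⟨c, rfl⟩ := hb1
      rcases Int.even_or_odd' c with ⟨d, rfl | rfl⟩
      · exact ⟨one_pos, 1, 2 * d + 1, .inl rfl, by ring, 1, -d, by ring⟩
      · exact ⟨one_pos, -1, 2 * d + 1, .inr rfl, by ring, 1, -d, by ring⟩
  suffices h : a ^ (M - m) ∣ 2 ^ (g + h - 1) * (t : ℤ) by
    have := mul_dvd_mul_left (n : ℤ) h
    push_cast
    convert! this using 1
    ring
  lift a to ℕ using by omega
  norm_cast
  rw [Nat.dvd_iff_prime_pow_dvd_dvd]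
  intro p j hp hj
  rcases Nat.eq_zero_or_pos j with rfl | hj0
  · simp
  have hpa : p ∣ a := hp.dvd_of_dvd_pow ((dvd_pow_self p hj0.ne').trans hj)
  have hpaZ : (p : ℤ) ∣ a := by exact_mod_cast hpa
  have hjZ : (p : ℤ) ^ j ∣ (a : ℤ) ^ (M - m) := by exact_mod_cast hj
  by_cases h4 : p = 2 → 4 ∣ A
  · have hA : 2 < A := by
      by_cases h2 : p = 2
      · have := Int.le_of_dvd hApos (h4 h2); omega
      · have := Int.le_of_dvd hApos (hpaZ.trans haA)
        have := hp.two_le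
        omega
    refine dvd_mul_of_dvd_right ?_ _
    have hKp : ¬(p : ℤ) ∣ K := fun h ↦
      (Nat.prime_iff_prime_int.mp hp).not_isUnit (hKa.isUnit_of_dvd' h hpaZ)
    have hpZ := Nat.prime_iff_prime_int.mp hp
    refine pow_dvd_of_mul_pow_dvd_pow_sub_one hp (K := -ε * K) (x := -ε * b ^ n) hApos.ne'
      (hpaZ.trans haA) h4 ?_ ?_ ?_
    · rcases hε with rfl | rfl <;> simpa using hKp
    · rw [mul_left_comm, ← hK]
      rcases hε with rfl | rfl <;> ring
    · rw [neg_sign_mul_pow_pow_sub_one hA hε hδ ⟨K, hK⟩ hAN]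
      exact ((mul_dvd_mul_left A hjZ).trans hANdvd).mul_left _
  · push Not at h4
    obtain ⟨rfl, h4⟩ := h4
    have h2a : (2 : ℤ) ∣ a := by exact_mod_cast hpa
    obtain ⟨c, hc⟩ := h2a
    have hm1 : m = 1 := by
      by_contra hm1
      refine h4 (Dvd.dvd.mul_left (dvd_trans ⟨c ^ 2, ?_⟩ (pow_dvd_pow _ (show 2 ≤ m by omega))) r)
      rw [hc]; ring
    subst hm1
    have hr_odd : Odd r := by
      rw [← Int.not_even_iff_odd]
      rintro ⟨d, rfl⟩
      exact h4 ⟨d * c, by rw [hAdef, hc]; ring⟩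
    have ha4 : (a : ℤ) % 4 = 2 := by
      by_contra hne
      obtain ⟨d, hd⟩ : (4 : ℤ) ∣ a := by omega
      exact h4 ⟨r * d, by rw [hAdef, hd]; ring⟩
    obtain ⟨⟨-, hg⟩, hhn, hhmax⟩ := hgh ⟨hr_odd, ha4, rfl⟩
    have hbo := hb_odd ⟨c, hc⟩
    have hg1 : 1 ≤ g := hg 1 (.inl (by obtain ⟨d, rfl⟩ := hbo; simp))
    have hs : (2 : ℤ) ^ (j + 1) ∣ b ^ (n * t) + δ := by
      refine dvd_trans ?_ hANdvd
      rw [pow_succ']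
      exact mul_dvd_mul (dvd_trans ⟨c, hc⟩ haA) (by exact_mod_cast hjZ)
    have hmain := two_pow_dvd_two_pow_mul_of_dvd_pow_add_sign hbo hg hδ hs
    obtain ⟨w, hw⟩ := hhn
    have hw2 : ¬2 ∣ w := by
      rintro ⟨v, rfl⟩
      have := hhmax (h + 1) ⟨v, by rw [hw]; ring⟩
      omega
    obtain ⟨q, hq⟩ : ∃ q, g + h - 1 = q := ⟨_, rfl⟩
    have hq' : g + h = q + 1 := by omega
    rw [hq]
    have hcop : Nat.Coprime (2 ^ j) w :=
      ((Nat.prime_two.coprime_iff_not_dvd).mpr hw2).pow_left j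
    refine hcop.dvd_of_dvd_mul_left (m := w) ?_
    have he : 2 ^ g * (n * t) = 2 * (w * (2 ^ q * t)) := by
      calc 2 ^ g * (n * t) = 2 ^ (g + h) * (w * t) := by rw [hw]; ring
        _ = _ := by rw [hq']; ring
    rw [he, pow_succ'] at hmain
    exact Nat.dvd_of_mul_dvd_mul_left two_pos hmain
end

section
/- Let a>1, b>1, c>0, r>0, s>0 be integers with gcd(ra, sb)=1. Suppose the equation (-1)^u·r·a^x + (-1)^v·s·b^y = c has two distinct solutions (x₁,y₁) and (x₂,y₂), in positive integers x,y with u,v ∈ {0,1}, such that x₁ = x₂. Then the equation has no third solution with positive x,y, except when (a,b,c,r,s) = (3,2,1,1,1), (3,2,5,1,1), (5,2,3,1,1), or (3,2,7,1,1). -/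
/-- For odd `a`, the cofactor of `a - 1` in `a ^ (2 * m + 1) - 1` is odd. -/
theorem exists_odd_cofactor {a : ℤ} (ha : Odd a) (m : ℕ) :
    ∃ S, Odd S ∧ a ^ (2 * m + 1) - 1 = (a - 1) * S := by
  induction m with
  | zero => exact ⟨1, odd_one, by ring⟩
  | succ m ih =>
    obtain ⟨S, hS, h⟩ := ih
    refine ⟨a ^ 2 * S + (a + 1), (ha.pow.mul hS).add_even (ha.add_odd odd_one), ?_⟩
    linear_combination a ^ 2 * h

theorem two_pow_dvd_sub_one {a : ℤ} (ha : Odd a) {N m : ℕ}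
    (h : (2 : ℤ) ^ N ∣ a ^ (2 * m + 1) - 1) : (2 : ℤ) ^ N ∣ a - 1 := by
  obtain ⟨S, hS, hS'⟩ := exists_odd_cofactor ha m
  rw [hS'] at h
  refine IsCoprime.dvd_of_dvd_mul_right ?_ h
  exact (Int.isCoprime_iff_gcd_eq_one.2 (by
    rw [Int.gcd_comm]; exact Int.isCoprime_iff_gcd_eq_one.1 (Int.isCoprime_two_right.2 hS))).pow_left

theorem two_pow_dvd_add_one {a : ℤ} (ha : Odd a) {N m : ℕ}
    (h : (2 : ℤ) ^ N ∣ a ^ (2 * m + 1) + 1) : (2 : ℤ) ^ N ∣ a + 1 := by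
  have h' : (2 : ℤ) ^ N ∣ (-a) ^ (2 * m + 1) - 1 := by
    rw [Odd.neg_pow ⟨m, rfl⟩]
    have := (dvd_neg (α := ℤ)).2 h
    rwa [neg_add'] at this
  have := (dvd_neg (α := ℤ)).2 (two_pow_dvd_sub_one ha.neg h')
  simpa [add_comm] using this

/-- Separation of an odd power of a binomial into its odd and even parts. -/
theorem add_pow_odd {R : Type*} [CommRing R] (A B f g : R) (hA : A ^ 2 = f) (hB : B ^ 2 = g)
    (h : ℕ) :
    (A + B) ^ (2 * h + 1) =
      A * (∑ i ∈ Finset.range (h + 1), f ^ i * g ^ (h - i) * ((2 * h + 1).choose (2 * i + 1) : ℕ))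
      + B * (∑ i ∈ Finset.range (h + 1), f ^ i * g ^ (h - i) * ((2 * h + 1).choose (2 * i) : ℕ)) := by
  have split : ∀ (F : ℕ → R) (k : ℕ), ∑ i ∈ Finset.range (2 * k), F i =
      ∑ i ∈ Finset.range k, F (2 * i + 1) + ∑ i ∈ Finset.range k, F (2 * i) := by
    intro F k
    induction k with
    | zero => simp
    | succ k ih =>
      rw [show 2 * (k + 1) = 2 * k + 1 + 1 by ring, Finset.sum_range_succ, Finset.sum_range_succ, ih,
        Finset.sum_range_succ, Finset.sum_range_succ]
      ring
  rw [add_pow, show 2 * h + 1 + 1 = 2 * (h + 1) by ring, split, Finset.mul_sum, Finset.mul_sum]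
  congr 1
  · refine Finset.sum_congr rfl fun i hi => ?_
    have hi' : i ≤ h := by simpa [Nat.lt_succ_iff] using hi
    rw [show 2 * h + 1 - (2 * i + 1) = 2 * (h - i) by omega, pow_succ, pow_mul, pow_mul, hA, hB]
    ring
  · refine Finset.sum_congr rfl fun i hi => ?_
    have hi' : i ≤ h := by simpa [Nat.lt_succ_iff] using hi
    rw [show 2 * h + 1 - (2 * i) = 2 * (h - i) + 1 by omega, pow_succ, pow_mul, pow_mul, hA, hB]
    ring

theorem odd_part_prime (f g : ℤ) {h : ℕ} (hh : 2 ≤ h) (hp : (2 * h + 1).Prime) :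
    ∃ K L : ℤ, ∑ i ∈ Finset.range (h + 1),
      f ^ i * g ^ (h - i) * ((2 * h + 1).choose (2 * i + 1) : ℕ) =
      (2 * h + 1 : ℕ) * g ^ h + (2 * h + 1 : ℕ) * f * K + f ^ 2 * L := by
  obtain ⟨k, rfl⟩ : ∃ k, h = k + 2 := ⟨h - 2, by omega⟩
  have hdvd : ((2 * (k + 2) + 1 : ℕ) : ℤ) * f ∣ ∑ i ∈ Finset.range (k + 1),
      f ^ (i + 1) * g ^ (k + 2 - (i + 1)) * ((2 * (k + 2) + 1).choose (2 * (i + 1) + 1) : ℕ) := by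
    refine Finset.dvd_sum fun i hi => ?_
    have hi' : i < k + 1 := by simpa using hi
    obtain ⟨q, hq⟩ := hp.dvd_choose_self (k := 2 * (i + 1) + 1) (by omega) (by omega)
    rw [hq]
    refine ⟨f ^ i * g ^ (k + 2 - (i + 1)) * q, ?_⟩
    push_cast
    ring
  obtain ⟨K, hK⟩ := hdvd
  refine ⟨K, f ^ k, ?_⟩
  rw [Finset.sum_range_succ, Finset.sum_range_succ', hK]
  simp
  ring

/-- Two times an odd power of `(α + β) / 2` is an integral combination of `α` and `β`,
where `α² = 2ⁿ + e` and `β² = -(2ⁿ - e)`. -/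
theorem exists_coeffs {n : ℕ} {e : ℤ} (he : e = 1 ∨ e = -1) {α β : ℂ}
    (hα : α ^ 2 = (2 ^ (n + 3) + e : ℤ)) (hβ : β ^ 2 = -(2 ^ (n + 3) - e : ℤ)) (l : ℕ) :
    ∃ U V : ℤ, Odd U ∧ 4 ∣ U - V ∧ 2 * ((α + β) / 2) ^ (2 * l + 1) = α * U + β * V := by
  induction l with
  | zero => exact ⟨1, 1, odd_one, by simp, by simp; ring⟩
  | succ l ih =>
    obtain ⟨U, V, ⟨k, rfl⟩, ⟨m, hm⟩, h⟩ := ih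
    obtain rfl : V = 2 * k + 1 - 4 * m := by linarith
    refine ⟨e * (2 * k + 1 - 2 * m) - 2 ^ (n + 2) * (2 * k + 1 - 4 * m),
      e * (2 * k + 1 - 2 * m) + 2 ^ (n + 2) * (2 * k + 1), ?_, ?_, ?_⟩
    · rcases he with rfl | rfl
      · exact ⟨k - m - 2 ^ (n + 1) * (2 * k + 1 - 4 * m), by ring⟩
      · exact ⟨-k - 1 + m - 2 ^ (n + 1) * (2 * k + 1 - 4 * m), by ring⟩
    · exact ⟨-2 ^ (n + 1) * (2 * k + 1 - 2 * m), by ring⟩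
    · have h2 : ((α + β) / 2) ^ 2 = (e + α * β) / 2 := by
        push_cast at hα hβ
        linear_combination hα / 4 + hβ / 4
      rw [show 2 * (l + 1) + 1 = (2 * l + 1) + 2 by ring, pow_add, ← mul_assoc, h, h2]
      push_cast at hα hβ ⊢
      linear_combination (β * (2 * k + 1) / 2) * hα + (α * (2 * k + 1 - 4 * m) / 2) * hβ

theorem dvd_of_two_pow_dvd_mul_odd {N : ℕ} {x T : ℤ} (hT : Odd T) (h : (2 : ℤ) ^ N ∣ x * T) :
    (2 : ℤ) ^ N ∣ x :=
  ((Int.isCoprime_two_left.2 hT).pow_left).dvd_of_dvd_mul_right h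

/-- If the power of two is small, then `X = Y = ±1`. -/
theorem eq_of_small_exponent {n w : ℕ} {e X Y : ℤ} (he : e = 1 ∨ e = -1) (hX : Odd X)
    (hXY : 4 ∣ X - Y) (hw : w ≤ 2 * (n + 3))
    (h : (2 ^ (n + 3) + e) * X ^ 2 + (2 ^ (n + 3) - e) * Y ^ 2 = 2 ^ w) :
    X = Y ∧ (X = 1 ∨ X = -1) := by
  obtain ⟨k, rfl⟩ := hX
  obtain ⟨m, hm⟩ := hXY
  obtain rfl : Y = 2 * k + 1 - 4 * m := by linarith
  set X : ℤ := 2 * k + 1 with hXdef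
  set Y : ℤ := X - 4 * m with hYdef
  have hP : (8 : ℤ) ≤ 2 ^ (n + 3) := by
    calc (8 : ℤ) = 2 ^ 3 := by norm_num
      _ ≤ 2 ^ (n + 3) := pow_le_pow_right₀ (by norm_num) (by omega)
  have hX1 : 1 ≤ X ^ 2 := by
    have := sq_pos_of_ne_zero (show X ≠ 0 by omega)
    omega
  have hY1 : 1 ≤ Y ^ 2 := by
    have := sq_pos_of_ne_zero (show Y ≠ 0 by omega)
    omega
  have hw' : n + 4 ≤ w := by
    by_contra hlt
    have h1 : (2 : ℤ) ^ w ≤ 2 ^ (n + 3) := pow_le_pow_right₀ (by norm_num) (by omega)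
    rcases he with rfl | rfl <;> nlinarith
  have hdvd : (2 : ℤ) ^ (n + 3) ∣ X - Y := by
    have hT : Odd (2 * k + 1 - 2 * m) := ⟨k - m, by ring⟩
    obtain ⟨v, rfl⟩ := Nat.exists_eq_add_of_le hw'
    refine dvd_of_two_pow_dvd_mul_odd hT ⟨e * (2 ^ v - (X ^ 2 - 4 * X * m + 8 * m ^ 2)), ?_⟩
    have hee : e ^ 2 = 1 := by rcases he with rfl | rfl <;> norm_num
    have : (2 : ℤ) ^ (n + 4 + v) = 2 * 2 ^ (n + 3) * 2 ^ v := by ring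
    rw [this] at h
    refine mul_left_cancel₀ (two_ne_zero (α := ℤ)) ?_
    linear_combination e * h - ((X - Y) * (X + Y)) * hee
  by_cases hEq : X = Y
  · refine ⟨hEq, ?_⟩
    rw [← hEq] at h
    have hd : X ∣ 2 ^ w := ⟨2 ^ (n + 4) * X, by rw [← h]; ring⟩
    have hu : IsUnit X :=
      ((Int.isCoprime_two_right.2 (⟨k, rfl⟩ : Odd X)).pow_right).isUnit_of_dvd' dvd_rfl hd
    exact Int.isUnit_iff.1 hu
  · exfalso
    have h1 : (2 : ℤ) ^ (n + 3) ≤ |X - Y| :=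
      Int.le_of_dvd (abs_pos.2 (sub_ne_zero.2 hEq)) ((dvd_abs _ _).2 hdvd)
    have h2 : ((2 : ℤ) ^ (n + 3)) ^ 2 ≤ (X - Y) ^ 2 := by
      rw [← sq_abs (X - Y)]; gcongr
    have h3 : (2 : ℤ) ^ w ≤ (2 ^ (n + 3)) ^ 2 := by
      rw [← pow_mul, mul_comm]; exact pow_le_pow_right₀ (by norm_num) hw
    have h4 : (X - Y) ^ 2 ≤ 2 * (X ^ 2 + Y ^ 2) := by nlinarith [sq_nonneg (X + Y)]
    rcases he with rfl | rfl <;> nlinarith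

/-- One step of the descent: dividing by `((α + β) / 2) ^ 2`. -/
theorem descent_step {n v : ℕ} {e X Y : ℤ} (he : e = 1 ∨ e = -1) (hX : Odd X)
    (hXY : 4 ∣ X - Y)
    (h : (2 ^ (n + 3) + e) * X ^ 2 + (2 ^ (n + 3) - e) * Y ^ 2 = 2 ^ (2 * n + 7 + v)) :
    ∃ X' Y' : ℤ, Odd X' ∧ 4 ∣ X' - Y' ∧
      (2 ^ (n + 3) + e) * X' ^ 2 + (2 ^ (n + 3) - e) * Y' ^ 2 = 2 ^ (v + 3) ∧
      2 * X = e * X' - (2 ^ (n + 3) - e) * Y' ∧ 2 * Y = e * Y' + (2 ^ (n + 3) + e) * X' := by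
  have hee : e ^ 2 = 1 := by rcases he with rfl | rfl <;> norm_num
  have hodde : Odd e := by rcases he with rfl | rfl <;> decide
  have hD1 : Odd ((2 : ℤ) ^ (n + 3) + e) := by
    refine Even.add_odd ⟨2 ^ (n + 2), by ring⟩ hodde
  obtain ⟨k, rfl⟩ := hX
  obtain ⟨m, hm⟩ := hXY
  obtain rfl : Y = 2 * k + 1 - 4 * m := by linarith
  have hYodd : Odd (2 * k + 1 - 4 * m) := ⟨k - 2 * m, by ring⟩
  have hT : Odd (2 ^ (n + 2) * (2 * k + 1) + e * (2 * k + 1 - 2 * m)) :=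
    Even.add_odd ⟨2 ^ (n + 1) * (2 * k + 1), by ring⟩ (hodde.mul ⟨k - m, by ring⟩)
  have key : (2 ^ (n + 1) * (2 * k + 1) + e * m) *
      (2 ^ (n + 2) * (2 * k + 1) + e * (2 * k + 1 - 2 * m)) =
      2 ^ (2 * n + 3) * ((2 ^ (n + 3) + e) * 2 ^ (v + 1) - (2 * k + 1 - 4 * m) ^ 2) := by
    refine mul_left_cancel₀ (show (8 : ℤ) ≠ 0 by norm_num) ?_
    linear_combination (2 ^ (n + 3) + e) * h
  obtain ⟨Z, hZ⟩ := dvd_of_two_pow_dvd_mul_odd hT ⟨_, key⟩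
  have hZT : Z * (2 ^ (n + 2) * (2 * k + 1) + e * (2 * k + 1 - 2 * m)) =
      (2 ^ (n + 3) + e) * 2 ^ (v + 1) - (2 * k + 1 - 4 * m) ^ 2 := by
    refine mul_left_cancel₀ (pow_ne_zero (2 * n + 3) (two_ne_zero (α := ℤ))) ?_
    rw [← key, hZ]; ring
  have hZodd : Odd Z := by
    have : Odd (Z * (2 ^ (n + 2) * (2 * k + 1) + e * (2 * k + 1 - 2 * m))) := by
      rw [hZT]
      exact Even.sub_odd ⟨(2 ^ (n + 3) + e) * 2 ^ v, by ring⟩ hYodd.pow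
    exact Int.Odd.of_mul_left this
  have key2 : (e * (2 * k + 1) + (2 ^ (n + 3) - e) * (2 * k + 1 - 4 * m)) * (2 ^ (n + 3) + e) =
      2 ^ (2 * n + 5) * (2 * (2 * k + 1 - 4 * m) + e * Z) := by
    linear_combination (4 * e) * hZ
  obtain ⟨X', hX'⟩ := dvd_of_two_pow_dvd_mul_odd hD1 ⟨_, key2⟩
  have hpos : (2 : ℤ) ^ (2 * n + 5) ≠ 0 := pow_ne_zero _ two_ne_zero
  have hX'D : X' * (2 ^ (n + 3) + e) = 2 * (2 * k + 1 - 4 * m) + e * Z := by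
    refine mul_left_cancel₀ hpos ?_
    rw [← key2, hX']; ring
  have hX'odd : Odd X' := by
    have : Odd (X' * (2 ^ (n + 3) + e)) := by
      rw [hX'D]
      exact (even_two_mul _).add_odd (hodde.mul hZodd)
    exact Int.Odd.of_mul_left this
  have e1 : 2 * (2 * k + 1) = e * X' - (2 ^ (n + 3) - e) * (-Z) := by
    refine mul_left_cancel₀ hpos ?_
    linear_combination e * hX' + (4 * (2 ^ (n + 3) - e)) * hZ
  refine ⟨X', -Z, hX'odd, ?_, ?_, e1, by linear_combination -hX'D⟩
  · obtain ⟨i, rfl⟩ := hX'odd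
    obtain ⟨j, rfl⟩ := hZodd
    have e2 : 2 * k + 1 = e * (i - j) + 2 ^ (n + 2) * (2 * j + 1) := by
      refine mul_left_cancel₀ (two_ne_zero (α := ℤ)) ?_
      rw [e1]; ring
    have : Odd (e * (i - j)) := by
      have : e * (i - j) = 2 * k + 1 - 2 ^ (n + 2) * (2 * j + 1) := by linarith
      rw [this]
      exact (odd_two_mul_add_one k).sub_even ⟨2 ^ (n + 1) * (2 * j + 1), by ring⟩
    obtain ⟨q, hq⟩ := Int.Odd.of_mul_right this
    exact ⟨q + j + 1, by linarith⟩
  · refine mul_left_cancel₀ (pow_ne_zero 2 hpos) ?_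
    have hN : (1 : ℤ) + (2 ^ (n + 3) + e) * (2 ^ (n + 3) - e) = 2 ^ (2 * n + 6) := by
      linear_combination -hee
    have h1 : (2 : ℤ) ^ (2 * n + 5) * Z = (2 ^ (n + 3) + e) * (2 * k + 1) - e * (2 * k + 1 - 4 * m) := by
      linear_combination -4 * hZ
    calc _ = (2 ^ (n + 3) + e) * (2 ^ (2 * n + 5) * X') ^ 2
          + (2 ^ (n + 3) - e) * (2 ^ (2 * n + 5) * Z) ^ 2 := by ring
      _ = ((2 ^ (n + 3) + e) * (2 * k + 1) ^ 2 + (2 ^ (n + 3) - e) * (2 * k + 1 - 4 * m) ^ 2) *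
          (e ^ 2 + (2 ^ (n + 3) + e) * (2 ^ (n + 3) - e)) := by rw [← hX', h1]; ring
      _ = _ := by rw [h, hee, hN]; ring

/-- All solutions of `(2ⁿ + e) X² + (2ⁿ - e) Y² = 2 ^ w` come from odd powers of `(α + β) / 2`. -/
theorem solution_structure {n : ℕ} {e : ℤ} (he : e = 1 ∨ e = -1) {α β : ℂ}
    (hα : α ^ 2 = (2 ^ (n + 3) + e : ℤ)) (hβ : β ^ 2 = -(2 ^ (n + 3) - e : ℤ)) (w : ℕ) :
    ∀ X Y : ℤ, Odd X → 4 ∣ X - Y →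
      (2 ^ (n + 3) + e) * X ^ 2 + (2 ^ (n + 3) - e) * Y ^ 2 = 2 ^ w →
      ∃ m : ℕ, ∃ σ : ℤ, (σ = 1 ∨ σ = -1) ∧
        α * X + β * Y = 2 * σ * ((α + β) / 2) ^ (2 * m + 1) ∧
        2 ^ (n + 3) + e ∣ 2 ^ m * X - σ * e ^ m * (2 * m + 1) ∧
        2 ^ (n + 3) + e ∣ 2 ^ m * Y - σ * e ^ m := by
  induction w using Nat.strong_induction_on with
  | _ w ih =>
  intro X Y hX hXY h
  rcases le_or_gt w (2 * (n + 3)) with hw | hw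
  · obtain ⟨rfl, hX1⟩ := eq_of_small_exponent he hX hXY hw h
    exact ⟨0, X, hX1, by push_cast; ring, by simp, by simp⟩
  · obtain ⟨v, rfl⟩ : ∃ v, w = 2 * n + 7 + v := ⟨w - (2 * n + 7), by omega⟩
    obtain ⟨X', Y', hX', hXY', h', e1, e2⟩ := descent_step he hX hXY h
    obtain ⟨m, σ, hσ, hm, ⟨c, hc⟩, ⟨d, hd⟩⟩ := ih (v + 3) (by omega) X' Y' hX' hXY' h'
    refine ⟨m + 1, σ, hσ, ?_, ?_, ?_⟩
    · have h2 : ((α + β) / 2) ^ 2 = (e + α * β) / 2 := by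
        push_cast at hα hβ
        linear_combination hα / 4 + hβ / 4
      rw [show 2 * (m + 1) + 1 = (2 * m + 1) + 2 by ring, pow_add, ← mul_assoc, ← hm, h2]
      have e1' : 2 * (X : ℂ) = e * X' - (2 ^ (n + 3) - e) * Y' := by exact_mod_cast e1
      have e2' : 2 * (Y : ℂ) = e * Y' + (2 ^ (n + 3) + e) * X' := by exact_mod_cast e2
      push_cast at hα hβ
      linear_combination (α / 2) * e1' + (β / 2) * e2' - (β * X' / 2) * hα - (α * Y' / 2) * hβ
    · refine ⟨e * c - 2 ^ m * Y' + 2 * e * d, ?_⟩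
      push_cast
      linear_combination 2 ^ m * e1 + e * hc + (2 * e) * hd
    · refine ⟨e * d + 2 ^ m * X', ?_⟩
      linear_combination 2 ^ m * e2 + e * hd

/-- If every prime factor of a divisor `F'` of the odd part of a `p`-th power divides `f`, then `F'`
is at most `p`. -/
theorem abs_le_of_odd_part {f g F' : ℤ} {h : ℕ} (hh : 2 ≤ h) (hp : (2 * h + 1).Prime)
    (hpf : ((2 * h + 1 : ℕ) : ℤ) ∣ f) (hfg : IsCoprime f g) (hF0 : F' ≠ 0)
    (hF : F' ∣ ∑ i ∈ Finset.range (h + 1),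
      f ^ i * g ^ (h - i) * ((2 * h + 1).choose (2 * i + 1) : ℕ))
    (hprime : ∀ q : ℕ, q.Prime → (q : ℤ) ∣ F' → (q : ℤ) ∣ f) :
    |F'| ≤ (2 * h + 1 : ℕ) := by
  obtain ⟨K, L, hKL⟩ := odd_part_prime f g hh hp
  rw [hKL] at hF
  set p := 2 * h + 1
  have hcop : ∀ q : ℕ, q.Prime → (q : ℤ) ∣ f → ¬ (q : ℤ) ∣ g ^ h := by
    intro q hq hqf hqg
    have hu := hfg.isUnit_of_dvd' hqf ((Nat.prime_iff_prime_int.1 hq).dvd_of_dvd_pow hqg)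
    exact (Nat.prime_iff_prime_int.1 hq).not_isUnit hu
  have hall : ∀ {d : ℕ}, d.Prime → d ∣ F'.natAbs → d = p := by
    intro q hq hqF
    have hqF' : (q : ℤ) ∣ F' := Int.natCast_dvd.2 hqF
    have hqf := hprime q hq hqF'
    have h1 := hqF'.trans hF
    have h2 : (q : ℤ) ∣ p * g ^ h := by
      have h3 : (q : ℤ) ∣ f * (p * K + f * L) := hqf.mul_right _
      have := dvd_sub h1 h3
      rwa [show (p : ℤ) * g ^ h + p * f * K + f ^ 2 * L - f * (p * K + f * L) = p * g ^ h by ring]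
        at this
    rcases (Nat.prime_iff_prime_int.1 hq).dvd_or_dvd h2 with h4 | h4
    · exact (Nat.prime_dvd_prime_iff_eq hq hp).1 (by exact_mod_cast h4)
    · exact absurd h4 (hcop q hq hqf)
  have hpow := Nat.eq_prime_pow_of_unique_prime_dvd (Int.natAbs_ne_zero.2 hF0) hall
  set i := F'.natAbs.primeFactorsList.length
  have hi : i ≤ 1 := by
    by_contra hi
    have h1 : ((p : ℤ)) ^ 2 ∣ F' := by
      rw [← Int.natCast_pow, Int.natCast_dvd, hpow]
      exact pow_dvd_pow _ (by omega)
    have h2 := h1.trans hF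
    obtain ⟨c, rfl⟩ := hpf
    have h3 : (p : ℤ) ^ 2 ∣ p * g ^ h := by
      have := dvd_sub h2 (Dvd.intro (c * K + c ^ 2 * L) rfl)
      rwa [show (p : ℤ) * g ^ h + p * (p * c) * K + (p * c) ^ 2 * L
        - p ^ 2 * (c * K + c ^ 2 * L) = p * g ^ h by ring] at this
    rw [sq] at h3
    exact hcop p hp (dvd_mul_right _ _)
      (Int.dvd_of_mul_dvd_mul_left (by exact_mod_cast hp.ne_zero) h3)
  rw [Int.abs_eq_natAbs, hpow]
  have : p ^ i ≤ p ^ 1 := Nat.pow_le_pow_right hp.pos hi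
  exact_mod_cast (by simpa using this)

theorem four_pow_gt {h : ℕ} (hh : h ≠ 0) : 2 * h + 1 < 4 ^ h := by
  induction h, Nat.one_le_iff_ne_zero.2 hh using Nat.le_induction with
  | base => norm_num
  | succ h hle ih => have := ih (by omega); rw [pow_succ]; omega

theorem size_contradiction {D₁ D₂ U F : ℤ} {h : ℕ} (h₁ : 7 ≤ D₁) (h₂ : 7 ≤ D₂)
    (h₁₂ : 16 ≤ D₁ + D₂) (hU : 1 ≤ U ^ 2) (hF : F ≠ 0) (habs : |F| ≤ (2 * h + 1 : ℕ)) (hh : h ≠ 0)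
    (hNeq : (D₁ * U ^ 2 + D₂) ^ (2 * h + 1) = 16 ^ h * (D₁ * (U ^ 2 * F ^ 2) + D₂)) : False := by
  have hN16 : 16 ≤ D₁ * U ^ 2 + D₂ := by
    have : D₁ * 1 ≤ D₁ * U ^ 2 := mul_le_mul_of_nonneg_left hU (by omega)
    omega
  have hF2 : F ^ 2 ≤ ((2 * h + 1 : ℕ) : ℤ) ^ 2 := sq_le_sq' (abs_le.1 habs).1 (abs_le.1 habs).2
  have hF1 : 1 ≤ F ^ 2 := by have := sq_pos_of_ne_zero hF; omega
  have hle : D₁ * (U ^ 2 * F ^ 2) + D₂ ≤ F ^ 2 * (D₁ * U ^ 2 + D₂) := by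
    have : 1 * D₂ ≤ F ^ 2 * D₂ := mul_le_mul_of_nonneg_right hF1 (by omega)
    linarith
  generalize D₁ * U ^ 2 + D₂ = N at *
  generalize D₁ * (U ^ 2 * F ^ 2) + D₂ = M at *
  have h1 : N ^ (2 * h) * N ≤ (16 ^ h * ((2 * h + 1 : ℕ) : ℤ) ^ 2) * N := by
    rw [← pow_succ, hNeq, mul_assoc]
    refine mul_le_mul_of_nonneg_left (hle.trans ?_) (by positivity)
    exact mul_le_mul_of_nonneg_right hF2 (by omega)
  have h2 := le_of_mul_le_mul_right h1 (by omega)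
  have h3 : (16 : ℤ) ^ (2 * h) ≤ N ^ (2 * h) := by gcongr
  have h4 : ((16 : ℤ) ^ h) ≤ ((2 * h + 1 : ℕ) : ℤ) ^ 2 := by
    refine le_of_mul_le_mul_left (a := (16 : ℤ) ^ h) ?_ (by positivity)
    rw [← pow_add, ← two_mul]
    exact h3.trans h2
  have h5 : ((4 : ℤ) ^ h) ^ 2 ≤ ((2 * h + 1 : ℕ) : ℤ) ^ 2 := by
    rw [← pow_mul, mul_comm, pow_mul]; exact h4
  have h6 := (sq_le_sq₀ (by positivity) (by positivity)).1 h5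
  have h7 : 4 ^ h ≤ 2 * h + 1 := by exact_mod_cast h6
  exact absurd h7 (four_pow_gt hh).not_ge

/-- `(2ⁿ + e) X² + (2ⁿ - e)` is not a power of two if `X > 1` is a power of a divisor of
`2ⁿ + e`. -/
theorem ne_two_pow {n w j : ℕ} {e a : ℤ} (he : e = 1 ∨ e = -1) (ha : 1 < a) (hj : 1 ≤ j)
    (hdvd : a ∣ 2 ^ (n + 3) + e) :
    (2 ^ (n + 3) + e) * (a ^ j) ^ 2 + (2 ^ (n + 3) - e) ≠ 2 ^ w := by
  intro hw
  have hP : (8 : ℤ) ≤ 2 ^ (n + 3) := by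
    calc (8 : ℤ) = 2 ^ 3 := by norm_num
      _ ≤ 2 ^ (n + 3) := pow_le_pow_right₀ (by norm_num) (by omega)
  have hodde : Odd e := by rcases he with rfl | rfl <;> decide
  have hPe : Even ((2 : ℤ) ^ (n + 3)) := ⟨2 ^ (n + 2), by ring⟩
  have haodd : Odd a := by
    obtain ⟨c, hc⟩ := hdvd
    exact Int.Odd.of_mul_left (hc ▸ hPe.add_odd hodde)
  set D₁ : ℤ := 2 ^ (n + 3) + e with hD₁
  set D₂ : ℤ := 2 ^ (n + 3) - e with hD₂
  have hD₁7 : 7 ≤ D₁ := by rcases he with rfl | rfl <;> omega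
  have hD₂7 : 7 ≤ D₂ := by rcases he with rfl | rfl <;> omega
  have hcopD : IsCoprime D₁ D₂ := by
    have h1 : IsCoprime D₁ 2 := Int.isCoprime_two_right.2 (hPe.add_odd hodde)
    have h2 : IsCoprime D₁ (-(2 * e)) := by
      rcases he with rfl | rfl
      · exact h1.neg_right
      · exact h1
    have := (IsCoprime.add_mul_left_right_iff (z := 1)).2 h2
    rwa [show -(2 * e) + D₁ * 1 = D₂ by rw [hD₁, hD₂]; ring] at this
  set X : ℤ := a ^ j with hXdef
  have hXodd : Odd X := haodd.pow
  obtain ⟨Y, hY, hXY⟩ : ∃ Y : ℤ, (Y = 1 ∨ Y = -1) ∧ 4 ∣ X - Y := by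
    obtain ⟨k, hk⟩ := hXodd
    rcases Int.emod_two_eq_zero_or_one k with hk2 | hk2
    · exact ⟨1, Or.inl rfl, by omega⟩
    · exact ⟨-1, Or.inr rfl, by omega⟩
  have hY2 : Y ^ 2 = 1 := by rcases hY with rfl | rfl <;> norm_num
  have hR₁ : (0 : ℝ) < D₁ := by exact_mod_cast (by omega : 0 < D₁)
  have hR₂ : (0 : ℝ) < D₂ := by exact_mod_cast (by omega : 0 < D₂)
  obtain ⟨x, hx0, hx⟩ : ∃ x : ℝ, 0 < x ∧ x ^ 2 = D₁ :=
    ⟨√D₁, Real.sqrt_pos.2 hR₁, Real.sq_sqrt hR₁.le⟩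
  obtain ⟨y, hy0, hy⟩ : ∃ y : ℝ, 0 < y ∧ y ^ 2 = D₂ :=
    ⟨√D₂, Real.sqrt_pos.2 hR₂, Real.sq_sqrt hR₂.le⟩
  obtain ⟨α, hαx⟩ : ∃ α : ℂ, α = x := ⟨_, rfl⟩
  obtain ⟨β, hβy⟩ : ∃ β : ℂ, β = y * Complex.I := ⟨_, rfl⟩
  have hα : α ^ 2 = (D₁ : ℤ) := by rw [hαx]; exact_mod_cast hx
  have hβ : β ^ 2 = -(D₂ : ℤ) := by
    rw [hβy, mul_pow, Complex.I_sq]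
    have : (y : ℂ) ^ 2 = (D₂ : ℤ) := by exact_mod_cast hy
    rw [this]; ring
  have hinj : ∀ A B A' B' : ℤ, α * A + β * B = α * A' + β * B' → A = A' ∧ B = B' := by
    intro A B A' B' hAB
    rw [hαx, hβy] at hAB
    have hre := congrArg Complex.re hAB
    have him := congrArg Complex.im hAB
    simp [hx0.ne'] at hre
    simp [hy0.ne'] at him
    exact ⟨by exact_mod_cast hre, by exact_mod_cast him⟩
  have hnorm : ∀ A B : ℤ, Complex.normSq (α * A + β * B) = (D₁ * A ^ 2 + D₂ * B ^ 2 : ℤ) := by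
    intro A B
    rw [hαx, hβy, Complex.normSq_apply]
    simp
    linear_combination A ^ 2 * hx + B ^ 2 * hy
  obtain ⟨m, σ, hσ, hm, hmX, -⟩ := solution_structure he (by rw [hα]) (by rw [hβ]) w X Y hXodd hXY
    (by rw [hY2, mul_one]; exact hw)
  have hσ2 : σ ^ 2 = 1 := by rcases hσ with rfl | rfl <;> norm_num
  obtain ⟨p, hp, hpa⟩ : ∃ p : ℕ, p.Prime ∧ (p : ℤ) ∣ a :=
    ⟨a.natAbs.minFac, Nat.minFac_prime (by omega), Int.natCast_dvd.2 (Nat.minFac_dvd _)⟩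
  obtain ⟨h, rfl⟩ : Odd p := by
    obtain ⟨c, rfl⟩ := hpa
    exact_mod_cast Int.Odd.of_mul_left haodd
  have hpD : ((2 * h + 1 : ℕ) : ℤ) ∣ D₁ := hpa.trans hdvd
  have hpX : ((2 * h + 1 : ℕ) : ℤ) ∣ X := hpa.trans (dvd_pow_self _ (by omega))
  obtain ⟨q, hq⟩ : (2 * h + 1) ∣ 2 * m + 1 := by
    have h1 := (dvd_sub_right (hpX.mul_left (2 ^ m))).1 (hpD.trans hmX)
    have hu : IsUnit (σ * e ^ m) :=
      (Int.isUnit_iff.2 hσ).mul ((Int.isUnit_iff.2 he).pow m)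
    exact_mod_cast hu.dvd_mul_left.1 h1
  obtain ⟨l, rfl⟩ : Odd q := by
    have h1 : Odd ((2 * h + 1) * q) := hq ▸ odd_two_mul_add_one m
    exact Nat.Odd.of_mul_right h1
  obtain ⟨U, V, hU, hUV, hUVpow⟩ := exists_coeffs he (n := n) (by rw [hα]) (by rw [hβ]) l
  have hV : Odd V := by
    obtain ⟨k, rfl⟩ := hU
    obtain ⟨c, hc⟩ := hUV
    exact ⟨k - 2 * c, by linarith⟩
  have hpow : (α * U + β * V) ^ (2 * h + 1) = 4 ^ h * (σ * (α * X + β * Y)) := by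
    have hσC : (σ : ℂ) ^ 2 = 1 := by exact_mod_cast hσ2
    rw [← hUVpow, hm, mul_pow, ← pow_mul, mul_comm (2 * l + 1), ← hq, pow_succ, pow_mul]
    norm_num
    linear_combination (-(4 ^ h * 2 * ((α + β) / 2) ^ (2 * m + 1))) * hσC
  have hsplit := add_pow_odd (α * U) (β * V) ((D₁ * U ^ 2 : ℤ) : ℂ) ((-D₂ * V ^ 2 : ℤ) : ℂ)
    (by rw [mul_pow, hα]; push_cast; ring) (by rw [mul_pow, hβ]; push_cast; ring) h
  set F : ℤ := ∑ i ∈ Finset.range (h + 1), (D₁ * U ^ 2) ^ i * (-D₂ * V ^ 2) ^ (h - i) *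
    ((2 * h + 1).choose (2 * i + 1) : ℕ) with hFdef
  set G : ℤ := ∑ i ∈ Finset.range (h + 1), (D₁ * U ^ 2) ^ i * (-D₂ * V ^ 2) ^ (h - i) *
    ((2 * h + 1).choose (2 * i) : ℕ) with hGdef
  obtain ⟨hUF, hVG⟩ := hinj (U * F) (V * G) (4 ^ h * σ * X) (4 ^ h * σ * Y) (by
    have e1 : α * (U * F : ℤ) + β * (V * G : ℤ) = (α * U + β * V) ^ (2 * h + 1) := by
      rw [hsplit, hFdef, hGdef]; push_cast; ring
    rw [e1, hpow]; push_cast; ring)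
  have hh0 : h ≠ 0 := by rintro rfl; exact hp.ne_one rfl
  have hcop4 : ∀ {z : ℤ}, Odd z → IsCoprime z (4 ^ h) := fun hz => by
    rw [show (4 : ℤ) = 2 ^ 2 by norm_num]
    exact ((Int.isCoprime_two_right.2 hz).pow_right).pow_right
  have hV2 : V ^ 2 = 1 := by
    have h1 : V ∣ 4 ^ h * (σ * Y) := ⟨G, by rw [hVG]; ring⟩
    have h2 := (hcop4 hV).dvd_of_dvd_mul_left h1
    have hu : IsUnit V := isUnit_of_dvd_unit h2 ((Int.isUnit_iff.2 hσ).mul (Int.isUnit_iff.2 hY))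
    rcases Int.isUnit_iff.1 hu with rfl | rfl <;> norm_num
  have hU1 : 1 ≤ U ^ 2 := by
    have : U ≠ 0 := by rintro rfl; simp at hU
    have := sq_pos_of_ne_zero this
    omega
  rcases Nat.lt_or_ge h 2 with hh | hh
  · obtain rfl : h = 1 := by omega
    have hG : G = 3 * (D₁ * U ^ 2) - D₂ := by
      rw [hGdef]
      simp [Finset.sum_range_succ, hV2, Nat.choose]
      ring
    have hG2 : G ^ 2 = 16 := by
      have : (V * G) ^ 2 = 16 := by rw [hVG]; linear_combination 16 * Y ^ 2 * hσ2 + 16 * hY2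
      linear_combination this - G ^ 2 * hV2
    have hG4 : G ≤ 4 := by nlinarith
    have : 3 * D₁ ≤ 3 * (D₁ * U ^ 2) := by nlinarith
    rcases he with rfl | rfl <;> omega
  · obtain ⟨F', hF'⟩ : (4 : ℤ) ^ h ∣ F := by
      refine IsCoprime.dvd_of_dvd_mul_left (hcop4 hU).symm ⟨σ * X, ?_⟩
      rw [hUF]; ring
    have hUF' : U * F' = σ * X := by
      refine mul_left_cancel₀ (pow_ne_zero h (four_ne_zero (α := ℤ))) ?_
      linear_combination hUF - U * hF'
    have hX0 : X ≠ 0 := by rintro h0; rw [h0] at hXodd; simp at hXodd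
    have hX2 : X ^ 2 = U ^ 2 * F' ^ 2 := by linear_combination -(U * F' + σ * X) * hUF' - X ^ 2 * hσ2
    have hF'X : F' ∣ X := by
      have h1 : F' ∣ σ * X := ⟨U, by rw [← hUF']; ring⟩
      exact (Int.isUnit_iff.2 hσ).dvd_mul_left.1 h1
    have hF'0 : F' ≠ 0 := by rintro rfl; exact hX0 (zero_dvd_iff.1 hF'X)
    have habs := abs_le_of_odd_part (f := D₁ * U ^ 2) (g := -D₂ * V ^ 2) hh hp (hpD.mul_right _)
      (by
        have hUD : IsCoprime (U ^ 2) D₂ := by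
          have h1 : U ∣ X := by
            have h2 : U ∣ σ * X := ⟨F', hUF'.symm⟩
            exact (Int.isUnit_iff.2 hσ).dvd_mul_left.1 h2
          exact ((hcopD.of_isCoprime_of_dvd_left hdvd).pow_left.of_isCoprime_of_dvd_left h1).pow_left
        rw [hV2, mul_one]
        exact (hcopD.mul_left hUD).neg_right) hF'0 ⟨4 ^ h, by rw [← hFdef, hF']; ring⟩
      (fun r hr hrF => by
        have := (Nat.prime_iff_prime_int.1 hr).dvd_of_dvd_pow (hrF.trans hF'X)
        exact (this.trans hdvd).mul_right _)
    have hNeq : (D₁ * U ^ 2 + D₂) ^ (2 * h + 1) = 16 ^ h * (D₁ * X ^ 2 + D₂) := by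
      have h1 := congrArg Complex.normSq hpow
      rw [map_pow, hnorm, map_mul, map_mul, map_pow, hnorm, hV2, hY2] at h1
      have h2 : Complex.normSq 4 = 16 := by rw [Complex.normSq_apply]; norm_num
      have h3 : Complex.normSq (σ : ℂ) = 1 := by
        rcases hσ with rfl | rfl <;> simp
      rw [h2, h3, one_mul, mul_one] at h1
      exact_mod_cast h1
    rw [hX2] at hNeq
    exact size_contradiction (by omega) (by omega) (by omega) hU1 hF'0 habs hh0 hNeq

/-- Two solutions with the same exponent `x` force `b = 2`, `s = 1` and
`r * a ^ x = 2 ^ n ± 1`, `c = 2 ^ n ∓ 1`. -/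
theorem IsSol.eq_two_pow {a b c r s : ℤ} (ha : 1 < a) (hb : 1 < b) (hc : 0 < c) (hr : 0 < r)
    (hs : 0 < s) (hgcd : Int.gcd (r * a) (s * b) = 1) {x y₁ y₂ : ℕ} (h₁ : IsSol a b c r s x y₁)
    (h₂ : IsSol a b c r s x y₂) (hlt : y₁ < y₂) :
    b = 2 ∧ s = 1 ∧ y₁ = 1 ∧ ∃ n : ℕ, 1 ≤ n ∧ y₂ = n + 1 ∧ ∃ e : ℤ, (e = 1 ∨ e = -1) ∧
      r * a ^ x = 2 ^ n + e ∧ c = 2 ^ n - e := by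
  obtain ⟨hx, hy₁, u₁, v₁, hu₁, hv₁, e₁⟩ := h₁
  obtain ⟨-, -, u₂, v₂, hu₂, hv₂, e₂⟩ := h₂
  obtain ⟨n, rfl⟩ := Nat.exists_eq_add_of_lt hlt
  have hcop : IsCoprime (r * a ^ x) (s * b ^ y₁) := by
    have h := (Int.isCoprime_iff_gcd_eq_one.2 hgcd).pow (m := x) (n := y₁)
    rw [mul_pow, mul_pow] at h
    exact (h.of_isCoprime_of_dvd_left (mul_dvd_mul (dvd_pow_self r hx.ne') dvd_rfl)
      ).of_isCoprime_of_dvd_right (mul_dvd_mul (dvd_pow_self s hy₁.ne') dvd_rfl)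
  have hA : 0 < r * a ^ x := by positivity
  have hB : 0 < s * b ^ y₁ := by positivity
  have hbb : b ≤ b ^ y₁ := le_self_pow₀ hb.le hy₁.ne'
  have hsb : b ^ y₁ ≤ s * b ^ y₁ := le_mul_of_one_le_left (by positivity) hs
  have hb2 : s * b ^ (y₁ + n + 1) = s * b ^ y₁ * b ^ (n + 1) := by ring
  have hbn : 2 ≤ b ^ (n + 1) := by
    have : b ≤ b ^ (n + 1) := le_self_pow₀ hb.le (by omega)
    omega
  have hB2 : s * b ^ y₁ * 2 ≤ s * b ^ y₁ * b ^ (n + 1) := mul_le_mul_of_nonneg_left hbn hB.le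
  have key : ∃ e : ℤ, (e = 1 ∨ e = -1) ∧ 2 * (r * a ^ x) = s * b ^ y₁ * (b ^ (n + 1) + e) ∧
      c = r * a ^ x - e * (s * b ^ y₁) := by
    rw [mul_assoc, mul_assoc] at e₁ e₂
    rw [hb2] at e₂
    generalize r * a ^ x = A at *
    generalize s * b ^ y₁ = B at *
    generalize hB' : B * b ^ (n + 1) = B' at *
    simp only [mul_add, hB']
    interval_cases u₁ <;> interval_cases v₁ <;> interval_cases u₂ <;> interval_cases v₂ <;>
      norm_num at e₁ e₂ <;>
      first
        | (exfalso; linarith)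
        | exact ⟨1, Or.inl rfl, by linarith, by linarith⟩
        | exact ⟨-1, Or.inr rfl, by linarith, by linarith⟩
  obtain ⟨e, he, h2A, hce⟩ := key
  have hdvd : s * b ^ y₁ ∣ 2 := hcop.symm.dvd_of_dvd_mul_right ⟨_, h2A⟩
  have hle := Int.le_of_dvd two_pos hdvd
  obtain rfl : b = 2 := by omega
  obtain rfl : y₁ = 1 := by
    by_contra hne
    have : (2 : ℤ) ^ 2 ≤ 2 ^ y₁ := pow_le_pow_right₀ (by norm_num) (by omega)
    omega
  obtain rfl : s = 1 := by omega
  refine ⟨rfl, rfl, rfl, n + 1, by omega, by omega, e, he, by linarith, by linarith⟩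

theorem eq_of_mul_pow_eq_prime {a r p : ℤ} (hp : Prime p) (hp0 : 0 < p) (ha : 1 < a) (hr : 0 < r)
    {x : ℕ} (hx : 0 < x) (h : r * a ^ x = p) : a = p ∧ r = 1 := by
  have hap : a ∣ p := h ▸ (dvd_pow_self a hx.ne').mul_left r
  have hass := (hp.irreducible.dvd_iff.1 hap).resolve_left
    (by rw [Int.isUnit_iff]; omega)
  have hae : a = p := Int.eq_of_associated_of_nonneg hass.symm (by omega) hp0.le
  refine ⟨hae, ?_⟩
  have h1 : a ≤ a ^ x := le_self_pow₀ ha.le hx.ne'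
  by_contra hne
  have h2 : 2 * a ^ x ≤ r * a ^ x := mul_le_mul_of_nonneg_right (by omega) (by positivity)
  omega

/-- There is no solution whose exponent of `a` is below the common exponent of the other two. -/
theorem no_smaller_exponent {a r e α β : ℤ} {n z k w : ℕ} (hn : 3 ≤ n) (he : e = 1 ∨ e = -1)
    (hα : α = 1 ∨ α = -1) (hβ : β = 1 ∨ β = -1) (ha : 3 ≤ a) (hr : 0 < r) (hz : 0 < z) (hk : 0 < k)
    (hA : r * a ^ (z + k) = 2 ^ n + e) (hex : ¬ (a = 3 ∧ r = 1 ∧ n = 3 ∧ e = 1))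
    (h : α * (r * a ^ z) + β * 2 ^ w = 2 ^ n - e) : False := by
  have haz : a ≤ a ^ z := le_self_pow₀ (by omega) hz.ne'
  have hak : a ≤ a ^ k := le_self_pow₀ (by omega) hk.ne'
  have hrz : a ^ z ≤ r * a ^ z := le_mul_of_one_le_left (by positivity) hr
  have hA' : r * a ^ z * a ^ k = 2 ^ n + e := by rw [← hA]; ring
  have h3 : r * a ^ z * 3 ≤ 2 ^ n + e := by
    rw [← hA']; exact mul_le_mul_of_nonneg_left (by omega) (by omega)
  have hP : (8 : ℤ) ≤ 2 ^ n := by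
    calc (8 : ℤ) = 2 ^ 3 := by norm_num
      _ ≤ 2 ^ n := pow_le_pow_right₀ (by norm_num) hn
  have hw0 : (0 : ℤ) < 2 ^ w := by positivity
  have hbig : (8 : ℤ) * e < 2 ^ n := by
    rcases he with rfl | rfl
    · rcases hn.lt_or_eq with hn' | rfl
      · calc (8 : ℤ) * 1 < 2 ^ 4 := by norm_num
          _ ≤ 2 ^ n := pow_le_pow_right₀ (by norm_num) hn'
      · exfalso
        have hd : a ^ z = 3 := by omega
        have hd' : r * a ^ z = 3 := by omega
        exact hex ⟨by omega, by rw [hd] at hd'; omega, rfl, rfl⟩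
    · omega
  have hβ1 : β = 1 := by
    rcases hβ with rfl | rfl
    · rfl
    · exfalso; rcases he with rfl | rfl <;> rcases hα with rfl | rfl <;> omega
  subst hβ1
  have h4 : (2 : ℤ) ^ w < 2 ^ (n + 1) := by
    rw [pow_succ]; rcases he with rfl | rfl <;> rcases hα with rfl | rfl <;> omega
  have h5 : (2 : ℤ) ^ n < 2 ^ (w + 1) := by
    rw [pow_succ]; rcases he with rfl | rfl <;> rcases hα with rfl | rfl <;> omega
  have h6 := (pow_lt_pow_iff_right₀ (one_lt_two (α := ℤ))).1 h4
  have h7 := (pow_lt_pow_iff_right₀ (one_lt_two (α := ℤ))).1 h5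
  obtain rfl : w = n := by omega
  rcases he with rfl | rfl <;> rcases hα with rfl | rfl <;> omega

/-- There is no solution whose exponent of `a` exceeds the common exponent of the other two. -/
theorem no_larger_exponent {a r e α β : ℤ} {n x k w : ℕ} (hn : 3 ≤ n) (he : e = 1 ∨ e = -1)
    (hα : α = 1 ∨ α = -1) (hβ : β = 1 ∨ β = -1) (ha : 3 ≤ a) (hodd : Odd a) (hx : 0 < x)
    (hk : 0 < k) (hA : r * a ^ x = 2 ^ n + e)
    (h : α * (r * a ^ (x + k)) + β * 2 ^ w = 2 ^ n - e) : False := by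
  have hak : a ≤ a ^ k := le_self_pow₀ (by omega) hk.ne'
  have hP : (8 : ℤ) ≤ 2 ^ n := by
    calc (8 : ℤ) = 2 ^ 3 := by norm_num
      _ ≤ 2 ^ n := pow_le_pow_right₀ (by norm_num) hn
  have hadvd : a ∣ 2 ^ n + e := hA ▸ (dvd_pow_self a hx.ne').mul_left r
  have hale : a ≤ 2 ^ n + e := Int.le_of_dvd (by rcases he with rfl | rfl <;> omega) hadvd
  have h' : α * ((2 ^ n + e) * a ^ k) + β * 2 ^ w = 2 ^ n - e := by
    rw [← h, ← hA]; ring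
  have h3 : (2 ^ n + e) * 3 ≤ (2 ^ n + e) * a ^ k :=
    mul_le_mul_of_nonneg_left (by omega) (by omega)
  have hw : n + 1 ≤ w := by
    by_contra hlt
    have : (2 : ℤ) ^ w ≤ 2 ^ n := pow_le_pow_right₀ (by norm_num) (by omega)
    have : (0 : ℤ) < 2 ^ w := by positivity
    generalize (2 ^ n + e) * a ^ k = M at *
    rcases he with rfl | rfl <;> rcases hα with rfl | rfl <;> rcases hβ with rfl | rfl <;> omega
  have hdvd : (2 : ℤ) ^ (n + 1) ∣ α * a ^ k + 1 := by
    obtain ⟨v, rfl⟩ := Nat.exists_eq_add_of_le hw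
    have hD : Odd ((2 : ℤ) ^ n + e) := by
      exact Even.add_odd ((even_two (α := ℤ)).pow_of_ne_zero (by omega))
        (by rcases he with rfl | rfl <;> decide)
    refine dvd_of_two_pow_dvd_mul_odd hD ⟨1 - β * 2 ^ v, ?_⟩
    linear_combination h'
  have hp : (2 : ℤ) ^ (n + 1) = 2 * 2 ^ n := by ring
  rcases hα with rfl | rfl
  · rw [one_mul] at hdvd
    rcases Nat.even_or_odd' k with ⟨j, rfl | rfl⟩
    · have h4 : (4 : ℤ) ∣ (a ^ j) ^ 2 + 1 := by
        rw [← pow_mul, mul_comm j]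
        exact (pow_dvd_pow (2 : ℤ) (by omega : 2 ≤ n + 1)).trans hdvd
      obtain ⟨i, hi⟩ : Odd (a ^ j) := hodd.pow
      rw [hi] at h4
      ring_nf at h4
      omega
    · have := Int.le_of_dvd (by omega) (two_pow_dvd_add_one hodd hdvd)
      rcases he with rfl | rfl <;> omega
  · have hdvd' : (2 : ℤ) ^ (n + 1) ∣ a ^ k - 1 := by
      have := (dvd_neg (α := ℤ)).2 hdvd
      rwa [show -(-1 * a ^ k + 1) = a ^ k - 1 by ring] at this
    rcases Nat.even_or_odd' k with ⟨j, rfl | rfl⟩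
    · obtain rfl : β = 1 := by
        rcases hβ with rfl | rfl
        · rfl
        · exfalso
          have : (0 : ℤ) < 2 ^ w := by positivity
          generalize (2 ^ n + e) * a ^ (2 * j) = M at *
          rcases he with rfl | rfl <;> omega
      obtain ⟨m, rfl⟩ := Nat.exists_eq_add_of_le' hn
      refine ne_two_pow (w := w) (j := j) he (by omega : 1 < a) (by omega) hadvd ?_
      rw [← pow_mul, mul_comm j]
      linarith
    · have := Int.le_of_dvd (by omega) (two_pow_dvd_sub_one hodd hdvd')
      rcases he with rfl | rfl <;> omega

theorem third_eq {a r e α β : ℤ} {n x z w : ℕ} (hn : 1 ≤ n) (he : e = 1 ∨ e = -1)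
    (hα : α = 1 ∨ α = -1) (hβ : β = 1 ∨ β = -1) (ha : 1 < a) (hr : 0 < r) (hx : 0 < x)
    (hz : 0 < z) (hA : r * a ^ x = 2 ^ n + e)
    (hex₁ : ¬ (a = 3 ∧ r = 1 ∧ (2 ^ n - e = 1 ∨ 2 ^ n - e = 5 ∨ 2 ^ n - e = 7)))
    (hex₂ : ¬ (a = 5 ∧ r = 1 ∧ 2 ^ n - e = 3))
    (h : α * (r * a ^ z) + β * 2 ^ w = 2 ^ n - e) : z = x ∧ (w = 1 ∨ w = n + 1) := by
  have hodd : Odd a := by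
    have h1 : Odd (r * a ^ x) := by
      rw [hA]
      obtain ⟨m, rfl⟩ := Nat.exists_eq_add_of_le' hn
      exact Even.add_odd ⟨2 ^ m, by ring⟩ (by rcases he with rfl | rfl <;> decide)
    exact (Int.odd_pow' hx.ne').1 (Int.Odd.of_mul_right h1)
  have ha3 : 3 ≤ a := by obtain ⟨k, rfl⟩ := hodd; omega
  have hn3 : 3 ≤ n := by
    by_contra hlt
    have hle : a ≤ 2 ^ n + e := by
      rw [← hA]
      exact (le_self_pow₀ ha.le hx.ne').trans (le_mul_of_one_le_left (by positivity) hr)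
    obtain rfl | rfl : n = 1 ∨ n = 2 := by omega
    · rcases he with rfl | rfl
      · obtain ⟨h1, h2⟩ := eq_of_mul_pow_eq_prime Int.prime_three (by norm_num) ha hr hx
          (hA.trans (by norm_num))
        exact hex₁ ⟨h1, h2, by norm_num⟩
      · omega
    · rcases he with rfl | rfl
      · obtain ⟨h1, h2⟩ := eq_of_mul_pow_eq_prime
          (Nat.prime_iff_prime_int.1 (by norm_num : Nat.Prime 5)) (by norm_num) ha hr hx
          (hA.trans (by norm_num))
        exact hex₂ ⟨h1, h2, by norm_num⟩
      · obtain ⟨h1, h2⟩ := eq_of_mul_pow_eq_prime Int.prime_three (by norm_num) ha hr hx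
          (hA.trans (by norm_num))
        exact hex₁ ⟨h1, h2, by norm_num⟩
  rcases lt_trichotomy z x with hlt | rfl | hlt
  · obtain ⟨k, rfl⟩ := Nat.exists_eq_add_of_le hlt.le
    refine (no_smaller_exponent hn3 he hα hβ ha3 hr hz (by omega) hA ?_ h).elim
    rintro ⟨h1, h2, rfl, rfl⟩
    exact hex₁ ⟨h1, h2, by norm_num⟩
  · refine ⟨rfl, ?_⟩
    have hinj : ∀ {i j : ℕ}, (2 : ℤ) ^ i = 2 ^ j → i = j := fun h =>
      pow_right_injective₀ two_pos (by norm_num) h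
    have hw0 : (0 : ℤ) < 2 ^ w := by positivity
    have hn0 : (0 : ℤ) < 2 ^ n := by positivity
    rw [hA] at h
    rcases hα with rfl | rfl
    · left
      refine hinj ?_
      rcases he with rfl | rfl <;> rcases hβ with rfl | rfl <;> omega
    · right
      refine hinj ?_
      rw [pow_succ]
      rcases he with rfl | rfl <;> rcases hβ with rfl | rfl <;> omega
  · obtain ⟨k, rfl⟩ := Nat.exists_eq_add_of_le hlt.le
    exact (no_larger_exponent hn3 he hα hβ ha3 hodd hx (by omega) hA h).elim

theorem neg_one_pow_of_le_one {u : ℕ} (hu : u ≤ 1) : (-1 : ℤ) ^ u = 1 ∨ (-1 : ℤ) ^ u = -1 := by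
  interval_cases u <;> simp

/-- If two solutions share the exponent `x`, every solution is one of the two. -/
theorem IsSol.eq_or_eq {a b c r s : ℤ} (ha : 1 < a) (hb : 1 < b) (hc : 0 < c) (hr : 0 < r)
    (hs : 0 < s) (hgcd : Int.gcd (r * a) (s * b) = 1) {x y₁ y₂ z w : ℕ}
    (h₁ : IsSol a b c r s x y₁) (h₂ : IsSol a b c r s x y₂) (hlt : y₁ < y₂)
    (hexc : (a, b, c, r, s) ≠ (3, 2, 1, 1, 1) ∧ (a, b, c, r, s) ≠ (3, 2, 5, 1, 1) ∧
      (a, b, c, r, s) ≠ (5, 2, 3, 1, 1) ∧ (a, b, c, r, s) ≠ (3, 2, 7, 1, 1))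
    (h₃ : IsSol a b c r s z w) : z = x ∧ (w = y₁ ∨ w = y₂) := by
  obtain ⟨rfl, rfl, rfl, n, hn, rfl, e, he, hA, rfl⟩ :=
    h₁.eq_two_pow ha hb hc hr hs hgcd h₂ hlt
  obtain ⟨hz, -, u, v, hu, hv, h⟩ := h₃
  obtain ⟨hx, -⟩ := h₁
  refine third_eq hn he (neg_one_pow_of_le_one hu) (neg_one_pow_of_le_one hv) ha hr hx hz hA ?_ ?_
    (by rw [← h]; ring)
  · rintro ⟨rfl, rfl, h1 | h1 | h1⟩ <;> simp [h1] at hexc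
  · rintro ⟨rfl, rfl, h1⟩
    simp [h1] at hexc

theorem stmt_3 (a b c r s : ℤ)
    (ha : 1 < a) (hb : 1 < b) (hc : 0 < c) (hr : 0 < r) (hs : 0 < s)
    (hgcd : Int.gcd (r * a) (s * b) = 1)
    (x₁ y₁ x₂ y₂ : ℕ)
    (h1 : IsSol a b c r s x₁ y₁) (h2 : IsSol a b c r s x₂ y₂)
    (hne : (x₁, y₁) ≠ (x₂, y₂)) (hx : x₁ = x₂)
    (hexc : (a, b, c, r, s) ≠ (3, 2, 1, 1, 1) ∧ (a, b, c, r, s) ≠ (3, 2, 5, 1, 1) ∧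
      (a, b, c, r, s) ≠ (5, 2, 3, 1, 1) ∧ (a, b, c, r, s) ≠ (3, 2, 7, 1, 1)) :
    ¬∃ x₃ y₃ : ℕ, IsSol a b c r s x₃ y₃ ∧
      (x₃, y₃) ≠ (x₁, y₁) ∧ (x₃, y₃) ≠ (x₂, y₂) := by
  rintro ⟨x₃, y₃, h3, hne1, hne2⟩
  subst hx
  have hy : y₁ ≠ y₂ := fun h => hne (by rw [h])
  rcases hy.lt_or_gt with hlt | hlt
  · obtain ⟨rfl, rfl | rfl⟩ := h1.eq_or_eq ha hb hc hr hs hgcd h2 hlt hexc h3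
    · exact hne1 rfl
    · exact hne2 rfl
  · obtain ⟨rfl, rfl | rfl⟩ := h2.eq_or_eq ha hb hc hr hs hgcd h1 hlt hexc h3
    · exact hne2 rfl
    · exact hne1 rfl
end

section
/- Let a>1, b>1, c>0, r>0, s>0 be integers with gcd(ra, sb)=1. If the equation (-1)^u·r·a^x + (-1)^v·s·b^y = c has two distinct solutions (x₁,y₁) and (x₂,y₂) in positive integers with x₁ ≤ x₂, then 2·r·a^(x₂) > c. If in addition there is a third solution (x₃,y₃), distinct from the first two, with x₃ ≥ x₂, then r·a^(x₃) > c. -/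
/-- The same solution, without signs: both terms are positive, neither base divides the
other term, and exactly three sign patterns remain. -/
theorem IsSol.terms {a b c r s : ℤ} (ha : 1 < a) (hb : 1 < b) (hc : 0 < c) (hr : 0 < r)
    (hs : 0 < s) (hgcd : Int.gcd (r * a) (s * b) = 1) {x y : ℕ} (h : IsSol a b c r s x y) :
    0 < r * a ^ x ∧ 0 < s * b ^ y ∧ a ∣ r * a ^ x ∧ b ∣ s * b ^ y ∧
      ¬ a ∣ s * b ^ y ∧ ¬ b ∣ r * a ^ x ∧
      (s * b ^ y = c - r * a ^ x ∨ s * b ^ y = r * a ^ x - c ∨ s * b ^ y = c + r * a ^ x) := by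
  obtain ⟨hx, hy, u, v, hu, hv, h⟩ := h
  have hA : 0 < r * a ^ x := by positivity
  have hB : 0 < s * b ^ y := by positivity
  have hco : IsCoprime (r * a) (s * b) := Int.isCoprime_iff_gcd_eq_one.mpr hgcd
  have hab : IsCoprime a (s * b ^ y) :=
    hco.of_mul_left_right.of_mul_right_left.mul_right
      hco.of_mul_left_right.of_mul_right_right.pow_right
  have hba : IsCoprime b (r * a ^ x) :=
    hco.symm.of_mul_left_right.of_mul_right_left.mul_right
      hco.symm.of_mul_left_right.of_mul_right_right.pow_right
  refine ⟨hA, hB, (dvd_pow_self a hx.ne').mul_left r, (dvd_pow_self b hy.ne').mul_left s,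
    fun hd => ?_, fun hd => ?_, ?_⟩
  · rcases Int.isUnit_iff.mp (hab.isUnit_of_dvd' dvd_rfl hd) with h | h <;> omega
  · rcases Int.isUnit_iff.mp (hba.isUnit_of_dvd' dvd_rfl hd) with h | h <;> omega
  · interval_cases u <;> interval_cases v <;>
      simp only [pow_zero, pow_one, one_mul, neg_mul] at h <;> omega

theorem exists_mul_pow_eq_of_lt {b s : ℤ} (hb : 1 < b) {m n : ℕ} (hmn : m < n) :
    ∃ q : ℤ, 2 ≤ q ∧ s * b ^ n = q * (s * b ^ m) := by
  refine ⟨b ^ (n - m), ?_, ?_⟩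
  · exact Int.add_one_le_iff.mpr (one_lt_pow₀ hb (by omega))
  · rw [← Nat.sub_add_cancel hmn.le, pow_add, Nat.add_sub_cancel]
    ring

theorem two_mul_mul_pow_le_of_lt {b s : ℤ} (hb : 1 < b) (hs : 0 < s) {m n : ℕ} (hmn : m < n) :
    2 * (s * b ^ m) ≤ s * b ^ n := by
  obtain ⟨q, hq, h⟩ := exists_mul_pow_eq_of_lt (s := s) hb hmn
  have : 0 < s * b ^ m := by positivity
  rw [h]
  gcongr

/-- Among solutions with `r * a ^ x < c`, the exponent `y` determines `x`. -/
theorem IsSol.left_unique {a b c r s : ℤ} (ha : 1 < a) (hb : 1 < b) (hc : 0 < c)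
    (hr : 0 < r) (hs : 0 < s) (hgcd : Int.gcd (r * a) (s * b) = 1)
    {x x' y : ℕ} (h : IsSol a b c r s x y) (h' : IsSol a b c r s x' y)
    (hx : r * a ^ x < c) (hx' : r * a ^ x' < c) : x = x' := by
  obtain ⟨hA, hB, -, -, -, -, e⟩ := h.terms ha hb hc hr hs hgcd
  obtain ⟨hA', -, -, -, -, -, e'⟩ := h'.terms ha hb hc hr hs hgcd
  rcases lt_trichotomy x x' with hlt | heq | hlt
  · have := two_mul_mul_pow_le_of_lt ha hr hlt
    omega
  · exact heq
  · have := two_mul_mul_pow_le_of_lt ha hr hlt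
    omega

theorem IsSol.not_both_small {a b c r s : ℤ} (ha : 1 < a) (hb : 1 < b) (hc : 0 < c)
    (hr : 0 < r) (hs : 0 < s) (hgcd : Int.gcd (r * a) (s * b) = 1)
    {x x' y y' : ℕ} (h : IsSol a b c r s x y) (h' : IsSol a b c r s x' y')
    (hx : 2 * (r * a ^ x) ≤ c) (hx' : 2 * (r * a ^ x') ≤ c) : ¬ y < y' := by
  intro hlt
  obtain ⟨hA, hB, haA, hbB, haB, hbA, e⟩ := h.terms ha hb hc hr hs hgcd
  obtain ⟨hA', hB', haA', -, -, -, e'⟩ := h'.terms ha hb hc hr hs hgcd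
  obtain ⟨q, hq, hqB⟩ := exists_mul_pow_eq_of_lt (s := s) hb hlt
  generalize r * a ^ x = A at *
  generalize r * a ^ x' = A' at *
  generalize s * b ^ y = B at *
  generalize s * b ^ y' = B' at *
  have hq3 : q ≤ 3 := by
    by_contra! hq4
    have : 4 * B ≤ q * B := by gcongr; omega
    omega
  interval_cases q
  · refine haB ?_
    obtain ⟨k, rfl⟩ := haA
    obtain ⟨l, rfl⟩ := haA'
    rcases e with e | e | e <;> rcases e' with e' | e' | e' <;> try omega
    · exact ⟨k + l, by linarith⟩
  · exact haB (by rwa [show B = A by omega])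

theorem IsSol.not_three_small {a b c r s : ℤ} (ha : 1 < a) (hb : 1 < b) (hc : 0 < c)
    (hr : 0 < r) (hs : 0 < s) (hgcd : Int.gcd (r * a) (s * b) = 1)
    {x₁ x y₁ y y' : ℕ} (h₁ : IsSol a b c r s x₁ y₁) (h : IsSol a b c r s x y)
    (h' : IsSol a b c r s x y') (hlt : x₁ < x) (hx : r * a ^ x < c)
    (hx' : c < 2 * (r * a ^ x)) : ¬ y < y' := by
  intro hy
  obtain ⟨hA₁, hB₁, haA₁, hbB₁, haB₁, hbA₁, e₁⟩ := h₁.terms ha hb hc hr hs hgcd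
  obtain ⟨hA, hB, haA, hbB, haB, hbA, e⟩ := h.terms ha hb hc hr hs hgcd
  obtain ⟨-, hB', -, -, -, -, e'⟩ := h'.terms ha hb hc hr hs hgcd
  have hBB' := two_mul_mul_pow_le_of_lt hb hs hy
  obtain ⟨p, hp, hpA⟩ := exists_mul_pow_eq_of_lt (s := r) ha hlt
  have hpA₁ : 2 * (r * a ^ x₁) ≤ p * (r * a ^ x₁) := by gcongr
  have hyy : y₁ < y' := by
    by_contra! hle
    rcases hle.lt_or_eq with hlt' | rfl
    · have := two_mul_mul_pow_le_of_lt hb hs hlt'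
      omega
    · omega
  obtain ⟨q, hq, hqB⟩ := exists_mul_pow_eq_of_lt (s := s) hb hyy
  generalize r * a ^ x = A at *
  generalize r * a ^ x₁ = A₁ at *
  generalize s * b ^ y = B at *
  generalize s * b ^ y' = B' at *
  generalize s * b ^ y₁ = B₁ at *
  have hq3 : q ≤ 3 := by
    by_contra! hq4
    have : 4 * B₁ ≤ q * B₁ := by gcongr; omega
    omega
  interval_cases q
  · refine haB₁ ?_
    obtain ⟨k, rfl⟩ := haA₁
    obtain ⟨l, rfl⟩ := haA
    rcases e₁ with e₁ | e₁ | e₁ <;> try omega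
    rw [show B' = c + a * l by omega] at hqB
    exact ⟨k + l, by linarith⟩
  · have hp3 : p < 3 := by
      by_contra! hp3
      have : 3 * A₁ ≤ p * A₁ := by gcongr
      omega
    interval_cases p
    exact hbA₁ (by rw [show A₁ = 2 * B by omega]; exact hbB.mul_left 2)

theorem stmt_4 (a b c r s : ℤ)
    (ha : 1 < a) (hb : 1 < b) (hc : 0 < c) (hr : 0 < r) (hs : 0 < s)
    (hgcd : Int.gcd (r * a) (s * b) = 1)
    (x₁ y₁ x₂ y₂ : ℕ)
    (h1 : IsSol a b c r s x₁ y₁) (h2 : IsSol a b c r s x₂ y₂)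
    (hne : (x₁, y₁) ≠ (x₂, y₂)) (hle : x₁ ≤ x₂) :
    2 * r * a ^ x₂ > c ∧
      ∀ x₃ y₃ : ℕ, IsSol a b c r s x₃ y₃ →
        (x₃, y₃) ≠ (x₁, y₁) → (x₃, y₃) ≠ (x₂, y₂) → x₂ ≤ x₃ →
        r * a ^ x₃ > c := by
  have step {x y x' y' : ℕ} (h : IsSol a b c r s x y) (h' : IsSol a b c r s x' y')
      (hne : (x, y) ≠ (x', y')) (hle : x ≤ x') : c < 2 * (r * a ^ x') := by
    by_contra! hsmall
    have hA : r * a ^ x ≤ r * a ^ x' := by gcongr; exact ha.le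
    have hA' : 0 < r * a ^ x' := by positivity
    rcases lt_trichotomy y y' with hlt | rfl | hlt
    · exact h.not_both_small ha hb hc hr hs hgcd h' (by omega) hsmall hlt
    · exact hne (by rw [h.left_unique ha hb hc hr hs hgcd h' (by omega) (by omega)])
    · exact h'.not_both_small ha hb hc hr hs hgcd h hsmall (by omega) hlt
  have h12 := step h1 h2 hne hle
  refine ⟨by linarith, fun x₃ y₃ h3 hne1 hne2 hle3 => ?_⟩
  by_contra! hsmall
  obtain ⟨hA₁, hB₁, -, -, -, -, e₁⟩ := h1.terms ha hb hc hr hs hgcd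
  obtain ⟨hA₂, hB₂, -, -, -, -, e₂⟩ := h2.terms ha hb hc hr hs hgcd
  obtain ⟨hA₃, hB₃, haA₃, -, haB₃, -, e₃⟩ := h3.terms ha hb hc hr hs hgcd
  have hlt3 : r * a ^ x₃ < c := by
    refine hsmall.lt_of_ne fun heq => haB₃ ?_
    rw [show s * b ^ y₃ = 2 * (r * a ^ x₃) by omega]
    exact haA₃.mul_left 2
  obtain rfl : x₂ = x₃ := by
    refine hle3.eq_of_not_lt fun hlt => ?_
    have := two_mul_mul_pow_le_of_lt ha hr hlt
    omega
  have hy23 : y₂ ≠ y₃ := fun h => hne2 (by rw [h])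
  rcases hle.lt_or_eq with hlt | rfl
  · rcases hy23.lt_or_gt with hy | hy
    · exact h1.not_three_small ha hb hc hr hs hgcd h2 h3 hlt hlt3 h12 hy
    · exact h1.not_three_small ha hb hc hr hs hgcd h3 h2 hlt hlt3 h12 hy
  · have hinj {m n : ℕ} (h : s * b ^ m = s * b ^ n) : m = n :=
      Int.pow_right_injective (by omega) (mul_left_cancel₀ hs.ne' h)
    have hy12 : s * b ^ y₁ ≠ s * b ^ y₂ := fun h => hne (by rw [hinj h])
    have hy13 : s * b ^ y₁ ≠ s * b ^ y₃ := fun h => hne1 (by rw [hinj h])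
    have hy23' : s * b ^ y₂ ≠ s * b ^ y₃ := fun h => hy23 (hinj h)
    omega
end
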